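/- Let Ω ⊂ ℝⁿ be an open domain with compact boundary of class C³, let p ∈ [1,∞), and suppose ρ satisfies Assumptions (A1) and (A2). Then for every ε ∈ (0,1], the nonlocal operator u ↦ P.V. ∫_Ω J_ε(·−y)(u(·)−u(y)) dy, initially defined on C_c²(Ω̄) ∩ W^{2,p}_M(Ω), extends to a bounded linear operator L_ε^Ω : W^{2,p}_M(Ω) → L^p(Ω) satisfying ‖L_ε^Ω u‖_{L^p(Ω)} ≤ c_Ω ‖u‖_{W^{2,p}(Ω)} for all u ∈ W^{2,p}_M(Ω), where c_Ω > 0 depends only on Ω, ρ and p (in particular it is independent of ε). -/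

import Mathlib

open MeasureTheory Filter Topology ENNReal Matrix

noncomputable section

abbrev EV (n : ℕ) := EuclideanSpace ℝ (Fin n)

/-- The kernel `J(x) = ρ(x)/|x|²`. -/
def kernelJ {n : ℕ} (ρ : EV n → ℝ) (x : EV n) : ℝ := ρ x / ‖x‖ ^ 2

/-- The rescaled density `ρ_ε(x) = ε^{-n} ρ(x/ε)`. -/
def scaled {n : ℕ} (ρ : EV n → ℝ) (ε : ℝ) (x : EV n) : ℝ := (ε ^ n)⁻¹ * ρ (ε⁻¹ • x)

/-- Assumption (A1): `ρ` is measurable, nonnegative, not a.e. zero, even,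
and `∫ ρ(x)(1+|x|) dx < ∞`. -/
def A1 {n : ℕ} (ρ : EV n → ℝ) : Prop :=
  Measurable ρ ∧ (∀ x, 0 ≤ ρ x) ∧ ¬ (ρ =ᵐ[volume] (fun _ => (0 : ℝ))) ∧
  (∀ᵐ x : EV n ∂volume, ρ (-x) = ρ x) ∧
  Integrable (fun x : EV n => ρ x * (1 + ‖x‖)) volume

/-- `L_ε u (x) = ∫_{ℝⁿ} J_ε(x-y) (u(x) - u(y) - ∇u(x)·(x-y)) dy`. -/
def nlOp {n : ℕ} (ρ : EV n → ℝ) (ε : ℝ) (u : EV n → ℝ) (x : EV n) : ℝ :=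
  ∫ y : EV n, kernelJ (scaled ρ ε) (x - y) * (u x - u y - fderiv ℝ u x (x - y))

/-- The classical partial derivative `∂ᵢ u`. -/
def partialD {n : ℕ} (i : Fin n) (u : EV n → ℝ) : EV n → ℝ :=
  fun x => fderiv ℝ u x (EuclideanSpace.single i 1)

/-- Iterated classical partial derivatives along a list of directions. -/
def partialDList {n : ℕ} : List (Fin n) → (EV n → ℝ) → (EV n → ℝ)
  | [], u => u
  | i :: l, u => partialD i (partialDList l u)

/-- The momentum matrix `M = (1/2)∫_{ℝⁿ} J(z) z ⊗ z dz`. -/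
def momentum {n : ℕ} (ρ : EV n → ℝ) : Matrix (Fin n) (Fin n) ℝ :=
  Matrix.of fun i j => (1 / 2 : ℝ) * ∫ z : EV n, kernelJ ρ z * z i * z j

/-- Multiplication of a vector of `ℝⁿ` by a matrix. -/
def mulVecE {m : ℕ} (Q : Matrix (Fin m) (Fin m) ℝ) (x : EV m) : EV m :=
  (WithLp.equiv 2 (Fin m → ℝ)).symm (Q.mulVec ((WithLp.equiv 2 (Fin m → ℝ)) x))

/-- The point `(z', zₙ) ∈ ℝⁿ` with first coordinates `z' ∈ ℝ^{n-1}` and last coordinate `zₙ`. -/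
def snocE {n : ℕ} (z' : EV n) (t : ℝ) : EV (n + 1) :=
  (WithLp.equiv 2 (Fin (n + 1) → ℝ)).symm
    (Fin.snoc ((WithLp.equiv 2 (Fin n → ℝ)) z') t)

/-- `v = ∂ᵢ u` weakly on `Ω`. -/
def WeakDerivOn {n : ℕ} (Ω : Set (EV n)) (i : Fin n) (u v : EV n → ℝ) : Prop :=
  ∀ φ : EV n → ℝ, ContDiff ℝ (⊤ : ℕ∞) φ → HasCompactSupport φ → tsupport φ ⊆ Ω →
    ∫ x in Ω, u x * partialD i φ x = - ∫ x in Ω, v x * φ x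

/-- `D` is a system of weak partial derivatives of `u` on `Ω` up to order `k`,
all lying in `L^p(Ω)`; i.e. `D` witnesses that `u ∈ W^{k,p}(Ω)`. -/
def IsSobDerivs {n : ℕ} (Ω : Set (EV n)) (k : ℕ) (p : ℝ≥0∞) (u : EV n → ℝ)
    (D : List (Fin n) → EV n → ℝ) : Prop :=
  D [] = u ∧
  (∀ l : List (Fin n), l.length < k → ∀ i : Fin n, WeakDerivOn Ω i (D l) (D (i :: l))) ∧
  (∀ l : List (Fin n), l.length ≤ k → MemLp (D l) p (volume.restrict Ω))

/-- `u ∈ W^{k,p}(Ω)`. -/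
def MemW {n : ℕ} (Ω : Set (EV n)) (k : ℕ) (p : ℝ≥0∞) (u : EV n → ℝ) : Prop :=
  ∃ D, IsSobDerivs Ω k p u D

/-- The `W^{k,p}`-norm computed from a system `D` of weak derivatives:
the sum of the `L^p` norms of all weak derivatives of order at most `k`. -/
def WNormD {n : ℕ} (k : ℕ) (p : ℝ≥0∞) (μ : Measure (EV n))
    (D : List (Fin n) → EV n → ℝ) : ℝ≥0∞ :=
  ∑' l : List (Fin n), if l.length ≤ k then eLpNorm (D l) p μ else 0

/-- The first `n` coordinates of a point of `ℝ^{n+1}`. -/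
def firstCoords {n : ℕ} (x : EV (n + 1)) : EV n :=
  (WithLp.equiv 2 (Fin n → ℝ)).symm (fun i => x i.castSucc)

/-- The curved half space `ℝⁿ_γ = {x : xₙ > γ(x₁,…,x_{n-1})}`. -/
def halfSpace {n : ℕ} (γ : EV n → ℝ) : Set (EV (n + 1)) :=
  {x : EV (n + 1) | γ (firstCoords x) < x (Fin.last n)}

/-- `γ ∈ C^k_b`: `γ` is `k` times continuously differentiable with bounded derivatives. -/
def Ckb {n : ℕ} (k : ℕ) (γ : EV n → ℝ) : Prop :=
  ContDiff ℝ k γ ∧ ∀ m : ℕ, m ≤ k → ∃ C : ℝ, ∀ x, ‖iteratedFDeriv ℝ m γ x‖ ≤ C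

/-- Assumption (A2): `ρ ∈ C¹(ℝⁿ∖{0})` with singularity bounds
`|ρ(x)| ≤ c₀|x|^{2-α-n}(1+|x|)^{-N}`, `|∇ρ(x)| ≤ c₁|x|^{1-α-n}(1+|x|)^{-N}` for some
`c₀, c₁ > 0`, `α ∈ (0,2)`, `N > 3-α`; and, with `A := √M`, the kernel satisfies
`∫_{ℝ^{n-1}} J(AQ(z', zₙ)) z' dz' = 0` for all `zₙ ∈ ℝ` and `Q ∈ SO(n)`.
(The ambient dimension is `n + 1`.) -/
def A2 {n : ℕ} (ρ : EV (n + 1) → ℝ) : Prop :=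
  ContDiffOn ℝ 1 ρ {(0 : EV (n + 1))}ᶜ ∧
  (∃ c₀ c₁ α N : ℝ, 0 < c₀ ∧ 0 < c₁ ∧ 0 < α ∧ α < 2 ∧ 3 - α < N ∧
    ∀ x : EV (n + 1), x ≠ 0 →
      |ρ x| ≤ c₀ * ‖x‖ ^ ((2 : ℝ) - α - (n + 1 : ℝ)) * (1 + ‖x‖) ^ (-N) ∧
      ‖fderiv ℝ ρ x‖ ≤ c₁ * ‖x‖ ^ ((1 : ℝ) - α - (n + 1 : ℝ)) * (1 + ‖x‖) ^ (-N)) ∧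
  (∃ A : Matrix (Fin (n + 1)) (Fin (n + 1)) ℝ, A.PosDef ∧ A * A = momentum ρ ∧
    ∀ t : ℝ, ∀ Q : Matrix (Fin (n + 1)) (Fin (n + 1)) ℝ, Qᵀ * Q = 1 → Q.det = 1 →
      (∫ z' : EV n, kernelJ ρ (mulVecE (A * Q) (snocE z' t)) • z') = 0)

/-- The homogeneous conormal boundary condition `M∇u · n = 0` on `∂Ω`, formulated weakly:
for any system of weak derivatives of `u ∈ W^{2,p}(Ω)` and any test function
`φ ∈ C_c^∞(ℝⁿ)`, Green's formula holds on `Ω` with no boundary contribution. -/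
def NeumannBC {m : ℕ} (Ω : Set (EV m)) (Mm : Matrix (Fin m) (Fin m) ℝ) (p : ℝ≥0∞)
    (u : EV m → ℝ) : Prop :=
  ∀ D : List (Fin m) → EV m → ℝ, IsSobDerivs Ω 2 p u D →
    ∀ φ : EV m → ℝ, ContDiff ℝ (⊤ : ℕ∞) φ → HasCompactSupport φ →
      (∑ i : Fin m, ∑ j : Fin m, Mm i j * ∫ x in Ω, D [i, j] x * φ x)
        = - ∑ i : Fin m, ∑ j : Fin m, Mm i j * ∫ x in Ω, D [j] x * partialD i φ x

/-- `u ∈ W^{k,p}(Ω)` together with the boundary condition `M∇u · n = 0` on `∂Ω`. -/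
def MemWN {m : ℕ} (Ω : Set (EV m)) (Mm : Matrix (Fin m) (Fin m) ℝ) (k : ℕ) (p : ℝ≥0∞)
    (u : EV m → ℝ) : Prop :=
  MemW Ω k p u ∧ NeumannBC Ω Mm p u

/-- `l` is the principal value `P.V. ∫_Ω J_ε(x-y)(u(x)-u(y)) dy` at the point `x`. -/
def pvAt {m : ℕ} (Ω : Set (EV m)) (ρ : EV m → ℝ) (ε : ℝ) (u : EV m → ℝ) (x : EV m)
    (l : ℝ) : Prop :=
  Tendsto
    (fun r : ℝ =>
      ∫ y in Ω ∩ {y : EV m | r ≤ dist x y}, kernelJ (scaled ρ ε) (x - y) * (u x - u y))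
    (𝓝[>] 0) (𝓝 l)

/-- `L` is a bounded linear extension to `W^{2,p}_M(Ω)` (Sobolev functions with the
boundary condition `M∇u · n = 0`), with operator bound `C`, of the nonlocal operator
`P.V. ∫_Ω J_ε(·-y)(u(·)-u(y)) dy` defined on `C_c²(cl Ω) ∩ W^{2,p}_M(Ω)`. -/
def IsNLExtOn {m : ℕ} (Ω : Set (EV m)) (Mm : Matrix (Fin m) (Fin m) ℝ) (ρ : EV m → ℝ)
    (p : ℝ≥0∞) (ε C : ℝ) (L : (EV m → ℝ) → EV m → ℝ) : Prop :=
  (∀ u : EV m → ℝ, ContDiff ℝ 2 u → HasCompactSupport u → MemWN Ω Mm 2 p u →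
    ∀ᵐ x ∂(volume.restrict Ω), pvAt Ω ρ ε u x (L u x)) ∧
  (∀ u v : EV m → ℝ, MemWN Ω Mm 2 p u → MemWN Ω Mm 2 p v → ∀ a b : ℝ,
    L (fun x => a * u x + b * v x) =ᵐ[volume.restrict Ω] fun x => a * L u x + b * L v x) ∧
  (∀ u : EV m → ℝ, MemWN Ω Mm 2 p u → MemLp (L u) p (volume.restrict Ω)) ∧
  (∀ u D, MemWN Ω Mm 2 p u → IsSobDerivs Ω 2 p u D →
    eLpNorm (L u) p (volume.restrict Ω)
      ≤ ENNReal.ofReal C * WNormD 2 p (volume.restrict Ω) D)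

/-- `Ω ⊆ ℝ^{n+1}` is an open set whose boundary is locally, up to a rotation, the region
above the graph of a `C^k` function with bounded derivatives (a domain of class `C^k`). -/
def IsGraphDomain {n : ℕ} (k : ℕ) (Ω : Set (EV (n + 1))) : Prop :=
  IsOpen Ω ∧ ∀ z ∈ frontier Ω,
    ∃ (U : Set (EV (n + 1))) (Q : Matrix (Fin (n + 1)) (Fin (n + 1)) ℝ) (γ : EV n → ℝ),
      IsOpen U ∧ z ∈ U ∧ Qᵀ * Q = 1 ∧ Q.det = 1 ∧ Ckb k γ ∧
      Ω ∩ U = (mulVecE Q '' halfSpace γ) ∩ U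

/-! ### Part 1: integral inequalities -/

theorem lintegral_rpow_jensen {β : Type*} [MeasurableSpace β] (ν : Measure β) [IsFiniteMeasure ν]
    (q : ℝ) (hq : 1 ≤ q) (f : β → ℝ≥0∞) (hf : Measurable f) :
    (∫⁻ t, f t ∂ν) ^ q ≤ ν Set.univ ^ (q - 1) * ∫⁻ t, f t ^ q ∂ν := by
  have h := eLpNorm'_le_eLpNorm'_mul_rpow_measure_univ (μ := ν) (f := f) (p := 1) (q := q)
    one_pos hq hf.aestronglyMeasurable
  simp only [eLpNorm', enorm_eq_self, ENNReal.rpow_one, div_one] at h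
  have h2 := ENNReal.rpow_le_rpow h (show 0 ≤ q by linarith)
  refine h2.trans (le_of_eq ?_)
  have hq0 : q ≠ 0 := by linarith
  rw [ENNReal.mul_rpow_of_nonneg _ _ (by linarith), ← ENNReal.rpow_mul, ← ENNReal.rpow_mul, mul_comm]
  congr 2
  · field_simp
  · rw [one_div_mul_cancel hq0, ENNReal.rpow_one]

theorem toReal_ge_one {p : ℝ≥0∞} (hp1 : 1 ≤ p) (hp : p ≠ ⊤) : 1 ≤ p.toReal := by
  rw [← ENNReal.toReal_one]
  exact (ENNReal.toReal_le_toReal ENNReal.one_ne_top hp).2 hp1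

theorem eLpNorm_le_iff_lint {α : Type*} [MeasurableSpace α] (μ : Measure α) {p : ℝ≥0∞}
    (hp1 : 1 ≤ p) (hp : p ≠ ⊤) (f : α → ℝ≥0∞) (C : ℝ≥0∞) :
    eLpNorm f p μ ≤ C ↔ ∫⁻ x, f x ^ p.toReal ∂μ ≤ C ^ p.toReal := by
  have hq := toReal_ge_one hp1 hp
  have h0 : p ≠ 0 := by rintro rfl; simp at hp1
  rw [eLpNorm_eq_lintegral_rpow_enorm_toReal h0 hp]
  simp only [enorm_eq_self, one_div]
  rw [ENNReal.rpow_inv_le_iff (by linarith)]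

/-- Minkowski type inequality for integrals against a finite measure. -/
theorem minkM {α β : Type*} [MeasurableSpace α] [MeasurableSpace β] (μ : Measure α) [SFinite μ]
    (ν : Measure β) [IsFiniteMeasure ν] {p : ℝ≥0∞} (hp1 : 1 ≤ p) (hp : p ≠ ⊤)
    (f : α → β → ℝ≥0∞) (hf : Measurable (Function.uncurry f)) (C : ℝ≥0∞)
    (h : ∀ᵐ t ∂ν, eLpNorm (fun x => f x t) p μ ≤ C) :
    eLpNorm (fun x => ∫⁻ t, f x t ∂ν) p μ ≤ ν Set.univ * C := by
  have hq := toReal_ge_one hp1 hp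
  rw [eLpNorm_le_iff_lint μ hp1 hp]
  set q := p.toReal
  calc ∫⁻ x, (∫⁻ t, f x t ∂ν) ^ q ∂μ ≤ ∫⁻ x, ν Set.univ ^ (q - 1) * ∫⁻ t, f x t ^ q ∂ν ∂μ := by
        refine lintegral_mono fun x => lintegral_rpow_jensen ν q hq _ ?_
        exact hf.comp measurable_prodMk_left
    _ = ν Set.univ ^ (q - 1) * ∫⁻ x, ∫⁻ t, f x t ^ q ∂ν ∂μ := by
        rw [lintegral_const_mul]
        exact (hf.pow_const q).lintegral_prod_right'
    _ = ν Set.univ ^ (q - 1) * ∫⁻ t, ∫⁻ x, f x t ^ q ∂μ ∂ν := by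
        rw [lintegral_lintegral_swap]
        exact (hf.pow_const q).aemeasurable
    _ ≤ ν Set.univ ^ (q - 1) * ∫⁻ t, C ^ q ∂ν := by
        gcongr 1
        refine lintegral_mono_ae ?_
        filter_upwards [h] with t ht
        exact (eLpNorm_le_iff_lint μ hp1 hp _ _).1 ht
    _ = (ν Set.univ * C) ^ q := by
        rw [lintegral_const, ENNReal.mul_rpow_of_nonneg _ _ (by linarith)]
        by_cases h0 : ν Set.univ = 0
        · rw [h0, mul_zero, mul_zero, ENNReal.zero_rpow_of_pos (by linarith), zero_mul]
        · have : ν Set.univ ^ q = ν Set.univ ^ (q - 1) * ν Set.univ := by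
            conv_rhs => rw [← ENNReal.rpow_one (ν Set.univ), ← ENNReal.rpow_mul, one_mul]
            rw [← ENNReal.rpow_add _ _ h0 (measure_ne_top _ _)]
            congr 1; ring
          rw [this]; ring

theorem eLpNorm_cmul_le {α : Type*} [MeasurableSpace α] (μ : Measure α) {p : ℝ≥0∞}
    (hp1 : 1 ≤ p) (hp : p ≠ ⊤) (f : α → ℝ≥0∞) (c : ℝ≥0∞) (hc : c ≠ ⊤) :
    eLpNorm (fun x => c * f x) p μ ≤ c * eLpNorm f p μ := by
  have hq := toReal_ge_one hp1 hp
  rw [eLpNorm_le_iff_lint μ hp1 hp, ENNReal.mul_rpow_of_nonneg _ _ (by linarith)]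
  simp only [ENNReal.mul_rpow_of_nonneg _ _ (show 0 ≤ p.toReal by linarith)]
  rw [lintegral_const_mul' _ _ (ENNReal.rpow_ne_top_of_nonneg (by linarith) hc)]
  gcongr
  exact (eLpNorm_le_iff_lint μ hp1 hp _ _).1 le_rfl

theorem eLpNorm_mono_e {α : Type*} [MeasurableSpace α] (μ : Measure α) {p : ℝ≥0∞}
    {f g : α → ℝ≥0∞} (h : ∀ᵐ x ∂μ, f x ≤ g x) : eLpNorm f p μ ≤ eLpNorm g p μ :=
  eLpNorm_mono_enorm_ae (by simpa using h)

theorem eLpNorm_add_e {α : Type*} [MeasurableSpace α] (μ : Measure α) {p : ℝ≥0∞}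
    (hp1 : 1 ≤ p) {f g : α → ℝ≥0∞} (hf : Measurable f) (hg : Measurable g) :
    eLpNorm (fun x => f x + g x) p μ ≤ eLpNorm f p μ + eLpNorm g p μ :=
  eLpNorm_add_le hf.aestronglyMeasurable hg.aestronglyMeasurable hp1

theorem eLpNorm_sum_e {α ι : Type*} [MeasurableSpace α] (μ : Measure α) {p : ℝ≥0∞}
    (hp1 : 1 ≤ p) (s : Finset ι) {f : ι → α → ℝ≥0∞} (hf : ∀ i ∈ s, Measurable (f i)) :
    eLpNorm (fun x => ∑ i ∈ s, f i x) p μ ≤ ∑ i ∈ s, eLpNorm (f i) p μ := by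
  have := eLpNorm_sum_le (μ := μ) (p := p) (s := s) (f := f)
    (fun i hi => (hf i hi).aestronglyMeasurable) hp1
  refine le_trans (le_of_eq ?_) this
  congr 1; ext x; simp

theorem eLpNorm_enorm_e {α : Type*} [MeasurableSpace α] (μ : Measure α) {p : ℝ≥0∞} (f : α → ℝ) :
    eLpNorm (fun x => ‖f x‖ₑ) p μ = eLpNorm f p μ :=
  eLpNorm_congr_enorm_ae (by simp)

theorem eLpNorm_union_e {α ι : Type*} [MeasurableSpace α] (μ : Measure α) {p : ℝ≥0∞}
    (hp1 : 1 ≤ p) (hp : p ≠ ⊤) (t : Finset ι) (V : ι → Set α) (S : Set α)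
    (hS : S ⊆ ⋃ i ∈ t, V i) (f : α → ℝ≥0∞) (C : ℝ≥0∞)
    (h : ∀ i ∈ t, eLpNorm f p (μ.restrict (V i)) ≤ C) :
    eLpNorm f p (μ.restrict S) ≤ t.card * C := by
  have hq := toReal_ge_one hp1 hp
  rw [eLpNorm_le_iff_lint _ hp1 hp]
  have h1 : ∫⁻ x in S, f x ^ p.toReal ∂μ ≤ ∑ i ∈ t, ∫⁻ x in V i, f x ^ p.toReal ∂μ := by
    refine (lintegral_mono_set hS).trans ?_
    clear hS h
    classical
    induction t using Finset.induction_on with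
    | empty => simp
    | insert a s ha ih =>
      rw [Finset.set_biUnion_insert, Finset.sum_insert ha]
      refine (lintegral_union_le _ _ _).trans ?_
      gcongr
  refine h1.trans ?_
  have h2 : ∑ i ∈ t, ∫⁻ x in V i, f x ^ p.toReal ∂μ ≤ ∑ i ∈ t, C ^ p.toReal :=
    Finset.sum_le_sum fun i hi => (eLpNorm_le_iff_lint _ hp1 hp _ _).1 (h i hi)
  refine h2.trans ?_
  rw [Finset.sum_const, nsmul_eq_mul, ENNReal.mul_rpow_of_nonneg _ _ (by linarith)]
  gcongr
  rcases Nat.eq_zero_or_pos t.card with h0 | h0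
  · simp [h0]
  · have : (1 : ℝ≥0∞) ≤ t.card := by exact_mod_cast h0
    calc (t.card : ℝ≥0∞) = (t.card : ℝ≥0∞) ^ (1 : ℝ) := by simp
      _ ≤ _ := ENNReal.rpow_le_rpow_of_exponent_le this hq

/-! ### Part 2: weak directional derivatives -/

/-- `g` is the weak derivative of `f` on `U` in direction `a`, for globally defined functions. -/
def WD {m : ℕ} (U : Set (EV m)) (a : EV m) (f g : EV m → ℝ) : Prop :=
  ∀ φ : EV m → ℝ, ContDiff ℝ (⊤ : ℕ∞) φ → HasCompactSupport φ → tsupport φ ⊆ U →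
    ∫ x, f x * fderiv ℝ φ x a = - ∫ x, g x * φ x

theorem isOpen_seg {m : ℕ} {U : Set (EV m)} (hU : IsOpen U) (a : EV m) :
    IsOpen {x : EV m | ∀ t ∈ Set.Icc (0 : ℝ) 1, x + t • a ∈ U} := by
  rw [Metric.isOpen_iff]
  intro x hx
  have hK : IsCompact ((fun t : ℝ => x + t • a) '' Set.Icc (0 : ℝ) 1) :=
    isCompact_Icc.image (by fun_prop)
  obtain ⟨δ, hδ, hsub⟩ := hK.exists_thickening_subset_open hU (by
    rintro _ ⟨t, ht, rfl⟩; exact hx t ht)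
  refine ⟨δ, hδ, fun y hy t ht => hsub ?_⟩
  rw [Metric.mem_thickening_iff]
  refine ⟨x + t • a, ⟨t, ht, rfl⟩, ?_⟩
  simpa using hy

theorem integrable_mul_cs {m : ℕ} {f φ : EV m → ℝ} (hf : LocallyIntegrable f volume)
    (hφ : Continuous φ) (hc : HasCompactSupport φ) : Integrable (fun x => f x * φ x) := by
  have := hf.integrable_smul_left_of_hasCompactSupport hφ hc
  simpa [mul_comm, smul_eq_mul] using this

theorem hasCompactSupport_dir {m : ℕ} {φ : EV m → ℝ} (hc : HasCompactSupport φ) (a : EV m) :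
    HasCompactSupport (fun x => fderiv ℝ φ x a) :=
  hc.fderiv_apply (𝕜 := ℝ) a

theorem cont_dir {m : ℕ} {φ : EV m → ℝ} (h : ContDiff ℝ 1 φ) (a : EV m) :
    Continuous (fun x => fderiv ℝ φ x a) :=
  (h.continuous_fderiv (by norm_num)).clm_apply continuous_const

/-- bounded shifts of a compactly supported function times a locally integrable one -/
theorem integrable_shift_prod {m : ℕ} {f φ : EV m → ℝ} (hf : LocallyIntegrable f volume)
    (hfm : Measurable f) (hφ : Continuous φ) (hc : HasCompactSupport φ) (a : EV m) :
    Integrable (fun z : EV m × ℝ => f z.1 * φ (z.1 - z.2 • a))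
      (volume.prod (volume.restrict (Set.Ioc (0 : ℝ) 1))) := by
  obtain ⟨B, hB⟩ := hc.exists_bound_of_continuous hφ
  obtain ⟨R, hR⟩ := hc.isCompact.isBounded.subset_closedBall 0
  set K : Set (EV m) := Metric.closedBall 0 (R + ‖a‖)
  have hK : IsCompact K := isCompact_closedBall _ _
  have h1 : Integrable (K.indicator (fun x => B * f x)) volume := by
    rw [integrable_indicator_iff hK.measurableSet]
    exact (hf.integrableOn_isCompact hK).const_mul B
  have h2 : Integrable (fun z : EV m × ℝ => K.indicator (fun x => B * f x) z.1)
      (volume.prod (volume.restrict (Set.Ioc (0 : ℝ) 1))) := h1.comp_fst _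
  refine h2.mono ?_ ?_
  · refine Measurable.aestronglyMeasurable ?_
    have : Measurable φ := hφ.measurable
    fun_prop
  · have hae : ∀ᵐ z : EV m × ℝ ∂(volume.prod (volume.restrict (Set.Ioc (0 : ℝ) 1))),
        z.2 ∈ Set.Ioc (0 : ℝ) 1 := by
      have hq : Measure.QuasiMeasurePreserving (Prod.snd : EV m × ℝ → ℝ)
        (volume.prod (volume.restrict (Set.Ioc (0 : ℝ) 1))) (volume.restrict (Set.Ioc (0 : ℝ) 1)) :=
        Measure.quasiMeasurePreserving_snd
      exact hq.ae (ae_restrict_mem measurableSet_Ioc)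
    filter_upwards [hae] with z hz
    by_cases hzK : z.1 ∈ K
    · rw [Set.indicator_of_mem hzK, norm_mul, norm_mul, mul_comm]
      gcongr
      exact (hB _).trans (le_abs_self B)
    · have : φ (z.1 - z.2 • a) = 0 := by
        by_contra hne
        have hmem := hR (subset_tsupport φ hne)
        apply hzK
        simp only [Metric.mem_closedBall, dist_zero_right, K] at hmem ⊢
        have h3 : ‖z.2 • a‖ ≤ ‖a‖ := by
          rw [norm_smul, Real.norm_eq_abs, abs_of_pos hz.1]
          nlinarith [norm_nonneg a, hz.2]
        calc ‖z.1‖ = ‖(z.1 - z.2 • a) + z.2 • a‖ := by simp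
          _ ≤ _ := (norm_add_le _ _).trans (add_le_add hmem h3)
      rw [this]; simp

theorem integrable_shift_prod' {m : ℕ} {f φ : EV m → ℝ} (hf : LocallyIntegrable f volume)
    (hfm : Measurable f) (hφ : Continuous φ) (hc : HasCompactSupport φ) (a : EV m) :
    Integrable (fun z : EV m × ℝ => f (z.1 + z.2 • a) * φ z.1)
      (volume.prod (volume.restrict (Set.Ioc (0 : ℝ) 1))) := by
  have h := integrable_shift_prod hf hfm hφ hc a
  have hφm : Measurable φ := hφ.measurable
  rw [integrable_prod_iff' (by
    refine Measurable.aestronglyMeasurable ?_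
    fun_prop)] at h ⊢
  obtain ⟨h1, h2⟩ := h
  constructor
  · filter_upwards [h1] with t ht
    have := ht.comp_add_right (t • a)
    simpa using this
  · refine h2.congr (Eventually.of_forall fun t => ?_)
    have := integral_add_right_eq_self (μ := (volume : Measure (EV m)))
      (fun x => ‖f x * φ (x - t • a)‖) (t • a)
    simp only [add_sub_cancel_right] at this
    exact this.symm

theorem seg_ftc {m : ℕ} {U : Set (EV m)} (hU : IsOpen U) {f g : EV m → ℝ} {p : ℝ≥0∞} (hp1 : 1 ≤ p)
    (hp : p ≠ ⊤)
    (hfm : Measurable f) (hgm : Measurable g) (hf : MemLp f p volume) (hg : MemLp g p volume)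
    (a : EV m) (hw : WD U a f g) :
    ∀ᵐ x, (∀ t ∈ Set.Icc (0 : ℝ) 1, x + t • a ∈ U) →
      f (x + a) - f x = ∫ t in Set.Ioc (0 : ℝ) 1, g (x + t • a) := by
  have hfl := hf.locallyIntegrable hp1
  have hgl := hg.locallyIntegrable hp1
  set ν : Measure ℝ := volume.restrict (Set.Ioc (0 : ℝ) 1) with hν
  have hνu : ν Set.univ = 1 := by simp [hν]
  set G : EV m → ℝ := fun x => ∫ t in Set.Ioc (0 : ℝ) 1, g (x + t • a) with hG
  have hGm : StronglyMeasurable G := by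
    have : StronglyMeasurable (fun z : EV m × ℝ => g (z.1 + z.2 • a)) :=
      Measurable.stronglyMeasurable (by fun_prop)
    exact this.integral_prod_right' (ν := ν)
  have hGp : MemLp G p volume := by
    refine ⟨hGm.aestronglyMeasurable, ?_⟩
    have h1 : eLpNorm (fun x => ∫⁻ t, ‖g (x + t • a)‖ₑ ∂ν) p volume
        ≤ ν Set.univ * eLpNorm g p volume := by
      refine minkM _ ν hp1 hp (fun x t => ‖g (x + t • a)‖ₑ) (by fun_prop) _ ?_
      refine Eventually.of_forall fun t => ?_
      rw [eLpNorm_enorm_e volume (fun x => g (x + t • a))]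
      refine le_of_eq ?_
      exact eLpNorm_comp_measurePreserving hg.1 (measurePreserving_add_right volume (t • a))
    refine lt_of_le_of_lt ((eLpNorm_mono_enorm fun x => ?_).trans h1) ?_
    · exact enorm_integral_le_lintegral_enorm _
    · rw [hνu, one_mul]; exact hg.2
  have hfa : MemLp (fun x => f (x + a)) p volume :=
    hf.comp_measurePreserving (measurePreserving_add_right volume a)
  have hh : MemLp (fun x => f (x + a) - f x - G x) p volume := (hfa.sub hf).sub hGp
  have key := (isOpen_seg hU a).ae_eq_zero_of_integral_contDiff_smul_eq_zero
    (f := fun x => f (x + a) - f x - G x) (μ := volume)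
    ((hh.locallyIntegrable hp1).locallyIntegrableOn _) ?_
  · filter_upwards [key] with x hx hxs
    have := hx hxs
    linarith
  intro φ hφ hφc hφS
  have hφ1 : ContDiff ℝ 1 φ := hφ.of_le (by exact_mod_cast le_top)
  have hφcont := hφ.continuous
  have i1 := integrable_mul_cs (hfa.locallyIntegrable hp1) hφcont hφc
  have i2 := integrable_mul_cs hfl hφcont hφc
  have i3 := integrable_mul_cs (hGp.locallyIntegrable hp1) hφcont hφc
  have i12 : Integrable (fun x => f (x + a) * φ x - f x * φ x) := i1.sub i2
  have e1 : ∫ x, φ x • (f (x + a) - f x - G x)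
      = (∫ x, f (x + a) * φ x) - (∫ x, f x * φ x) - ∫ x, G x * φ x := by
    rw [← integral_sub i1 i2, ← integral_sub i12 i3]
    refine integral_congr_ae (Eventually.of_forall fun x => ?_)
    simp only [smul_eq_mul]; ring
  rw [e1]
  have e2 : ∫ x, f (x + a) * φ x = ∫ x, f x * φ (x - a) := by
    have := integral_add_right_eq_self (μ := (volume : Measure (EV m)))
      (fun x => f x * φ (x - a)) a
    simp only [add_sub_cancel_right] at this
    exact this
  have e3 : ∫ x, G x * φ x = ∫ t, (∫ x, g (x + t • a) * φ x) ∂ν := by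
    rw [← integral_integral_swap (integrable_shift_prod' hgl hgm hφcont hφc a)]
    refine integral_congr_ae (Eventually.of_forall fun x => ?_)
    simp only [hG]
    rw [← integral_mul_const]
  have e4 : ∀ᵐ t ∂ν, ∫ x, g (x + t • a) * φ x = - ∫ x, f x * fderiv ℝ φ (x - t • a) a := by
    filter_upwards [ae_restrict_mem measurableSet_Ioc] with t ht
    have h1 := integral_add_right_eq_self (μ := (volume : Measure (EV m)))
      (fun x => g x * φ (x - t • a)) (t • a)
    simp only [add_sub_cancel_right] at h1
    rw [h1]
    have h2 := hw (fun x => φ (x - t • a)) (hφ.comp (contDiff_id.sub contDiff_const))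
      (hφc.comp_homeomorph (Homeomorph.subRight (t • a))) ?_
    · have h3 : ∀ x, fderiv ℝ (fun x => φ (x - t • a)) x = fderiv ℝ φ (x - t • a) := fun x => by
        simp only [sub_eq_add_neg]; rw [fderiv_comp_add_right]
      simp only [h3] at h2
      rw [h2, neg_neg]
    · intro y hy
      have h4 : y - t • a ∈ tsupport φ := by
        have := tsupport_comp_subset_preimage φ (f := fun x : EV m => x - t • a) (by fun_prop)
        exact this hy
      have := hφS h4 t ⟨ht.1.le, ht.2⟩
      simpa using this
  have e5 : ∫ t, (∫ x, f x * fderiv ℝ φ (x - t • a) a) ∂ν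
      = ∫ x, f x * (φ x - φ (x - a)) := by
    rw [← integral_integral_swap (integrable_shift_prod hfl hfm (cont_dir hφ1 a)
      (hasCompactSupport_dir hφc a) a)]
    refine integral_congr_ae (Eventually.of_forall fun x => ?_)
    simp only
    rw [integral_const_mul]
    congr 1
    have hd : ∀ t : ℝ, HasDerivAt (fun t : ℝ => - φ (x - t • a)) (fderiv ℝ φ (x - t • a) a) t := by
      intro t
      have h1 : HasFDerivAt φ (fderiv ℝ φ (x - t • a)) (x - t • a) :=
        (hφ1.differentiable (by norm_num) _).hasFDerivAt
      have h2 : HasDerivAt (fun t : ℝ => x - t • a) (-a) t := by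
        simpa using ((hasDerivAt_id t).smul_const a).const_sub x
      have h5 := (h1.comp_hasDerivAt t h2).neg
      rw [map_neg, neg_neg] at h5
      exact h5
    have := intervalIntegral.integral_eq_sub_of_hasDerivAt (a := 0) (b := 1)
      (fun t _ => hd t) (Continuous.intervalIntegrable (by
        exact (cont_dir hφ1 a).comp (by fun_prop)) _ _)
    rw [intervalIntegral.integral_of_le zero_le_one] at this
    rw [hν, this]; simp; ring
  rw [e2, e3, integral_congr_ae e4, integral_neg, e5]
  have i4 : Integrable (fun x => f x * φ (x - a)) := integrable_mul_cs hfl (hφcont.comp (continuous_sub_right a))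
    (hφc.comp_homeomorph (Homeomorph.subRight a))
  have : ∫ x, f x * (φ x - φ (x - a)) = (∫ x, f x * φ x) - ∫ x, f x * φ (x - a) := by
    rw [← integral_sub i2 i4]
    refine integral_congr_ae (Eventually.of_forall fun x => ?_)
    simp [mul_sub]
  rw [this]; ring

/-- smooth approximation of a `C¹` compactly supported function -/
theorem mollify {m : ℕ} {φ : EV m → ℝ} (hφ : ContDiff ℝ 1 φ) (hc : HasCompactSupport φ) (a : EV m)
    {δ : ℝ} (hδ : 0 < δ) {η : ℝ} (hη : 0 < η) :
    ∃ χ : EV m → ℝ, ContDiff ℝ (⊤ : ℕ∞) χ ∧ tsupport χ ⊆ Metric.cthickening δ (tsupport φ) ∧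
      (∀ x, |χ x - φ x| ≤ η) ∧ ∀ x, |fderiv ℝ χ x a - fderiv ℝ φ x a| ≤ η := by
  have hu1 := hc.uniformContinuous_of_continuous hφ.continuous
  have hu2 := (hasCompactSupport_dir hc a).uniformContinuous_of_continuous (cont_dir hφ a)
  rw [Metric.uniformContinuous_iff] at hu1 hu2
  obtain ⟨d1, hd1, h1⟩ := hu1 η hη
  obtain ⟨d2, hd2, h2⟩ := hu2 η hη
  set d := min δ (min d1 d2) with hd
  have hdpos : 0 < d := by positivity
  let b : ContDiffBump (0 : EV m) := ⟨d / 2, d, by positivity, by linarith⟩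
  have hbr : b.rOut = d := rfl
  have hbl : LocallyIntegrable (b.normed (volume : Measure (EV m))) volume :=
    b.continuous_normed.locallyIntegrable
  refine ⟨convolution (b.normed volume) φ (ContinuousLinearMap.lsmul ℝ ℝ) volume, ?_, ?_, ?_, ?_⟩
  · exact b.hasCompactSupport_normed.contDiff_convolution_left _ b.contDiff_normed
      hφ.continuous.locallyIntegrable
  · refine closure_minimal ?_ Metric.isClosed_cthickening
    refine (support_convolution_subset _).trans ?_
    rintro _ ⟨y, hy, z, hz, rfl⟩
    rw [b.support_normed_eq, hbr] at hy
    refine Metric.mem_cthickening_of_dist_le (y + z) z δ _ (subset_tsupport _ hz) ?_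
    simp only [Metric.mem_ball, dist_zero_right] at hy
    have : dist (y + z) z = ‖y‖ := by simp [dist_eq_norm]
    rw [this]
    exact hy.le.trans (min_le_left _ _)
  · intro x
    have := ContDiffBump.dist_normed_convolution_le (φ := b) (μ := volume) (g := φ) (x₀ := x) (ε := η)
      hφ.continuous.aestronglyMeasurable (fun y hy => (h1 (lt_of_lt_of_le (Metric.mem_ball.1 hy)
        ((min_le_right _ _).trans (min_le_left _ _)))).le)
    rwa [Real.dist_eq] at this
  · intro x
    have hF := (hc.hasFDerivAt_convolution_right (ContinuousLinearMap.lsmul ℝ ℝ) hbl hφ x)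
    rw [hF.fderiv, convolution_precompR_apply _ hbl (hc.fderiv (𝕜 := ℝ))
      (hφ.continuous_fderiv (by norm_num))]
    have := ContDiffBump.dist_normed_convolution_le (φ := b) (μ := volume)
      (g := fun y => fderiv ℝ φ y a) (x₀ := x) (ε := η)
      (cont_dir hφ a).aestronglyMeasurable (fun y hy => (h2 (lt_of_lt_of_le (Metric.mem_ball.1 hy)
        ((min_le_right _ _).trans (min_le_right _ _)))).le)
    rwa [Real.dist_eq] at this

theorem abs_integral_mul_le {m : ℕ} {f ψ : EV m → ℝ} (hf : LocallyIntegrable f volume)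
    {K : Set (EV m)} (hK : IsCompact K) (hψ : ∀ x, x ∉ K → ψ x = 0) {η : ℝ}
    (hη : ∀ x, |ψ x| ≤ η) : |∫ x, f x * ψ x| ≤ η * ∫ x in K, |f x| := by
  have h1 : ∫ x, f x * ψ x = ∫ x in K, f x * ψ x := by
    rw [setIntegral_eq_integral_of_forall_compl_eq_zero]
    intro x hx; rw [hψ x hx, mul_zero]
  rw [h1, ← integral_const_mul, ← Real.norm_eq_abs]
  refine norm_integral_le_of_norm_le ((hf.integrableOn_isCompact hK).abs.const_mul η) ?_
  refine Eventually.of_forall fun x => ?_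
  rw [norm_mul, Real.norm_eq_abs, Real.norm_eq_abs, mul_comm]
  gcongr
  exact hη x

theorem wd_C1 {m : ℕ} {U : Set (EV m)} (hU : IsOpen U) {f g : EV m → ℝ}
    (hf : LocallyIntegrable f volume) (hg : LocallyIntegrable g volume) {a : EV m}
    (hw : WD U a f g) (φ : EV m → ℝ) (hφ : ContDiff ℝ 1 φ) (hc : HasCompactSupport φ)
    (hs : tsupport φ ⊆ U) : ∫ x, f x * fderiv ℝ φ x a = - ∫ x, g x * φ x := by
  obtain ⟨δ, hδ, hsub⟩ := hc.isCompact.exists_cthickening_subset_open hU hs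
  set K := Metric.cthickening δ (tsupport φ)
  have hK : IsCompact K := hc.isCompact.cthickening
  have hKz : tsupport φ ⊆ K := Metric.self_subset_cthickening _
  set Cf := ∫ x in K, |f x|
  set Cg := ∫ x in K, |g x|
  have hCf : 0 ≤ Cf := integral_nonneg fun x => abs_nonneg _
  have hCg : 0 ≤ Cg := integral_nonneg fun x => abs_nonneg _
  suffices h : ∀ η : ℝ, 0 < η →
      |(∫ x, f x * fderiv ℝ φ x a) + ∫ x, g x * φ x| ≤ η * (Cf + Cg) by
    have h0 : |(∫ x, f x * fderiv ℝ φ x a) + ∫ x, g x * φ x| ≤ 0 := by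
      refine le_of_forall_pos_le_add fun e he => ?_
      have := h (e / (Cf + Cg + 1)) (by positivity)
      refine this.trans ?_
      rw [zero_add, div_mul_eq_mul_div, div_le_iff₀ (by positivity)]
      nlinarith
    have := abs_eq_zero.1 (le_antisymm h0 (abs_nonneg _))
    linarith
  intro η hη
  obtain ⟨χ, hχ, hχs, hχ1, hχ2⟩ := mollify hφ hc a hδ hη
  have hχc : HasCompactSupport χ := HasCompactSupport.of_support_subset_isCompact hK
    ((subset_tsupport _).trans hχs)
  have hχ1' : ContDiff ℝ 1 χ := hχ.of_le (by exact_mod_cast le_top)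
  have hwd := hw χ hχ hχc (hχs.trans hsub)
  have i1 := integrable_mul_cs hf (cont_dir hφ a) (hasCompactSupport_dir hc a)
  have i2 := integrable_mul_cs hf (cont_dir hχ1' a) (hasCompactSupport_dir hχc a)
  have i3 := integrable_mul_cs hg hφ.continuous hc
  have i4 := integrable_mul_cs hg hχ.continuous hχc
  have hz : ∀ {ψ : EV m → ℝ}, tsupport ψ ⊆ K → ∀ x, x ∉ K → ψ x = 0 := fun h x hx =>
    image_eq_zero_of_notMem_tsupport fun h' => hx (h h')
  have hz' : ∀ {ψ : EV m → ℝ}, tsupport ψ ⊆ K → ∀ x, x ∉ K → fderiv ℝ ψ x a = 0 :=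
    fun {ψ} h x hx => by
      have := image_eq_zero_of_notMem_tsupport (f := fderiv ℝ ψ) (x := x)
        fun h' => hx (h (tsupport_fderiv_subset ℝ h'))
      rw [this]; rfl
  have b1 := abs_integral_mul_le hf hK (ψ := fun x => fderiv ℝ χ x a - fderiv ℝ φ x a)
    (fun x hx => by rw [hz' hχs x hx, hz' hKz x hx, sub_zero]) hχ2
  have b2 := abs_integral_mul_le hg hK (ψ := fun x => χ x - φ x)
    (fun x hx => by rw [hz hχs x hx, hz hKz x hx, sub_zero]) hχ1
  simp only [mul_sub] at b1 b2
  rw [integral_sub i2 i1] at b1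
  rw [integral_sub i4 i3] at b2
  have : (∫ x, f x * fderiv ℝ φ x a) + ∫ x, g x * φ x =
    -((∫ x, f x * fderiv ℝ χ x a) - (∫ x, f x * fderiv ℝ φ x a))
      - ((∫ x, g x * χ x) - ∫ x, g x * φ x) := by rw [hwd]; ring
  rw [this]
  refine (abs_sub _ _).trans ?_
  rw [abs_neg]
  linarith [mul_add η Cf Cg]

/-- uniqueness of weak derivatives -/
theorem wd_unique {m : ℕ} {U : Set (EV m)} (hU : IsOpen U) {f f' g g' : EV m → ℝ} {a : EV m}
    (hg : LocallyIntegrable g volume) (hg' : LocallyIntegrable g' volume)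
    (hff : ∀ᵐ x, f x = f' x) (hw : WD U a f g) (hw' : WD U a f' g') :
    ∀ᵐ x, x ∈ U → g x = g' x := by
  have key := hU.ae_eq_zero_of_integral_contDiff_smul_eq_zero
    (f := fun x => g x - g' x) (μ := volume) ((hg.sub hg').locallyIntegrableOn _) ?_
  · filter_upwards [key] with x hx hxs
    linarith [hx hxs]
  intro φ hφ hφc hφS
  have i1 := integrable_mul_cs hg hφ.continuous hφc
  have i2 := integrable_mul_cs hg' hφ.continuous hφc
  have h1 := hw φ hφ hφc hφS
  have h2 := hw' φ hφ hφc hφS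
  have h3 : ∫ x, f x * fderiv ℝ φ x a = ∫ x, f' x * fderiv ℝ φ x a :=
    integral_congr_ae (by filter_upwards [hff] with x hx; rw [hx])
  have : ∫ x, φ x • (g x - g' x) = (∫ x, g x * φ x) - ∫ x, g' x * φ x := by
    rw [← integral_sub i1 i2]
    refine integral_congr_ae (Eventually.of_forall fun x => ?_)
    simp only [smul_eq_mul]; ring
  rw [this]; linarith

lemma mulVecE_apply {m : ℕ} (Q : Matrix (Fin m) (Fin m) ℝ) (x : EV m) (i : Fin m) :
    mulVecE Q x i = ∑ j, Q i j * x j := rfl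

lemma mulVecE_mul {m : ℕ} (A B : Matrix (Fin m) (Fin m) ℝ) (x : EV m) :
    mulVecE (A * B) x = mulVecE A (mulVecE B x) := by
  simp [mulVecE, Matrix.mulVec_mulVec]

lemma mulVecE_one {m : ℕ} (x : EV m) : mulVecE 1 x = x := by
  simp [mulVecE]

/-- `mulVecE` as a continuous linear map. -/
def mulVecL {m : ℕ} (Q : Matrix (Fin m) (Fin m) ℝ) : EV m →L[ℝ] EV m :=
  LinearMap.toContinuousLinearMap (Matrix.toEuclideanLin Q)

lemma mulVecL_apply {m : ℕ} (Q : Matrix (Fin m) (Fin m) ℝ) (x : EV m) :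
    mulVecL Q x = mulVecE Q x := rfl

lemma mulVecE_smul {m : ℕ} (Q : Matrix (Fin m) (Fin m) ℝ) (c : ℝ) (x : EV m) :
    mulVecE Q (c • x) = c • mulVecE Q x := (mulVecL Q).map_smul c x

lemma mulVecE_add {m : ℕ} (Q : Matrix (Fin m) (Fin m) ℝ) (x y : EV m) :
    mulVecE Q (x + y) = mulVecE Q x + mulVecE Q y := (mulVecL Q).map_add x y

lemma mulVecE_sub {m : ℕ} (Q : Matrix (Fin m) (Fin m) ℝ) (x y : EV m) :
    mulVecE Q (x - y) = mulVecE Q x - mulVecE Q y := (mulVecL Q).map_sub x y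

lemma mulVecE_neg {m : ℕ} (Q : Matrix (Fin m) (Fin m) ℝ) (x : EV m) :
    mulVecE Q (-x) = - mulVecE Q x := (mulVecL Q).map_neg x

lemma continuous_mulVecE {m : ℕ} (Q : Matrix (Fin m) (Fin m) ℝ) :
    Continuous (mulVecE Q) := (mulVecL Q).continuous

lemma inner_eq_sum {m : ℕ} (x y : EV m) : inner ℝ x y = ∑ i, x i * y i := by
  rw [PiLp.inner_apply]; exact Finset.sum_congr rfl fun i _ => by simp [mul_comm]

lemma inner_mulVecE {m : ℕ} (Q : Matrix (Fin m) (Fin m) ℝ) (x y : EV m) :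
    inner ℝ (mulVecE Q x) y = inner ℝ x (mulVecE Qᵀ y) := by
  simp only [inner_eq_sum, mulVecE_apply, Finset.sum_mul, Finset.mul_sum, Matrix.transpose_apply]
  rw [Finset.sum_comm]
  exact Finset.sum_congr rfl fun i _ => Finset.sum_congr rfl fun j _ => by ring

lemma norm_mulVecE {m : ℕ} {Q : Matrix (Fin m) (Fin m) ℝ} (hQ : Qᵀ * Q = 1) (x : EV m) :
    ‖mulVecE Q x‖ = ‖x‖ := by
  have : ‖mulVecE Q x‖ ^ 2 = ‖x‖ ^ 2 := by
    rw [← real_inner_self_eq_norm_sq, ← real_inner_self_eq_norm_sq, inner_mulVecE, ← mulVecE_mul,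
      hQ, mulVecE_one]
  exact (sq_eq_sq₀ (norm_nonneg _) (norm_nonneg _)).1 this

lemma snocE_castSucc {n : ℕ} (y : EV n) (t : ℝ) (i : Fin n) : snocE y t i.castSucc = y i := by
  simp [snocE]

lemma snocE_last {n : ℕ} (y : EV n) (t : ℝ) : snocE y t (Fin.last n) = t := by
  simp [snocE]

lemma firstCoords_apply {n : ℕ} (x : EV (n+1)) (i : Fin n) : firstCoords x i = x i.castSucc := rfl

lemma firstCoords_snocE {n : ℕ} (y : EV n) (t : ℝ) : firstCoords (snocE y t) = y := by
  ext i; rw [firstCoords_apply, snocE_castSucc]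

lemma snocE_firstCoords {n : ℕ} (x : EV (n+1)) : snocE (firstCoords x) (x (Fin.last n)) = x := by
  ext i; refine Fin.lastCases ?_ (fun i => ?_) i
  · rw [snocE_last]
  · rw [snocE_castSucc, firstCoords_apply]

lemma norm_sq_succ {n : ℕ} (x : EV (n+1)) :
    ‖x‖ ^ 2 = ‖firstCoords x‖ ^ 2 + (x (Fin.last n)) ^ 2 := by
  rw [EuclideanSpace.real_norm_sq_eq, EuclideanSpace.real_norm_sq_eq, Fin.sum_univ_castSucc]
  rfl

lemma norm_firstCoords_le {n : ℕ} (x : EV (n+1)) : ‖firstCoords x‖ ≤ ‖x‖ := by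
  have := norm_sq_succ x
  exact abs_le_of_sq_le_sq' (by nlinarith [sq_nonneg (x (Fin.last n))]) (norm_nonneg _) |>.2

lemma norm_snocE_ge {n : ℕ} (y : EV n) (t : ℝ) : ‖y‖ ≤ ‖snocE y t‖ := by
  simpa [firstCoords_snocE] using norm_firstCoords_le (snocE y t)

lemma snocE_mp {n : ℕ} :
    MeasurePreserving (fun q : EV n × ℝ => snocE q.1 q.2) (volume.prod volume) volume := by
  have h1 := (volume_preserving_piFinSuccAbove (fun _ : Fin (n + 1) => ℝ) (Fin.last n)).symm
  have h2 := PiLp.volume_preserving_toLp (Fin (n+1))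
  have h3 := PiLp.volume_preserving_ofLp (Fin n)
  have h4 : MeasurePreserving (fun q : EV n × ℝ => (q.2, (WithLp.ofLp q.1 : Fin n → ℝ)))
      (volume.prod volume) (volume.prod volume) :=
    (MeasurePreserving.prod (MeasurePreserving.id volume) h3).comp
      (Measure.measurePreserving_swap)
  have h5 := (h2.comp h1).comp h4
  have e : (fun q : EV n × ℝ => snocE q.1 q.2) =
      ((WithLp.toLp 2 : (Fin (n+1) → ℝ) → EV (n+1)) ∘
        ((MeasurableEquiv.piFinSuccAbove (fun _ : Fin (n + 1) => ℝ) (Fin.last n)).symm)) ∘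
        (fun q : EV n × ℝ => (q.2, (WithLp.ofLp q.1 : Fin n → ℝ))) := by
    funext q
    ext i
    simp [snocE, MeasurableEquiv.piFinSuccAbove, Fin.insertNthEquiv]
  rw [e]
  exact h5

lemma mp_lintegral {n : ℕ} (f : EV (n+1) → ℝ≥0∞) (hf : Measurable f) :
    ∫⁻ x, f x = ∫⁻ y : EV n, ∫⁻ t : ℝ, f (snocE y t) := by
  rw [← snocE_mp.lintegral_comp hf, lintegral_prod]
  exact (hf.comp snocE_mp.measurable).aemeasurable

lemma det_mulVecL {m : ℕ} (B : Matrix (Fin m) (Fin m) ℝ) :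
    LinearMap.det (mulVecL B : EV m →ₗ[ℝ] EV m) = B.det := by
  have : (mulVecL B : EV m →ₗ[ℝ] EV m) = Matrix.toLin (EuclideanSpace.basisFun (Fin m) ℝ).toBasis
      (EuclideanSpace.basisFun (Fin m) ℝ).toBasis B := by
    rw [← Matrix.toEuclideanLin_eq_toLin_orthonormal]; rfl
  rw [this, LinearMap.det_toLin]

lemma map_mulVecE {m : ℕ} {B : Matrix (Fin m) (Fin m) ℝ} (hB : B.det ≠ 0) :
    Measure.map (mulVecE B) (volume : Measure (EV m)) = ENNReal.ofReal |B.det⁻¹| • volume := by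
  have := Measure.map_linearMap_addHaar_eq_smul_addHaar (volume : Measure (EV m))
    (f := (mulVecL B : EV m →ₗ[ℝ] EV m)) (by rwa [det_mulVecL])
  rw [det_mulVecL] at this
  exact this

lemma lintegral_mulVecE {m : ℕ} {B : Matrix (Fin m) (Fin m) ℝ} (hB : B.det ≠ 0)
    (f : EV m → ℝ≥0∞) (hf : Measurable f) :
    ∫⁻ x, f (mulVecE B x) = ENNReal.ofReal |B.det⁻¹| * ∫⁻ x, f x := by
  rw [← lintegral_map hf (continuous_mulVecE B).measurable, map_mulVecE hB, lintegral_smul_measure]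
  rfl

lemma embed_mulVecE {m : ℕ} {B : Matrix (Fin m) (Fin m) ℝ} (hB : B.det ≠ 0) :
    MeasurableEmbedding (mulVecE B) := by
  have h : Function.LeftInverse (mulVecE B⁻¹) (mulVecE B) := fun x => by
    rw [← mulVecE_mul, Matrix.nonsing_inv_mul _ (isUnit_iff_ne_zero.2 hB), mulVecE_one]
  have h' : Function.RightInverse (mulVecE B⁻¹) (mulVecE B) := fun x => by
    rw [← mulVecE_mul, Matrix.mul_nonsing_inv _ (isUnit_iff_ne_zero.2 hB), mulVecE_one]
  exact (Homeomorph.mk ⟨mulVecE B, mulVecE B⁻¹, h, h'⟩ (continuous_mulVecE B)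
    (continuous_mulVecE _)).measurableEmbedding

lemma integral_mulVecE {m : ℕ} {B : Matrix (Fin m) (Fin m) ℝ} (hB : B.det ≠ 0)
    (f : EV m → ℝ) :
    ∫ x, f (mulVecE B x) = |B.det⁻¹| * ∫ x, f x := by
  rw [← (embed_mulVecE hB).integral_map, map_mulVecE hB, integral_smul_measure,
    ENNReal.toReal_ofReal (abs_nonneg _), smul_eq_mul]

lemma integrable_mulVecE {m : ℕ} {B : Matrix (Fin m) (Fin m) ℝ} (hB : B.det ≠ 0)
    {f : EV m → ℝ} (hf : Integrable f) : Integrable (fun x => f (mulVecE B x)) := by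
  have := (embed_mulVecE hB).integrable_map_iff (g := f) (μ := volume)
  refine this.1 ?_
  rw [map_mulVecE hB]
  exact hf.smul_measure ENNReal.ofReal_ne_top

lemma det_ne_of_orth {m : ℕ} {Q : Matrix (Fin m) (Fin m) ℝ} (hQ : Qᵀ * Q = 1) : Q.det ≠ 0 := by
  intro h
  have := congrArg Matrix.det hQ
  rw [Matrix.det_mul, h, mul_zero, Matrix.det_one] at this
  exact zero_ne_one this

lemma absdet_of_orth {m : ℕ} {Q : Matrix (Fin m) (Fin m) ℝ} (hQ : Qᵀ * Q = 1) : |Q.det| = 1 := by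
  have := congrArg Matrix.det hQ
  rw [Matrix.det_mul, Matrix.det_transpose, Matrix.det_one] at this
  rw [abs_eq zero_le_one]; exact mul_self_eq_one_iff.1 this

lemma mp_orth_lintegral {n : ℕ} {Q : Matrix (Fin (n+1)) (Fin (n+1)) ℝ} (hQ : Qᵀ * Q = 1)
    (f : EV (n+1) → ℝ≥0∞) (hf : Measurable f) :
    ∫⁻ x, f x = ∫⁻ y : EV n, ∫⁻ t : ℝ, f (mulVecE Q (snocE y t)) := by
  rw [← mp_lintegral (fun x => f (mulVecE Q x)) (hf.comp (continuous_mulVecE Q).measurable),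
    lintegral_mulVecE (det_ne_of_orth hQ) f hf, abs_inv, absdet_of_orth hQ]
  simp

lemma mp_integral {n : ℕ} (f : EV (n+1) → ℝ) (hf : Integrable f) :
    ∫ x, f x = ∫ t : ℝ, ∫ y : EV n, f (snocE y t) := by
  have hmp : MeasurePreserving (fun q : ℝ × EV n => snocE q.2 q.1) (volume.prod volume) volume :=
    snocE_mp.comp Measure.measurePreserving_swap
  have h1 : ∫ x, f x = ∫ q : ℝ × EV n, f (snocE q.2 q.1) ∂(volume.prod volume) := by
    conv_lhs => rw [← hmp.map_eq]
    rw [integral_map hmp.measurable.aemeasurable]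
    rw [hmp.map_eq]; exact hf.1
  rw [h1, integral_prod]
  exact hmp.integrable_comp_of_integrable hf

lemma lintegral_inv_smul {m : ℕ} (f : EV m → ℝ≥0∞) (hf : Measurable f) {ε : ℝ} (hε : 0 < ε) :
    ∫⁻ x, f (ε⁻¹ • x) = ENNReal.ofReal (ε ^ m) * ∫⁻ x, f x := by
  have h := Measure.map_addHaar_smul (volume : Measure (EV m)) (inv_ne_zero hε.ne')
  rw [← lintegral_map (f := f) (g := fun x : EV m => ε⁻¹ • x) hf (measurable_const_smul _), h,
    lintegral_smul_measure]
  simp [abs_of_pos hε]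

/-- The basic properties of the rescaled densities which do not depend on `ε`. -/
structure KerOK {m : ℕ} (K : EV m → ℝ) (m0 : ℝ) : Prop where
  meas : Measurable K
  nonneg : ∀ z, 0 ≤ K z
  even : ∀ᵐ z : EV m, K (-z) = K z
  mass : ∫⁻ z, ENNReal.ofReal (K z) ≤ ENNReal.ofReal m0
  m0pos : 0 ≤ m0

lemma A1.int {m : ℕ} {ρ : EV m → ℝ} (h : A1 ρ) : Integrable ρ := by
  obtain ⟨h1, h2, _, _, h5⟩ := h
  refine h5.mono' h1.aestronglyMeasurable (ae_of_all _ fun x => ?_)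
  rw [Real.norm_of_nonneg (h2 x)]
  nlinarith [h2 x, norm_nonneg x, mul_nonneg (h2 x) (norm_nonneg x)]

lemma kerOK_scaled {m : ℕ} {ρ : EV m → ℝ} (h : A1 ρ) {ε : ℝ} (hε : 0 < ε) :
    KerOK (scaled ρ ε) (∫ x, ρ x) := by
  have hi := h.int
  obtain ⟨h1, h2, _, h4, h5⟩ := h
  refine ⟨?_, ?_, ?_, ?_, integral_nonneg h2⟩
  · unfold scaled; exact (h1.comp (measurable_const_smul _)).const_mul _
  · intro z; unfold scaled; have := h2 (ε⁻¹ • z); positivity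
  · have hq : Measure.QuasiMeasurePreserving (fun x : EV m => ε⁻¹ • x) volume volume := by
      refine ⟨measurable_const_smul _, ?_⟩
      rw [Measure.map_addHaar_smul _ (inv_ne_zero hε.ne')]
      exact Measure.smul_absolutelyContinuous
    filter_upwards [hq.ae h4] with x hx
    simp only [scaled, smul_neg]; rw [hx]
  · unfold scaled
    have : ∀ z : EV m, ENNReal.ofReal ((ε ^ m)⁻¹ * ρ (ε⁻¹ • z)) =
        ENNReal.ofReal ((ε ^ m)⁻¹) * ENNReal.ofReal (ρ (ε⁻¹ • z)) := fun z =>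
      ENNReal.ofReal_mul (by positivity)
    simp_rw [this]
    rw [lintegral_const_mul _ (by fun_prop), lintegral_inv_smul (fun z => ENNReal.ofReal (ρ z))
      (by fun_prop) hε, ← mul_assoc, ← ENNReal.ofReal_mul (by positivity),
      inv_mul_cancel₀ (by positivity), ENNReal.ofReal_one, one_mul,
      ofReal_integral_eq_lintegral_ofReal hi (ae_of_all _ h2)]

/-- The tail function of the first order kernel. -/
def Gk {m : ℕ} (K : EV m → ℝ) (τ : ℝ) : ℝ≥0∞ :=
  ∫⁻ z in {z : EV m | τ ≤ ‖z‖}, ENNReal.ofReal (K z / ‖z‖)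

lemma Gk_anti {m : ℕ} (K : EV m → ℝ) : Antitone (Gk K) := fun a b h =>
  lintegral_mono_set fun z (hz : b ≤ ‖z‖) => h.trans hz

lemma meas_normge {m : ℕ} (τ : ℝ) : MeasurableSet {z : EV m | τ ≤ ‖z‖} :=
  measurableSet_le measurable_const measurable_norm

lemma Gk_mul_le {m : ℕ} {K : EV m → ℝ} {m0 : ℝ} (hK : KerOK K m0) {τ : ℝ} (hτ : 0 < τ) :
    ENNReal.ofReal τ * Gk K τ ≤ ENNReal.ofReal m0 := by
  unfold Gk
  have hm := hK.meas
  rw [← lintegral_const_mul _ (by fun_prop)]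
  refine le_trans ?_ hK.mass
  refine le_trans ?_ (setLIntegral_le_lintegral {z : EV m | τ ≤ ‖z‖} _)
  refine setLIntegral_mono' (meas_normge τ) fun z (hz : τ ≤ ‖z‖) => ?_
  rw [← ENNReal.ofReal_mul hτ.le]
  refine ENNReal.ofReal_le_ofReal ?_
  have := hK.nonneg z
  rw [mul_div_assoc', div_le_iff₀ (hτ.trans_le hz)]
  nlinarith

lemma Gk_ne_top {m : ℕ} {K : EV m → ℝ} {m0 : ℝ} (hK : KerOK K m0) {τ : ℝ} (hτ : 0 < τ) :
    Gk K τ ≠ ⊤ := by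
  intro h
  have := Gk_mul_le hK hτ
  rw [h, ENNReal.mul_top (by simpa using hτ)] at this
  exact absurd this (by simp)

lemma Gk_int {m : ℕ} {K : EV m → ℝ} {m0 : ℝ} (hK : KerOK K m0) {Λ : ℝ} (hΛ : 0 < Λ) :
    ∫⁻ t in Set.Ioi (0:ℝ), Gk K (t / Λ) ≤ ENNReal.ofReal (Λ * m0) := by
  have hm := hK.meas
  have e : ∀ t : ℝ, Gk K (t/Λ) = ∫⁻ z : EV m, {q : ℝ × EV m | q.1 / Λ ≤ ‖q.2‖}.indicator
      (fun q => ENNReal.ofReal (K q.2 / ‖q.2‖)) (t, z) := fun t => by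
    unfold Gk
    rw [← lintegral_indicator (meas_normge _)]
    rfl
  simp_rw [e]
  have hS : MeasurableSet {q : ℝ × EV m | q.1 / Λ ≤ ‖q.2‖} :=
    measurableSet_le (by fun_prop) (by fun_prop)
  rw [lintegral_lintegral_swap]
  · rw [ENNReal.ofReal_mul hΛ.le]
    refine le_trans ?_ (mul_le_mul_right hK.mass _)
    rw [← lintegral_const_mul _ (by fun_prop)]
    refine lintegral_mono fun z => ?_
    rw [show (fun t : ℝ => {q : ℝ × EV m | q.1 / Λ ≤ ‖q.2‖}.indicator
      (fun q => ENNReal.ofReal (K q.2 / ‖q.2‖)) (t, z)) =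
      {t : ℝ | t / Λ ≤ ‖z‖}.indicator (fun _ => ENNReal.ofReal (K z / ‖z‖)) from rfl]
    rw [lintegral_indicator (measurableSet_le (by fun_prop) (by fun_prop)), setLIntegral_const,
      Measure.restrict_apply (measurableSet_le (by fun_prop) (by fun_prop))]
    have : {t : ℝ | t / Λ ≤ ‖z‖} ∩ Set.Ioi 0 = Set.Ioc 0 (Λ * ‖z‖) := by
      ext t; simp only [Set.mem_inter_iff, Set.mem_ofPred_eq, Set.mem_Ioi, Set.mem_Ioc,
        div_le_iff₀ hΛ]
      rw [mul_comm Λ]; tauto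
    rw [this, Real.volume_Ioc, sub_zero, ← ENNReal.ofReal_mul (div_nonneg (hK.nonneg z) (norm_nonneg _)),
      ← ENNReal.ofReal_mul hΛ.le]
    refine ENNReal.ofReal_le_ofReal ?_
    rcases eq_or_ne ‖z‖ 0 with h0 | h0
    · rw [h0]; simp; exact mul_nonneg hΛ.le (hK.nonneg z)
    · apply le_of_eq; field_simp
  · exact ((Measurable.ennreal_ofReal (by fun_prop)).indicator hS).aemeasurable

/-- radial profile bound -/
def CurvOK {n : ℕ} (K : EV (n+1) → ℝ) (κ : ℝ) : Prop :=
  ∀ (Q : Matrix (Fin (n+1)) (Fin (n+1)) ℝ) (ν : EV (n+1)) (σ Λ : ℝ), Qᵀ * Q = 1 →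
    inner ℝ ν (mulVecE Q (EuclideanSpace.single (Fin.last n) 1)) = 1 → 0 ≤ Λ →
    ∫⁻ z in {z : EV (n+1) | |σ - inner ℝ ν z| ≤ Λ * ‖firstCoords (mulVecE Qᵀ z)‖ ^ 2},
      ENNReal.ofReal (K z / ‖z‖) ≤ ENNReal.ofReal (Λ * κ)

lemma psi_integrable {n : ℕ} {α N : ℝ} (h0 : 0 < α) (h2 : α < 2) (hN : 3 - α < N) :
    Integrable (fun y : EV n => ‖y‖ ^ 2 * (‖y‖ ^ (-α - n) * (1 + ‖y‖) ^ (-N))) := by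
  rcases Nat.eq_zero_or_pos n with hn | hn
  · subst hn
    have : (fun y : EV 0 => ‖y‖ ^ 2 * (‖y‖ ^ (-α - (0:ℕ)) * (1 + ‖y‖) ^ (-N))) = fun _ => 0 := by
      funext y; rw [Subsingleton.elim y 0]; simp
    rw [this]; exact integrable_zero _ _ _
  · haveI : Nonempty (Fin n) := ⟨⟨0, hn⟩⟩
    haveI : Nontrivial (EV n) := inferInstance
    refine (integrable_fun_norm_addHaar (volume : Measure (EV n))
      (f := fun r : ℝ => r ^ 2 * (r ^ (-α - n) * (1 + r) ^ (-N)))).2 ?_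
    have hd : Module.finrank ℝ (EV n) = n := by simp
    rw [hd]
    have e : Set.EqOn (fun r : ℝ => r ^ (n - 1) • (r ^ 2 * (r ^ (-α - (n:ℝ)) * (1 + r) ^ (-N))))
        (fun r => r ^ (1 - α) * (1 + r) ^ (-N)) (Set.Ioi 0) := by
      intro r (hr : 0 < r)
      have : r ^ (1 - α) = r ^ (n - 1) * (r ^ 2 * r ^ (-α - (n:ℝ))) := by
        rw [← Real.rpow_natCast, ← Real.rpow_natCast, ← Real.rpow_add hr, ← Real.rpow_add hr]
        congr 1
        rw [Nat.cast_sub hn]; push_cast; ring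
      simp only [smul_eq_mul, this]; ring
    rw [integrableOn_congr_fun e measurableSet_Ioi]
    rw [← Set.Ioc_union_Ioi_eq_Ioi (zero_le_one (α := ℝ))]
    have hm : AEStronglyMeasurable (fun r : ℝ => r ^ (1 - α) * (1 + r) ^ (-N)) :=
      (by fun_prop : Measurable (fun r : ℝ => r ^ (1 - α) * (1 + r) ^ (-N))).aestronglyMeasurable
    refine IntegrableOn.union ?_ ?_
    · have := (intervalIntegral.intervalIntegrable_rpow' (a := 0) (b := 1) (r := 1 - α) (by linarith))
      rw [intervalIntegrable_iff_integrableOn_Ioc_of_le zero_le_one] at this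
      refine this.mono' hm.restrict ?_
      filter_upwards [ae_restrict_mem measurableSet_Ioc] with r hr
      have hr0 := hr.1
      rw [Real.norm_of_nonneg (by positivity)]
      refine mul_le_of_le_one_right (by positivity) ?_
      exact Real.rpow_le_one_of_one_le_of_nonpos (by linarith) (by linarith)
    · have := integrableOn_Ioi_rpow_of_lt (a := 1 - α - N) (by linarith) (zero_lt_one' ℝ)
      refine this.mono' hm.restrict ?_
      filter_upwards [ae_restrict_mem measurableSet_Ioi] with r hr
      have hr0 : 0 < r := zero_lt_one.trans hr
      rw [Real.norm_of_nonneg (by positivity), sub_eq_add_neg (1 - α) N, Real.rpow_add hr0]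
      exact mul_le_mul_of_nonneg_left
        (Real.rpow_le_rpow_of_nonpos hr0 (by linarith) (by linarith)) (Real.rpow_nonneg hr0.le _)

lemma curvOK_scaled {n : ℕ} {ρ : EV (n+1) → ℝ} (h : A1 ρ) {c₀ α N : ℝ} (hc : 0 < c₀)
    (h0 : 0 < α) (h2 : α < 2) (hN : 3 - α < N)
    (hb : ∀ x : EV (n + 1), x ≠ 0 →
      |ρ x| ≤ c₀ * ‖x‖ ^ ((2 : ℝ) - α - (n + 1 : ℝ)) * (1 + ‖x‖) ^ (-N)) :
    ∃ κ : ℝ, 0 ≤ κ ∧ ∀ ε : ℝ, 0 < ε → CurvOK (scaled ρ ε) κ := by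
  set Ψ : EV n → ℝ := fun y => ‖y‖ ^ 2 * (‖y‖ ^ (-α - n) * (1 + ‖y‖) ^ (-N)) with hΨ
  have hΨi : Integrable Ψ := psi_integrable h0 h2 hN
  have hΨ0 : ∀ y, 0 ≤ Ψ y := fun y => by positivity
  refine ⟨2 * c₀ * ∫ y, Ψ y, mul_nonneg (by positivity) (integral_nonneg hΨ0), ?_⟩
  intro ε hε Q ν σ Λ hQ hν hΛ
  have hKm := (kerOK_scaled h hε).meas
  have hfc : Continuous (firstCoords : EV (n+1) → EV n) := by
    unfold firstCoords
    exact (PiLp.continuous_toLp 2 _).comp (by fun_prop)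
  have hS : MeasurableSet {z : EV (n+1) | |σ - inner ℝ ν z| ≤
      Λ * ‖firstCoords (mulVecE Qᵀ z)‖ ^ 2} :=
    (isClosed_le (by fun_prop) (by
      have := hfc.comp (continuous_mulVecE Qᵀ)
      exact continuous_const.mul (this.norm.pow 2))).measurableSet
  rw [← lintegral_indicator hS, mp_orth_lintegral hQ _
    ((Measurable.ennreal_ofReal (by fun_prop)).indicator hS)]
  -- pointwise kernel bound
  have hker : ∀ z : EV (n+1), ∀ y : EV n, y ≠ 0 → ‖y‖ ≤ ‖z‖ →
      scaled ρ ε z / ‖z‖ ≤ c₀ * (ε ^ (n+2))⁻¹ *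
        (‖ε⁻¹ • y‖ ^ (-α - n) * (1 + ‖ε⁻¹ • y‖) ^ (-N)) := by
    intro z y hy hyz
    have hy0 : 0 < ‖y‖ := norm_pos_iff.2 hy
    have hz0 : 0 < ‖z‖ := hy0.trans_le hyz
    have hz : z ≠ 0 := norm_pos_iff.1 hz0
    set ζ := ε⁻¹ • z with hζ
    have hζ0 : ζ ≠ 0 := smul_ne_zero (inv_ne_zero hε.ne') hz
    have hζn : ‖ζ‖ = ε⁻¹ * ‖z‖ := by rw [hζ, norm_smul, Real.norm_of_nonneg (by positivity)]
    have hηn : ‖ε⁻¹ • y‖ = ε⁻¹ * ‖y‖ := by rw [norm_smul, Real.norm_of_nonneg (by positivity)]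
    have hζp : 0 < ‖ζ‖ := norm_pos_iff.2 hζ0
    have hηp : 0 < ‖ε⁻¹ • y‖ := by rw [hηn]; positivity
    have hle : ‖ε⁻¹ • y‖ ≤ ‖ζ‖ := by rw [hηn, hζn]; gcongr
    have b := (le_abs_self _).trans (hb ζ hζ0)
    have e1 : scaled ρ ε z / ‖z‖ = (ε ^ (n+2))⁻¹ * (ρ ζ / ‖ζ‖) := by
      unfold scaled; rw [← hζ, hζn]; field_simp; ring
    have e2 : ρ ζ / ‖ζ‖ ≤ c₀ * (‖ζ‖ ^ (-α - n) * (1 + ‖ζ‖) ^ (-N)) := by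
      rw [div_le_iff₀ hζp]
      refine b.trans (le_of_eq ?_)
      have : ‖ζ‖ ^ ((2 : ℝ) - α - (n + 1 : ℝ)) = ‖ζ‖ ^ (-α - n) * ‖ζ‖ := by
        nth_rw 3 [← Real.rpow_one ‖ζ‖]
        rw [← Real.rpow_add hζp]; congr 1; ring
      rw [this]; ring
    have e3 : ‖ζ‖ ^ (-α - n) * (1 + ‖ζ‖) ^ (-N) ≤
        ‖ε⁻¹ • y‖ ^ (-α - n) * (1 + ‖ε⁻¹ • y‖) ^ (-N) := by
      have hn0 : (0:ℝ) ≤ n := Nat.cast_nonneg n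
      refine mul_le_mul (Real.rpow_le_rpow_of_nonpos hηp hle (by linarith))
        (Real.rpow_le_rpow_of_nonpos (by linarith) (by linarith) (by linarith)) (by positivity)
        (by positivity)
    rw [e1]
    calc (ε ^ (n+2))⁻¹ * (ρ ζ / ‖ζ‖) ≤ (ε ^ (n+2))⁻¹ * (c₀ * (‖ζ‖ ^ (-α - n) * (1 + ‖ζ‖) ^ (-N))) := by
          gcongr
      _ ≤ (ε ^ (n+2))⁻¹ * (c₀ * (‖ε⁻¹ • y‖ ^ (-α - n) * (1 + ‖ε⁻¹ • y‖) ^ (-N))) := by gcongr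
      _ = _ := by ring
  have key : ∀ y : EV n, ∫⁻ t : ℝ, ({z : EV (n+1) | |σ - inner ℝ ν z| ≤
      Λ * ‖firstCoords (mulVecE Qᵀ z)‖ ^ 2}.indicator
        (fun z => ENNReal.ofReal (scaled ρ ε z / ‖z‖))) (mulVecE Q (snocE y t)) ≤
      ENNReal.ofReal (Λ * (2 * c₀) * (ε ^ n)⁻¹) * ENNReal.ofReal (Ψ (ε⁻¹ • y)) := by
    intro y
    set c := σ - inner ℝ ν (mulVecE Q (snocE y 0)) with hcdef
    have hlin : ∀ t, σ - inner ℝ ν (mulVecE Q (snocE y t)) = c - t := by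
      intro t
      have : snocE y t = snocE y 0 + t • EuclideanSpace.single (Fin.last n) (1:ℝ) := by
        ext i; refine Fin.lastCases ?_ (fun i => ?_) i
        · simp [snocE_last]
        · simp [snocE_castSucc]
      rw [this, mulVecE_add, mulVecE_smul, inner_add_right, inner_smul_right, hν, hcdef]; ring
    have hfc2 : ∀ t, firstCoords (mulVecE Qᵀ (mulVecE Q (snocE y t))) = y := fun t => by
      rw [← mulVecE_mul, hQ, mulVecE_one, firstCoords_snocE]
    have hT : ∀ t, ({z : EV (n+1) | |σ - inner ℝ ν z| ≤
      Λ * ‖firstCoords (mulVecE Qᵀ z)‖ ^ 2}.indicator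
        (fun z => ENNReal.ofReal (scaled ρ ε z / ‖z‖))) (mulVecE Q (snocE y t)) ≤
        (Set.Icc (c - Λ * ‖y‖ ^ 2) (c + Λ * ‖y‖ ^ 2)).indicator (fun t =>
          ENNReal.ofReal (scaled ρ ε (mulVecE Q (snocE y t)) / ‖mulVecE Q (snocE y t)‖)) t := by
      intro t
      by_cases ht : |c - t| ≤ Λ * ‖y‖ ^ 2
      · rw [Set.indicator_of_mem (a := t)]
        · exact Set.indicator_le_self _ _ _
        · rw [abs_le] at ht; constructor <;> linarith [ht.1, ht.2]
      · rw [Set.indicator_of_notMem]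
        · exact zero_le
        · simp only [Set.mem_ofPred_eq, hlin, hfc2]; exact ht
    refine (lintegral_mono hT).trans ?_
    rw [lintegral_indicator measurableSet_Icc]
    rcases eq_or_ne y 0 with rfl | hy
    · simp
    · refine (setLIntegral_mono' measurableSet_Icc fun t _ => ENNReal.ofReal_le_ofReal
        (hker (mulVecE Q (snocE y t)) y hy (by rw [norm_mulVecE hQ]; exact norm_snocE_ge y t))).trans ?_
      rw [setLIntegral_const, Real.volume_Icc, ← ENNReal.ofReal_mul (by positivity),
        ← ENNReal.ofReal_mul (by positivity)]
      refine ENNReal.ofReal_le_ofReal (le_of_eq ?_)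
      simp only [hΨ]
      have : ‖y‖ ^ 2 = ε ^ 2 * ‖ε⁻¹ • y‖ ^ 2 := by
        rw [norm_smul, Real.norm_of_nonneg (by positivity)]; field_simp
      rw [show c + Λ * ‖y‖ ^ 2 - (c - Λ * ‖y‖ ^ 2) = 2 * Λ * ‖y‖ ^ 2 by ring, this]
      rw [show ε ^ (n+2) = ε ^ n * ε ^ 2 by ring]
      field_simp
  refine (lintegral_mono key).trans ?_
  have hΨm : Measurable Ψ := by rw [hΨ]; fun_prop
  rw [lintegral_const_mul _ (by fun_prop), lintegral_inv_smul (fun y => ENNReal.ofReal (Ψ y))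
    (by fun_prop) hε, ← ofReal_integral_eq_lintegral_ofReal hΨi (ae_of_all _ hΨ0),
    ← ENNReal.ofReal_mul (by positivity), ← ENNReal.ofReal_mul (by positivity)]
  refine ENNReal.ofReal_le_ofReal (le_of_eq ?_)
  field_simp

/-- The slice condition for a density. -/
def SliceOK {n : ℕ} (A : Matrix (Fin (n + 1)) (Fin (n + 1)) ℝ) (K : EV (n+1) → ℝ) : Prop :=
  ∀ t : ℝ, ∀ Q : Matrix (Fin (n + 1)) (Fin (n + 1)) ℝ, Qᵀ * Q = 1 → Q.det = 1 →
      (∫ z' : EV n, kernelJ K (mulVecE (A * Q) (snocE z' t)) • z') = 0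

lemma smul_snocE {n : ℕ} (c : ℝ) (y : EV n) (t : ℝ) : c • snocE y t = snocE (c • y) (c * t) := by
  ext i; refine Fin.lastCases ?_ (fun i => ?_) i
  · simp [snocE_last]
  · simp [snocE_castSucc]

lemma slice_scaled {n : ℕ} {A : Matrix (Fin (n + 1)) (Fin (n + 1)) ℝ} {ρ : EV (n+1) → ℝ}
    (h : SliceOK A ρ) {ε : ℝ} (hε : 0 < ε) : SliceOK A (scaled ρ ε) := by
  intro t Q hQ hd
  have h1 := h (ε⁻¹ * t) Q hQ hd
  have h2 := Measure.integral_comp_smul (volume : Measure (EV n))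
    (fun z' => kernelJ ρ (mulVecE (A * Q) (snocE z' (ε⁻¹ * t))) • z') ε⁻¹
  rw [h1, smul_zero] at h2
  have e : ∀ z' : EV n, kernelJ (scaled ρ ε) (mulVecE (A * Q) (snocE z' t)) • z' =
      ((ε ^ (n+1))⁻¹ * (ε⁻¹) ^ 2 * ε) •
        (kernelJ ρ (mulVecE (A * Q) (snocE (ε⁻¹ • z') (ε⁻¹ * t))) • (ε⁻¹ • z')) := by
    intro z'
    rw [← smul_snocE, mulVecE_smul]
    unfold kernelJ scaled
    simp only [smul_smul, norm_smul, Real.norm_of_nonneg (inv_nonneg.2 hε.le)]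
    congr 1
    rcases eq_or_ne ‖mulVecE (A * Q) (snocE z' t)‖ 0 with h0 | h0
    · rw [h0]; simp
    · field_simp
  simp_rw [e]
  rw [integral_smul, h2, smul_zero]

lemma exists_orth {n : ℕ} (v : EV (n+1)) (hv : v ≠ 0) :
    ∃ (Q : Matrix (Fin (n + 1)) (Fin (n + 1)) ℝ) (κ : ℝ), Qᵀ * Q = 1 ∧ Q.det = 1 ∧ κ ≠ 0 ∧
      ∀ i, v i = κ * Q i (Fin.last n) := by
  have hv0 : ‖v‖ ≠ 0 := norm_ne_zero_iff.2 hv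
  obtain ⟨b, hb⟩ := Orthonormal.exists_orthonormalBasis_extension_of_card_eq (𝕜 := ℝ)
    (E := EV (n+1)) (ι := Fin (n+1)) (by simp) (v := fun _ => ‖v‖⁻¹ • v) (s := {Fin.last n}) (by
      constructor
      · rintro ⟨i, hi⟩
        simp [Set.domRestrict, norm_smul, hv0]
      · rintro ⟨i, hi⟩ ⟨j, hj⟩ hij
        simp only [Set.mem_singleton_iff] at hi hj
        subst hi; subst hj
        exact absurd rfl hij)
  have hb' := hb (Fin.last n) rfl
  set Q : Matrix (Fin (n + 1)) (Fin (n + 1)) ℝ := Matrix.of fun i j => b j i with hQdef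
  have hQ : Qᵀ * Q = 1 := by
    ext i j
    rw [Matrix.mul_apply, Matrix.one_apply, ← orthonormal_iff_ite.1 b.orthonormal i j, inner_eq_sum]
    rfl
  have hcol : ∀ i, v i = ‖v‖ * Q i (Fin.last n) := by
    intro i
    simp only [hQdef, Matrix.of_apply, hb', PiLp.smul_apply, smul_eq_mul]
    field_simp
  have hdet : Q.det = 1 ∨ Q.det = -1 := by
    have := absdet_of_orth hQ
    exact (abs_eq zero_le_one).1 this
  rcases hdet with hd | hd
  · exact ⟨Q, ‖v‖, hQ, hd, hv0, hcol⟩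
  · set d : Fin (n+1) → ℝ := fun j => if j = Fin.last n then -1 else 1 with hddef
    refine ⟨Q * Matrix.diagonal d, -‖v‖, ?_, ?_, neg_ne_zero.2 hv0, ?_⟩
    · rw [Matrix.transpose_mul, Matrix.diagonal_transpose, Matrix.mul_assoc,
        ← Matrix.mul_assoc Qᵀ, hQ, Matrix.one_mul, Matrix.diagonal_mul_diagonal,
        ← Matrix.diagonal_one]
      congr 1; funext j; simp only [hddef]; split_ifs <;> simp
    · rw [Matrix.det_mul, hd, Matrix.det_diagonal]
      simp [hddef]
    · intro i
      rw [Matrix.mul_diagonal, hcol i]; simp [hddef]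

lemma posdef_lower {m : ℕ} {A : Matrix (Fin m) (Fin m) ℝ} (hA : A.PosDef) :
    ∃ lam : ℝ, 0 < lam ∧ ∀ ν : EV m, lam * ‖ν‖ ≤ ‖mulVecE (A * A) ν‖ := by
  have hd : (A * A).det ≠ 0 := by
    rw [Matrix.det_mul]; exact mul_ne_zero hA.det_pos.ne' hA.det_pos.ne'
  refine ⟨(‖mulVecL (A * A)⁻¹‖ + 1)⁻¹, by positivity, fun ν => ?_⟩
  rw [inv_mul_le_iff₀ (by positivity)]
  have h1 : mulVecL (A * A)⁻¹ (mulVecE (A * A) ν) = ν := by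
    rw [mulVecL_apply, ← mulVecE_mul, Matrix.nonsing_inv_mul _ (isUnit_iff_ne_zero.2 hd),
      mulVecE_one]
  have h2 := (mulVecL (A * A)⁻¹).le_opNorm (mulVecE (A * A) ν)
  rw [h1] at h2
  nlinarith [norm_nonneg (mulVecE (A * A) ν)]

lemma kernelJ_nonneg {m : ℕ} {K : EV m → ℝ} (h : ∀ z, 0 ≤ K z) (z : EV m) : 0 ≤ kernelJ K z :=
  div_nonneg (h z) (by positivity)

lemma kernelJ_mul_norm {m : ℕ} (K : EV m → ℝ) (z : EV m) : kernelJ K z * ‖z‖ = K z / ‖z‖ := by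
  unfold kernelJ
  rcases eq_or_ne ‖z‖ 0 with h | h
  · rw [h]; simp
  · field_simp

lemma KerOK.measJ {m : ℕ} {K : EV m → ℝ} {m0 : ℝ} (h : KerOK K m0) : Measurable (kernelJ K) := by
  unfold kernelJ; have := h.meas; fun_prop

lemma abs_coord_le {m : ℕ} (z : EV m) (i : Fin m) : |z i| ≤ ‖z‖ := by
  simpa using PiLp.norm_apply_le z i

lemma integrableOn_first {m : ℕ} {K : EV m → ℝ} {m0 : ℝ} (hK : KerOK K m0) {τ : ℝ} (hτ : 0 < τ) :
    IntegrableOn (fun z => K z / ‖z‖) {z : EV m | τ ≤ ‖z‖} := by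
  refine ⟨(hK.meas.div measurable_norm).aestronglyMeasurable, ?_⟩
  rw [hasFiniteIntegral_iff_ofReal (ae_of_all _ fun z => div_nonneg (hK.nonneg z) (norm_nonneg z))]
  exact (Gk_ne_top hK hτ).lt_top

lemma integrableOn_first' {m : ℕ} {K : EV m → ℝ} {m0 : ℝ} (hK : KerOK K m0) {τ : ℝ} (hτ : 0 < τ)
    {S : Set (EV m)} (hS : MeasurableSet S) (hSτ : ∀ z ∈ S, τ ≤ ‖z‖) {g : EV m → ℝ} (hg : Measurable g)
    (C : ℝ) (hgC : ∀ z, |g z| ≤ C * ‖z‖) : IntegrableOn (fun z => kernelJ K z * g z) S := by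
  have h := ((integrableOn_first hK hτ).mono_set (s := S) hSτ).const_mul C
  refine h.mono' (hK.measJ.mul hg).aestronglyMeasurable (ae_of_all _ fun z => ?_)
  rw [norm_mul, Real.norm_of_nonneg (kernelJ_nonneg hK.nonneg z), ← kernelJ_mul_norm]
  have := mul_le_mul_of_nonneg_left (hgC z) (kernelJ_nonneg hK.nonneg z)
  rw [Real.norm_eq_abs]; linarith

lemma direction {n : ℕ} {A : Matrix (Fin (n + 1)) (Fin (n + 1)) ℝ} (hA : A.PosDef)
    {K : EV (n+1) → ℝ} {m0 : ℝ} (hK : KerOK K m0) (hs : SliceOK A K) {ν : EV (n+1)}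
    (hν : ν ≠ 0) {σ : ℝ} (hσ : 0 < σ) :
    ∃ β : ℝ, (∀ i, ∫ z in {z : EV (n+1) | inner ℝ ν z ≤ -σ}, kernelJ K z * z i =
      β * mulVecE (A * A) ν i) ∧
      ENNReal.ofReal (|β| * ‖mulVecE (A * A) ν‖) ≤ Gk K (σ / ‖ν‖) := by
  have hν0 : 0 < ‖ν‖ := norm_pos_iff.2 hν
  have hAt : Aᵀ = A := by
    have := hA.isHermitian; rwa [Matrix.IsHermitian, Matrix.conjTranspose_eq_transpose_of_trivial] at this
  obtain ⟨lam, hlam, hlow⟩ := posdef_lower hA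
  have hAν : mulVecE A ν ≠ 0 := by
    intro h
    have := hlow ν
    rw [mulVecE_mul, h] at this
    have h0 : mulVecE A (0 : EV (n+1)) = 0 := (mulVecL A).map_zero
    rw [h0, norm_zero] at this
    nlinarith
  obtain ⟨Q, κ, hQ, hdQ, hκ, hcol⟩ := exists_orth _ hAν
  set B := A * Q with hB
  have hBdet : B.det ≠ 0 := by
    rw [hB, Matrix.det_mul, hdQ, mul_one]; exact hA.det_pos.ne'
  set τ := σ / ‖ν‖ with hτdef
  have hτ : 0 < τ := div_pos hσ hν0
  set S := {z : EV (n+1) | inner ℝ ν z ≤ -σ} with hSdef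
  have hSm : MeasurableSet S := (isClosed_le (by fun_prop) continuous_const).measurableSet
  have hSτ : ∀ z ∈ S, τ ≤ ‖z‖ := by
    intro z (hz : inner ℝ ν z ≤ -σ)
    rw [hτdef, div_le_iff₀ hν0]
    have := abs_real_inner_le_norm ν z
    have := (abs_le.1 this).1
    linarith
  -- the structure of B
  have hinner : ∀ y : EV (n+1), inner ℝ ν (mulVecE B y) = κ * y (Fin.last n) := by
    intro y
    rw [hB, real_inner_comm, mulVecE_mul, inner_mulVecE, hAt, inner_mulVecE]
    have : mulVecE Qᵀ (mulVecE A ν) = κ • EuclideanSpace.single (Fin.last n) 1 := by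
      ext j
      rw [mulVecE_apply]
      have : ∀ i, Qᵀ j i * mulVecE A ν i = κ * (Qᵀ j i * Q i (Fin.last n)) := fun i => by
        rw [hcol i]; ring
      simp_rw [this]
      rw [← Finset.mul_sum, ← Matrix.mul_apply, hQ]
      simp [Matrix.one_apply]
    rw [this, inner_smul_right]
    simp [EuclideanSpace.inner_single_right]
  have hBlast : ∀ i, κ * B i (Fin.last n) = mulVecE (A * A) ν i := by
    intro i
    rw [mulVecE_mul, mulVecE_apply, hB, Matrix.mul_apply, Finset.mul_sum]
    exact Finset.sum_congr rfl fun j _ => by rw [hcol j]; ring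
  -- coordinates of y in terms of z
  set g : EV (n+1) → EV (n+1) := fun y => mulVecE B y
  set F : EV (n+1) → ℝ := fun y => (S.indicator (fun _ => (1:ℝ)) (mulVecE B y)) *
    kernelJ K (mulVecE B y) with hF
  have hFm : Measurable F := by
    have := (continuous_mulVecE B).measurable
    exact (((measurable_const.indicator hSm).comp this)).mul (hK.measJ.comp this)
  have hF0 : ∀ y, 0 ≤ F y := fun y => mul_nonneg (Set.indicator_nonneg (fun _ _ => zero_le_one) _)
    (kernelJ_nonneg hK.nonneg _)
  set Cb := ‖mulVecL B⁻¹‖ with hCb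
  have hinv : ∀ z, mulVecE B⁻¹ (mulVecE B z) = z := fun z => by
    rw [← mulVecE_mul, Matrix.nonsing_inv_mul _ (isUnit_iff_ne_zero.2 hBdet), mulVecE_one]
  have hFn : Integrable (fun y => F y * ‖y‖) := by
    have h1 := integrableOn_first' hK hτ hSm hSτ (g := fun z => ‖mulVecE B⁻¹ z‖)
      (continuous_mulVecE B⁻¹).norm.measurable Cb (fun z => by
        rw [abs_of_nonneg (norm_nonneg _)]; exact (mulVecL B⁻¹).le_opNorm z)
    rw [← integrable_indicator_iff hSm] at h1
    have h2 := integrable_mulVecE hBdet h1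
    refine h2.congr (ae_of_all _ fun y => ?_)
    simp only [hF]
    by_cases hy : mulVecE B y ∈ S
    · simp [hy, hinv]
    · simp [hy]
  have hFj : ∀ j, Integrable (fun y => F y * y j) := by
    intro j
    refine hFn.mono' (hFm.mul (by fun_prop)).aestronglyMeasurable (ae_of_all _ fun y => ?_)
    rw [norm_mul, Real.norm_of_nonneg (hF0 y)]
    exact mul_le_mul_of_nonneg_left (abs_coord_le y j) (hF0 y)
  -- the tangential integrals vanish
  have hzero : ∀ j : Fin n, ∫ y, F y * y j.castSucc = 0 := by
    intro j
    rw [mp_integral _ (hFj _)]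
    have hmp : MeasurePreserving (fun q : ℝ × EV n => snocE q.2 q.1) (volume.prod volume) volume :=
      snocE_mp.comp Measure.measurePreserving_swap
    have hae := (hmp.integrable_comp_of_integrable hFn).prod_right_ae
    refine integral_eq_zero_of_ae ?_
    filter_upwards [hae] with t ht
    simp only [snocE_castSucc, Pi.zero_apply, Function.comp_apply] at ht ⊢
    by_cases hts : κ * t ≤ -σ
    · have hFt : ∀ y : EV n, F (snocE y t) = kernelJ K (mulVecE B (snocE y t)) := by
        intro y
        simp only [hF]
        rw [Set.indicator_of_mem, one_mul]
        change inner ℝ ν (mulVecE B (snocE y t)) ≤ -σ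
        rw [hinner, snocE_last]; exact hts
      simp_rw [hFt] at ht ⊢
      have hsm : Measurable (fun y : EV n => snocE y t) :=
        (snocE_mp (n := n)).measurable.comp (measurable_id.prodMk measurable_const)
      have hJm : Measurable (fun y : EV n => kernelJ K (mulVecE B (snocE y t))) :=
        hK.measJ.comp ((continuous_mulVecE B).measurable.comp hsm)
      have hvi : Integrable (fun y : EV n => kernelJ K (mulVecE B (snocE y t)) • y) := by
        refine ht.mono' (hJm.smul measurable_id).aestronglyMeasurable (ae_of_all _ fun y => ?_)
        rw [norm_smul, Real.norm_of_nonneg (kernelJ_nonneg hK.nonneg _)]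
        exact mul_le_mul_of_nonneg_left (norm_snocE_ge y t) (kernelJ_nonneg hK.nonneg _)
      have h3 := (EuclideanSpace.proj j : EV n →L[ℝ] ℝ).integral_comp_comm hvi
      rw [hB, hs t Q hQ hdQ, map_zero] at h3
      rw [← h3]
      rfl
    · have hFt : ∀ y : EV n, F (snocE y t) = 0 := by
        intro y
        simp only [hF]
        rw [Set.indicator_of_notMem, zero_mul]
        change ¬ inner ℝ ν (mulVecE B (snocE y t)) ≤ -σ
        rw [hinner, snocE_last]; exact hts
      simp_rw [hFt]; simp
  have hIi : ∀ i, ∫ z in S, kernelJ K z * z i =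
      |B.det| * (B i (Fin.last n) * ∫ y, F y * y (Fin.last n)) := by
    intro i
    rw [← integral_indicator hSm]
    have h1 := integral_mulVecE hBdet (S.indicator fun z => kernelJ K z * z i)
    have h2 : ∀ y, (S.indicator fun z => kernelJ K z * z i) (mulVecE B y) =
        ∑ j, B i j * (F y * y j) := by
      intro y
      have : ∑ j, B i j * (F y * y j) = F y * mulVecE B y i := by
        rw [mulVecE_apply, Finset.mul_sum]
        exact Finset.sum_congr rfl fun j _ => by ring
      rw [this]
      simp only [hF]
      by_cases hy : mulVecE B y ∈ S
      · simp [hy]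
      · simp [hy]
    simp_rw [h2] at h1
    rw [integral_finsetSum _ fun j _ => (hFj j).const_mul _] at h1
    simp_rw [integral_const_mul] at h1
    rw [Fin.sum_univ_castSucc] at h1
    simp only [hzero, mul_zero, Finset.sum_const_zero, zero_add] at h1
    rw [h1, abs_inv, mul_inv_cancel_left₀ (abs_ne_zero.2 hBdet)]
  set b0 := ∫ y, F y * y (Fin.last n) with hb0
  set Mν := mulVecE (A * A) ν with hMν
  have hres : ∀ i, ∫ z in S, kernelJ K z * z i = (|B.det| * b0 / κ) * Mν i := by
    intro i; rw [hIi, ← hBlast i]; field_simp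
  set β := |B.det| * b0 / κ with hβ
  refine ⟨β, hres, ?_⟩
  -- the size of β
  have hMν0 : 0 < ‖Mν‖ := lt_of_lt_of_le (by positivity) (hlow ν)
  have hci : ∀ i, IntegrableOn (fun z => kernelJ K z * z i) S := fun i =>
    integrableOn_first' hK hτ hSm hSτ (by fun_prop) 1 (fun z => by
      rw [one_mul]; exact abs_coord_le z i)
  have e1 : ∫ z in S, kernelJ K z * inner ℝ Mν z = β * ‖Mν‖ ^ 2 := by
    have : ∀ z : EV (n+1), kernelJ K z * inner ℝ Mν z = ∑ i, Mν i * (kernelJ K z * z i) := by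
      intro z; rw [inner_eq_sum, Finset.mul_sum]
      exact Finset.sum_congr rfl fun j _ => by ring
    simp_rw [this]
    rw [integral_finsetSum _ fun j _ => (hci j).const_mul _]
    simp_rw [integral_const_mul, hres]
    rw [← real_inner_self_eq_norm_sq, inner_eq_sum, Finset.mul_sum]
    exact Finset.sum_congr rfl fun j _ => by ring
  have e2 : |β * ‖Mν‖ ^ 2| ≤ ‖Mν‖ * ∫ z in {z : EV (n+1) | τ ≤ ‖z‖}, K z / ‖z‖ := by
    rw [← e1]
    have hsub : S ⊆ {z : EV (n+1) | τ ≤ ‖z‖} := hSτ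
    calc |∫ z in S, kernelJ K z * inner ℝ Mν z| ≤ ∫ z in S, ‖Mν‖ * (K z / ‖z‖) := by
          rw [← Real.norm_eq_abs]
          refine norm_integral_le_of_norm_le
            (((integrableOn_first hK hτ).mono_set hsub).const_mul _) (ae_of_all _ fun z => ?_)
          rw [norm_mul, Real.norm_of_nonneg (kernelJ_nonneg hK.nonneg _), ← kernelJ_mul_norm]
          have := abs_real_inner_le_norm Mν z
          have := mul_le_mul_of_nonneg_left this (kernelJ_nonneg hK.nonneg z)
          rw [Real.norm_eq_abs]; linarith
      _ = ‖Mν‖ * ∫ z in S, (K z / ‖z‖) := integral_const_mul _ _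
      _ ≤ _ := by
          refine mul_le_mul_of_nonneg_left ?_ (norm_nonneg _)
          exact setIntegral_mono_set (integrableOn_first hK hτ)
            (ae_of_all _ fun z => div_nonneg (hK.nonneg z) (norm_nonneg z)) hsub.eventuallyLE
  have e3 : |β| * ‖Mν‖ ≤ ∫ z in {z : EV (n+1) | τ ≤ ‖z‖}, K z / ‖z‖ := by
    rw [abs_mul, abs_of_nonneg (sq_nonneg ‖Mν‖)] at e2
    refine le_of_mul_le_mul_left ?_ hMν0
    linarith
  refine (ENNReal.ofReal_le_ofReal e3).trans (le_of_eq ?_)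
  rw [ofReal_integral_eq_lintegral_ofReal (integrableOn_first hK hτ)
    (ae_of_all _ fun z => div_nonneg (hK.nonneg z) (norm_nonneg z))]
  rfl

lemma taylor2 {m : ℕ} {f : EV m → ℝ} (hf : ContDiff ℝ 2 f) {C : ℝ} (hC0 : 0 ≤ C)
    (hC : ∀ x, ‖iteratedFDeriv ℝ 2 f x‖ ≤ C) (x z : EV m) :
    |f (x - z) - f x + fderiv ℝ f x z| ≤ C * ‖z‖ ^ 2 := by
  have hd1 : ContDiff ℝ 1 (fderiv ℝ f) := hf.fderiv_right (by norm_num)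
  have hC' : ∀ x, ‖fderiv ℝ (fderiv ℝ f) x‖ ≤ C := fun x => by
    rw [← norm_iteratedFDeriv_one, norm_iteratedFDeriv_fderiv]; exact hC x
  have hb : ∀ y ∈ Metric.closedBall x ‖z‖, ‖fderiv ℝ f y - fderiv ℝ f x‖ ≤ C * ‖z‖ := by
    intro y hy
    have := convex_univ.norm_image_sub_le_of_norm_fderiv_le (f := fderiv ℝ f) (𝕜 := ℝ)
      (fun x _ => (hd1.differentiable (by norm_num)) x) (fun x _ => hC' x) (Set.mem_univ x)
      (Set.mem_univ y)
    refine this.trans (mul_le_mul_of_nonneg_left ?_ hC0)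
    rwa [← dist_eq_norm]
  have h := (convex_closedBall x ‖z‖).norm_image_sub_le_of_norm_fderiv_le' (𝕜 := ℝ)
    (fun x _ => (hf.differentiable (by norm_num)) x) hb
    (Metric.mem_closedBall_self (norm_nonneg z)) (y := x - z) (by simp [dist_eq_norm])
  rw [show x - z - x = -z by abel, map_neg, sub_neg_eq_add, norm_neg] at h
  rw [← Real.norm_eq_abs]
  linarith [h, sq ‖z‖]

/-- the last direction of a chart -/
def lastDir {n : ℕ} (Q : Matrix (Fin (n+1)) (Fin (n+1)) ℝ) : EV (n+1) :=
  mulVecE Q (EuclideanSpace.single (Fin.last n) 1)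

/-- A local chart of the boundary with constant `Λ`. -/
structure IsLChart {n : ℕ} (Ω : Set (EV (n+1))) (Λ : ℝ) (U : Set (EV (n+1)))
    (Q : Matrix (Fin (n+1)) (Fin (n+1)) ℝ) (s : EV (n+1) → ℝ) : Prop where
  isOpen : IsOpen U
  orth : Qᵀ * Q = 1
  smooth : ContDiff ℝ 2 s
  one_le : 1 ≤ Λ
  bound : ∀ x, ‖fderiv ℝ s x‖ ≤ Λ
  shift : ∀ x t, s (x + t • lastDir Q) = s x + t
  taylor : ∀ x z, |s (x - z) - s x + fderiv ℝ s x z| ≤ Λ * ‖firstCoords (mulVecE Qᵀ z)‖ ^ 2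
  mem_iff : ∀ x ∈ U, x ∈ Ω ↔ 0 < s x

lemma IsLChart.mono {n : ℕ} {Ω : Set (EV (n+1))} {Λ Λ' : ℝ} {U Q s} (h : IsLChart Ω Λ U Q s)
    (hl : Λ ≤ Λ') : IsLChart Ω Λ' U Q s :=
  ⟨h.isOpen, h.orth, h.smooth, h.one_le.trans hl, fun x => (h.bound x).trans hl, h.shift,
    fun x z => (h.taylor x z).trans (by gcongr), h.mem_iff⟩

/-- `firstCoords` as a continuous linear map. -/
def fcL {n : ℕ} : EV (n+1) →L[ℝ] EV n :=
  LinearMap.toContinuousLinearMap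
    { toFun := firstCoords
      map_add' := fun x y => by ext i; simp [firstCoords_apply]
      map_smul' := fun c x => by ext i; simp [firstCoords_apply] }

lemma fcL_apply {n : ℕ} (x : EV (n+1)) : fcL x = firstCoords x := rfl

lemma exists_lchart {n : ℕ} {Ω : Set (EV (n+1))} (hΩ : IsGraphDomain 3 Ω) {z : EV (n+1)}
    (hz : z ∈ frontier Ω) : ∃ Λ U Q s, z ∈ U ∧ IsLChart Ω Λ U Q s := by
  obtain ⟨U, Q, γ, hU, hzU, hQ, -, ⟨hγ, hγb⟩, hΩU⟩ := hΩ.2 z hz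
  obtain ⟨C1, hC1⟩ := hγb 1 (by norm_num)
  obtain ⟨C2, hC2⟩ := hγb 2 (by norm_num)
  have hQ' : Q * Qᵀ = 1 := mul_eq_one_comm.1 hQ
  have hQt : (Qᵀ)ᵀ * Qᵀ = 1 := by rw [Matrix.transpose_transpose]; exact hQ'
  set P : EV (n+1) →L[ℝ] EV n := fcL.comp (mulVecL Qᵀ) with hP
  set ℓ : EV (n+1) →L[ℝ] ℝ := (EuclideanSpace.proj (Fin.last n) : EV (n+1) →L[ℝ] ℝ).comp
    (mulVecL Qᵀ) with hℓ
  have hPn : ∀ x, ‖P x‖ ≤ ‖x‖ := fun x => by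
    rw [← norm_mulVecE hQt x]; exact norm_firstCoords_le _
  have hℓn : ∀ x, |ℓ x| ≤ ‖x‖ := fun x => by
    rw [← norm_mulVecE hQt x]; exact abs_coord_le (mulVecE Qᵀ x) (Fin.last n)
  set s : EV (n+1) → ℝ := fun x => ℓ x - γ (P x) with hs
  have hγ2 : ContDiff ℝ 2 γ := hγ.of_le (by norm_num)
  have hγd : Differentiable ℝ γ := hγ2.differentiable (by norm_num)
  have hfd : ∀ x, fderiv ℝ s x = ℓ - (fderiv ℝ γ (P x)).comp P := fun x => by
    have h1 : HasFDerivAt s (ℓ - (fderiv ℝ γ (P x)).comp P) x :=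
      ℓ.hasFDerivAt.sub ((hγd (P x)).hasFDerivAt.comp x P.hasFDerivAt)
    exact h1.fderiv
  have hC1' : ∀ y, ‖fderiv ℝ γ y‖ ≤ C1 := fun y => by rw [← norm_iteratedFDeriv_one]; exact hC1 y
  have h10 : 0 ≤ C1 := (norm_nonneg _).trans (hC1' 0)
  have h20 : 0 ≤ C2 := (norm_nonneg _).trans (hC2 0)
  have hPe : P (lastDir Q) = 0 := by
    simp only [hP, lastDir, ContinuousLinearMap.comp_apply, mulVecL_apply, ← mulVecE_mul, hQ,
      mulVecE_one, fcL_apply]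
    ext i; simp [firstCoords_apply]
  have hℓe : ℓ (lastDir Q) = 1 := by
    simp [hℓ, lastDir, mulVecL_apply, ← mulVecE_mul, hQ, mulVecE_one]
  refine ⟨1 + C1 + C2, U, Q, s, hzU, hU, hQ, ?_, by linarith, ?_, ?_, ?_, ?_⟩
  · exact ℓ.contDiff.sub (hγ2.comp P.contDiff)
  · intro x
    rw [hfd]
    refine ContinuousLinearMap.opNorm_le_bound _ (by linarith) fun v => ?_
    rw [_root_.sub_apply, ContinuousLinearMap.comp_apply]
    have a1 := hℓn v
    have a2 : ‖fderiv ℝ γ (P x) (P v)‖ ≤ C1 * ‖v‖ := by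
      refine ((fderiv ℝ γ (P x)).le_opNorm _).trans ?_
      exact mul_le_mul (hC1' _) (hPn v) (norm_nonneg _) h10
    calc ‖ℓ v - fderiv ℝ γ (P x) (P v)‖ ≤ ‖ℓ v‖ + ‖fderiv ℝ γ (P x) (P v)‖ := norm_sub_le _ _
      _ ≤ ‖v‖ + C1 * ‖v‖ := add_le_add a1 a2
      _ ≤ _ := by nlinarith [norm_nonneg v, mul_nonneg h20 (norm_nonneg v)]
  · intro x t
    simp only [hs, map_add, map_smul, hPe, hℓe]
    simp; ring
  · intro x z
    have := taylor2 hγ2 h20 hC2 (P x) (P z)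
    have e : s (x - z) - s x + fderiv ℝ s x z =
        -(γ (P x - P z) - γ (P x) + fderiv ℝ γ (P x) (P z)) := by
      rw [hfd]; simp only [hs, map_sub, _root_.sub_apply, ContinuousLinearMap.comp_apply]
      ring
    rw [e, abs_neg]
    refine this.trans ?_
    change C2 * ‖P z‖ ^ 2 ≤ (1 + C1 + C2) * ‖P z‖ ^ 2
    gcongr; linarith
  · intro x hx
    have : x ∈ Ω ↔ x ∈ mulVecE Q '' halfSpace γ := by
      have h := Set.ext_iff.1 hΩU x
      simp only [Set.mem_inter_iff, hx, and_true] at h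
      exact h
    rw [this]
    have h2 : x ∈ mulVecE Q '' halfSpace γ ↔ mulVecE Qᵀ x ∈ halfSpace γ := by
      constructor
      · rintro ⟨y, hy, rfl⟩
        rwa [← mulVecE_mul, hQ, mulVecE_one]
      · intro h
        exact ⟨_, h, by rw [← mulVecE_mul, hQ', mulVecE_one]⟩
    rw [h2]
    change γ (P x) < ℓ x ↔ 0 < ℓ x - γ (P x)
    rw [sub_pos]

lemma exists_atlas {n : ℕ} {Ω : Set (EV (n+1))} (hΩ : IsGraphDomain 3 Ω)
    (hcpt : IsCompact (frontier Ω)) :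
    ∃ (Λ δ : ℝ) (t : Finset (EV (n+1))) (U : EV (n+1) → Set (EV (n+1)))
      (Q : EV (n+1) → Matrix (Fin (n+1)) (Fin (n+1)) ℝ) (s : EV (n+1) → EV (n+1) → ℝ),
      1 ≤ Λ ∧ 0 < δ ∧ (∀ k ∈ t, IsLChart Ω Λ (U k) (Q k) (s k)) ∧
      ∀ x ∈ Ω, Metric.ball x δ ⊆ Ω ∨ ∃ k ∈ t, Metric.ball x δ ⊆ U k := by
  classical
  have h : ∀ z : EV (n+1), ∃ Λ U Q s, z ∈ frontier Ω → (z ∈ U ∧ IsLChart Ω Λ U Q s) := fun z => by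
    by_cases hz : z ∈ frontier Ω
    · obtain ⟨Λ, U, Q, s, h⟩ := exists_lchart hΩ hz
      exact ⟨Λ, U, Q, s, fun _ => h⟩
    · exact ⟨0, ∅, 0, 0, fun h => absurd h hz⟩
  choose Λ U Q s hch using h
  obtain ⟨t, ht, hcov⟩ := hcpt.elim_nhds_subcover U fun x hx =>
    ((hch x hx).2.isOpen).mem_nhds (hch x hx).1
  obtain ⟨Λm, hΛm⟩ : ∃ Λm : ℝ, 1 ≤ Λm ∧ ∀ k ∈ t, Λ k ≤ Λm := by
    refine ⟨1 + ∑ k ∈ t, |Λ k|, le_add_of_nonneg_right (Finset.sum_nonneg fun _ _ => abs_nonneg _),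
      fun k hk => ?_⟩
    have := Finset.single_le_sum (f := fun k => |Λ k|) (fun _ _ => abs_nonneg _) hk
    have := le_abs_self (Λ k)
    linarith
  obtain ⟨δ, hδ, hleb⟩ := lebesgue_number_lemma_of_metric (ι := {k // k ∈ t})
    (c := fun k => U k.1) hcpt (fun k => (hch k.1 (ht k.1 k.2)).2.isOpen) (by
      intro x hx
      obtain ⟨k, hk, hxk⟩ := Set.mem_iUnion₂.1 (hcov hx)
      exact Set.mem_iUnion.2 ⟨⟨k, hk⟩, hxk⟩)
  refine ⟨Λm, δ / 2, t, U, Q, s, hΛm.1, by linarith, fun k hk =>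
    (hch k (ht k hk)).2.mono (hΛm.2 k hk), fun x hx => ?_⟩
  by_cases hb : Metric.ball x (δ/2) ⊆ Ω
  · exact Or.inl hb
  · right
    have hx2 : x ∈ Metric.ball x (δ/2) := Metric.mem_ball_self (by linarith)
    obtain ⟨y, hyb, hyf⟩ : (Metric.ball x (δ/2) ∩ frontier Ω).Nonempty := by
      by_contra hne
      rw [Set.not_nonempty_iff_eq_empty] at hne
      have hnf : ∀ y ∈ Metric.ball x (δ/2), y ∉ frontier Ω := fun y hy hf => by
        have : y ∈ Metric.ball x (δ/2) ∩ frontier Ω := ⟨hy, hf⟩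
        rw [hne] at this; exact this
      have hcl : ∀ y ∈ Metric.ball x (δ/2), y ∉ Ω → y ∈ (closure Ω)ᶜ := fun y hy hn hc => by
        rw [closure_eq_self_union_frontier] at hc
        exact hc.elim hn (hnf y hy)
      obtain ⟨y, hy, hyn⟩ := Set.not_subset.1 hb
      obtain ⟨w, -, hw1, hw2⟩ := (convex_ball x (δ/2)).isPreconnected Ω (closure Ω)ᶜ hΩ.1
        isClosed_closure.isOpen_compl (fun y hy => by
          by_cases h : y ∈ Ω
          · exact Or.inl h
          · exact Or.inr (hcl y hy h)) ⟨x, hx2, hx⟩ ⟨y, hy, hcl y hy hyn⟩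
      exact hw2 (subset_closure hw1)
    obtain ⟨k, hk⟩ := hleb y hyf
    refine ⟨k.1, k.2, fun w hw => hk ?_⟩
    rw [Metric.mem_ball] at *
    have := dist_triangle w x y
    rw [dist_comm] at hyb
    linarith

/-- the region of one-sided points -/
def oneSided {m : ℕ} (Ω : Set (EV m)) (δ0 : ℝ) (x : EV m) : Set (EV m) :=
  {z | ‖z‖ < δ0 ∧ x - z ∈ Ω ∧ x + z ∉ Ω}

lemma meas_oneSided {m : ℕ} {Ω : Set (EV m)} (hΩ : IsOpen Ω) (δ0 : ℝ) (x : EV m) :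
    MeasurableSet (oneSided Ω δ0 x) := by
  have h1 : MeasurableSet {z : EV m | ‖z‖ < δ0} := measurableSet_lt measurable_norm measurable_const
  have h2 : MeasurableSet {z : EV m | x - z ∈ Ω} := hΩ.measurableSet.preimage (by fun_prop)
  have h3 : MeasurableSet {z : EV m | x + z ∈ Ω} := hΩ.measurableSet.preimage (by fun_prop)
  exact h1.inter (h2.inter h3.compl)

/-- the drift -/
def bfun {m : ℕ} (Ω : Set (EV m)) (K : EV m → ℝ) (δ0 : ℝ) (x : EV m) (i : Fin m) : ℝ :=
  ∫ z in oneSided Ω δ0 x, kernelJ K z * z i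

/-- gradient vector -/
def gradV {m : ℕ} (s : EV m → ℝ) (x : EV m) : EV m :=
  WithLp.toLp 2 fun i => fderiv ℝ s x (EuclideanSpace.single i 1)

lemma lin_eq_sum {m : ℕ} (f : EV m →L[ℝ] ℝ) (z : EV m) :
    f z = ∑ i, f (EuclideanSpace.single i 1) * z i := by
  conv_lhs => rw [← (EuclideanSpace.basisFun (Fin m) ℝ).sum_repr z]
  simp [map_sum, mul_comm]

lemma inner_gradV {m : ℕ} (s : EV m → ℝ) (x z : EV m) :
    inner ℝ (gradV s x) z = fderiv ℝ s x z := by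
  rw [inner_eq_sum, lin_eq_sum]; rfl

lemma norm_gradV_le {m : ℕ} (s : EV m → ℝ) (x : EV m) : ‖gradV s x‖ ≤ ‖fderiv ℝ s x‖ := by
  rcases eq_or_ne (gradV s x) 0 with h | h
  · rw [h, norm_zero]; exact norm_nonneg _
  · have h1 : ‖gradV s x‖ ^ 2 = fderiv ℝ s x (gradV s x) := by
      rw [← inner_gradV, real_inner_self_eq_norm_sq]
    have h2 := (le_abs_self _).trans ((fderiv ℝ s x).le_opNorm (gradV s x))
    have h3 : 0 < ‖gradV s x‖ := norm_pos_iff.2 h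
    refine le_of_mul_le_mul_right ?_ h3
    rw [← sq, h1]; exact h2

lemma norm_lastDir {n : ℕ} {Q : Matrix (Fin (n+1)) (Fin (n+1)) ℝ} (hQ : Qᵀ * Q = 1) :
    ‖lastDir Q‖ = 1 := by
  unfold lastDir; rw [norm_mulVecE hQ]; simp

lemma IsLChart.fderiv_last {n : ℕ} {Ω : Set (EV (n+1))} {Λ : ℝ} {U Q s}
    (h : IsLChart Ω Λ U Q s) (x : EV (n+1)) : fderiv ℝ s x (lastDir Q) = 1 := by
  have h1 : HasDerivAt (fun t : ℝ => s (x + t • lastDir Q)) (fderiv ℝ s x (lastDir Q)) 0 := by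
    have hd : HasFDerivAt s (fderiv ℝ s x) (x + (0:ℝ) • lastDir Q) := by
      rw [zero_smul, add_zero]; exact ((h.smooth.differentiable (by norm_num)) x).hasFDerivAt
    have hl : HasDerivAt (fun t : ℝ => x + t • lastDir Q) (lastDir Q) 0 := by
      simpa using ((hasDerivAt_id (0:ℝ)).smul_const (lastDir Q)).const_add x
    exact hd.comp_hasDerivAt 0 hl
  have h2 : HasDerivAt (fun t : ℝ => s (x + t • lastDir Q)) 1 0 := by
    simp_rw [h.shift]; exact (hasDerivAt_id 0).const_add _
  exact h1.unique h2

lemma b_est {n : ℕ} {A : Matrix (Fin (n + 1)) (Fin (n + 1)) ℝ} (hA : A.PosDef)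
    {lam : ℝ} (hlam : 0 < lam) (hlow : ∀ ν : EV (n+1), lam * ‖ν‖ ≤ ‖mulVecE (A * A) ν‖)
    {K : EV (n+1) → ℝ} {m0 κ : ℝ} (hK : KerOK K m0) (hs : SliceOK A K) (hκ : 0 ≤ κ)
    (hcv : CurvOK K κ)
    {Ω : Set (EV (n+1))} (hΩ : IsOpen Ω) {Λ : ℝ} {U Q s} (h : IsLChart Ω Λ U Q s) {δ0 δ1 : ℝ}
    (hδ0 : 0 < δ0) (hδ : δ0 ≤ δ1) {x : EV (n+1)} (hx : x ∈ Ω) (hxU : Metric.ball x δ1 ⊆ U) :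
    ∃ β : ℝ, (∀ i, |bfun Ω K δ0 x i - β * mulVecE (A * A) (gradV s x) i| ≤
        2 * Λ * κ + m0 / δ0) ∧
      ENNReal.ofReal (|β| * lam) ≤ Gk K (s x / Λ) := by
  have hx1 : x ∈ Metric.ball x δ1 := Metric.mem_ball_self (hδ0.trans_le hδ)
  have hσ : 0 < s x := (h.mem_iff x (hxU hx1)).1 hx
  set ν := gradV s x with hν
  set σ := s x with hσdef
  have hΛ0 : 0 < Λ := zero_lt_one.trans_le h.one_le
  have hνe : inner ℝ ν (lastDir Q) = 1 := by rw [hν, inner_gradV]; exact h.fderiv_last x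
  have hνΛ : ‖ν‖ ≤ Λ := (norm_gradV_le s x).trans (h.bound x)
  have hν1 : 1 ≤ ‖ν‖ := by
    have := abs_real_inner_le_norm ν (lastDir Q)
    rw [hνe, norm_lastDir h.orth] at this
    simpa using this
  have hν0 : ν ≠ 0 := norm_pos_iff.1 (by linarith)
  obtain ⟨β, hβ, hβ2⟩ := direction hA hK hs hν0 hσ
  refine ⟨β, ?_, ?_⟩
  swap
  · refine (ENNReal.ofReal_le_ofReal ?_).trans (hβ2.trans (Gk_anti K ?_))
    · refine mul_le_mul_of_nonneg_left ?_ (abs_nonneg _)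
      have := hlow ν; nlinarith
    · exact div_le_div_of_nonneg_left hσ.le (by linarith) hνΛ
  intro i
  rw [← hβ i]
  obtain ⟨τ, hτ, hτΩ⟩ := Metric.isOpen_iff.1 hΩ x hx
  have hSb := meas_oneSided hΩ δ0 x
  set Sb := oneSided Ω δ0 x with hSbdef
  set Sν := {z : EV (n+1) | inner ℝ ν z ≤ -σ} with hSν
  have hSνm : MeasurableSet Sν := (isClosed_le (by fun_prop) continuous_const).measurableSet
  have hgC : ∀ z : EV (n+1), |z i| ≤ 1 * ‖z‖ := fun z => by rw [one_mul]; exact abs_coord_le z i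
  have i1 : IntegrableOn (fun z => kernelJ K z * z i) Sb :=
    integrableOn_first' hK hτ hSb (fun z hz => by
      by_contra hlt
      push Not at hlt
      exact hz.2.2 (hτΩ (by simpa [dist_eq_norm] using hlt))) (by fun_prop) 1 hgC
  have i2 : IntegrableOn (fun z => kernelJ K z * z i) Sν :=
    integrableOn_first' hK (τ := σ / ‖ν‖) (by positivity) hSνm (fun z (hz : inner ℝ ν z ≤ -σ) => by
      rw [div_le_iff₀ (by linarith)]
      have := abs_real_inner_le_norm ν z
      have := (abs_le.1 this).1
      linarith) (by fun_prop) 1 hgC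
  unfold bfun
  rw [← integral_indicator hSb, ← integral_indicator hSνm,
    ← integral_sub ((integrable_indicator_iff hSb).2 i1) ((integrable_indicator_iff hSνm).2 i2)]
  have hΛ' := hΛ0.le
  have hm0 := hK.m0pos
  have hb0 : 0 ≤ 2 * Λ * κ + m0 / δ0 := by positivity
  rw [← Real.norm_eq_abs]
  refine (norm_integral_le_lintegral_norm _).trans ?_
  refine ENNReal.toReal_le_of_le_ofReal hb0 ?_
  set T1 := {z : EV (n+1) | |σ - inner ℝ ν z| ≤ Λ * ‖firstCoords (mulVecE Qᵀ z)‖ ^ 2} with hT1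
  set T2 := {z : EV (n+1) | |-σ - inner ℝ ν z| ≤ Λ * ‖firstCoords (mulVecE Qᵀ z)‖ ^ 2} with hT2
  set T3 := {z : EV (n+1) | δ0 ≤ ‖z‖} with hT3
  have hfm : Continuous fun z : EV (n+1) => Λ * ‖firstCoords (mulVecE Qᵀ z)‖ ^ 2 :=
    continuous_const.mul (((fcL.comp (mulVecL Qᵀ)).continuous.norm).pow 2)
  have mT1 : MeasurableSet T1 := (isClosed_le (by fun_prop) hfm).measurableSet
  have mT2 : MeasurableSet T2 := (isClosed_le (by fun_prop) hfm).measurableSet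
  have mT3 : MeasurableSet T3 := meas_normge δ0
  set k : EV (n+1) → ℝ≥0∞ := fun z => ENNReal.ofReal (K z / ‖z‖) with hk
  have hkm : Measurable k := (hK.meas.div measurable_norm).ennreal_ofReal
  have hPneg : ∀ z : EV (n+1), ‖firstCoords (mulVecE Qᵀ (-z))‖ = ‖firstCoords (mulVecE Qᵀ z)‖ :=
    fun z => by
      have : firstCoords (mulVecE Qᵀ (-z)) = - firstCoords (mulVecE Qᵀ z) :=
        (fcL.comp (mulVecL Qᵀ)).map_neg z
      rw [this, norm_neg]
  have hcover : ∀ z, (z ∈ Sb ∧ z ∉ Sν) ∨ (z ∈ Sν ∧ z ∉ Sb) → z ∈ T1 ∨ z ∈ T2 ∨ z ∈ T3 := by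
    intro z hz
    by_cases hzδ : δ0 ≤ ‖z‖
    · exact Or.inr (Or.inr hzδ)
    push Not at hzδ
    have hm : x - z ∈ U := hxU (by simpa [dist_eq_norm] using hzδ.trans_le hδ)
    have hp : x + z ∈ U := hxU (by simpa [dist_eq_norm] using hzδ.trans_le hδ)
    have t1 := h.taylor x z
    have t2 := h.taylor x (-z)
    rw [sub_neg_eq_add, hPneg, map_neg, ← inner_gradV, ← hν] at t2
    rw [← inner_gradV, ← hν] at t1
    rw [abs_le] at t1 t2
    have T2of : ((s (x+z) ≤ 0 ∧ -σ < inner ℝ ν z) ∨ (0 < s (x+z) ∧ inner ℝ ν z ≤ -σ)) → z ∈ T2 := by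
      intro hh
      change |-σ - inner ℝ ν z| ≤ _
      rw [abs_le]
      rcases hh with hh | hh <;> constructor <;> linarith [hh.1, hh.2]
    rcases hz with ⟨hz1, hz2⟩ | ⟨hz1, hz2⟩
    · right; left
      have hz3 := hz1.2.2
      rw [h.mem_iff _ hp] at hz3
      have hz4 : ¬ inner ℝ ν z ≤ -σ := hz2
      exact T2of (Or.inl ⟨not_lt.1 hz3, not_le.1 hz4⟩)
    · have hz4 : inner ℝ ν z ≤ -σ := hz1
      by_cases ha : x + z ∈ Ω
      · right; left
        exact T2of (Or.inr ⟨(h.mem_iff _ hp).1 ha, hz4⟩)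
      · left
        have hb : x - z ∉ Ω := fun hb => hz2 ⟨hzδ, hb, ha⟩
        rw [h.mem_iff _ hm] at hb
        change |σ - inner ℝ ν z| ≤ _
        rw [abs_le]
        constructor <;> linarith
  have hpt : ∀ z, ENNReal.ofReal ‖Sb.indicator (fun z => kernelJ K z * z i) z -
      Sν.indicator (fun z => kernelJ K z * z i) z‖ ≤
      T1.indicator k z + T2.indicator k z + T3.indicator k z := by
    intro z
    have hle : ENNReal.ofReal ‖kernelJ K z * z i‖ ≤ k z := by
      refine ENNReal.ofReal_le_ofReal ?_
      rw [norm_mul, Real.norm_of_nonneg (kernelJ_nonneg hK.nonneg _), ← kernelJ_mul_norm]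
      exact mul_le_mul_of_nonneg_left (abs_coord_le z i) (kernelJ_nonneg hK.nonneg _)
    have hT : z ∈ T1 ∨ z ∈ T2 ∨ z ∈ T3 →
        k z ≤ T1.indicator k z + T2.indicator k z + T3.indicator k z := by
      rintro (hz | hz | hz)
      · rw [Set.indicator_of_mem hz, add_assoc]; exact le_self_add
      · rw [Set.indicator_of_mem (s := T2) hz, add_right_comm]; exact le_add_self
      · rw [Set.indicator_of_mem (s := T3) hz]; exact le_add_self
    by_cases hz1 : z ∈ Sb <;> by_cases hz2 : z ∈ Sν
    · simp [hz1, hz2]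
    · rw [Set.indicator_of_mem hz1, Set.indicator_of_notMem hz2, sub_zero]
      exact hle.trans (hT (hcover z (Or.inl ⟨hz1, hz2⟩)))
    · rw [Set.indicator_of_notMem hz1, Set.indicator_of_mem hz2, zero_sub, norm_neg]
      exact hle.trans (hT (hcover z (Or.inr ⟨hz2, hz1⟩)))
    · simp [hz1, hz2]
  refine (lintegral_mono hpt).trans ?_
  rw [lintegral_add_right _ (hkm.indicator mT3), lintegral_add_right _ (hkm.indicator mT2),
    lintegral_indicator mT1, lintegral_indicator mT2, lintegral_indicator mT3]
  have c1 := hcv Q ν σ Λ h.orth hνe hΛ'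
  have c2 := hcv Q ν (-σ) Λ h.orth hνe hΛ'
  have c3 : ∫⁻ z in T3, k z ≤ ENNReal.ofReal (m0 / δ0) := by
    have := Gk_mul_le hK hδ0
    rw [ENNReal.ofReal_div_of_pos hδ0, ENNReal.le_div_iff_mul_le (by simp [hδ0]) (by simp), mul_comm]
    exact this
  refine (add_le_add (add_le_add c1 c2) c3).trans ?_
  rw [← ENNReal.ofReal_add (by positivity) (by positivity),
    ← ENNReal.ofReal_add (by positivity) (by positivity)]
  exact ENNReal.ofReal_le_ofReal (by linarith)

lemma hardy {m : ℕ} {p : ℝ≥0∞} (hp1 : 1 ≤ p) (hp : p ≠ ⊤) (e : EV m) {s : EV m → ℝ}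
    (hs : Measurable s) (S : Set (EV m)) {w g : EV m → ℝ≥0∞} (hg : Measurable g)
    (hS : MeasurableSet S)
    (hw : ∀ᵐ x, x ∈ S → 0 < s x ∧ w x ≤ ∫⁻ t in Set.Ioo 0 (s x), g (x - t • e))
    {H : ℝ → ℝ≥0∞} (hH : Antitone H) {c : ℝ≥0∞} (hc : c ≠ ⊤)
    (hr : ∀ r : ℝ, 0 < r → ENNReal.ofReal r * H r ≤ c) (hi : ∫⁻ t in Set.Ioi (0:ℝ), H t ≤ c) :
    eLpNorm (fun x => H (s x) * w x) p (volume.restrict S) ≤ c * eLpNorm g p volume := by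
  have hq := toReal_ge_one hp1 hp
  rw [eLpNorm_le_iff_lint _ hp1 hp]
  set q := p.toReal
  have hHm : Measurable H := hH.measurable
  have hgq : ∫⁻ x, g x ^ q ≤ eLpNorm g p volume ^ q := (eLpNorm_le_iff_lint _ hp1 hp g _).1 le_rfl
  have step1 : ∀ᵐ x, x ∈ S → (H (s x) * w x) ^ q ≤ c ^ (q - 1) *
      ∫⁻ t in Set.Ioi (0:ℝ), H t * g (x - t • e) ^ q := by
    filter_upwards [hw] with x hx hxS
    obtain ⟨h0, h1⟩ := hx hxS
    haveI : IsFiniteMeasure (volume.restrict (Set.Ioo 0 (s x))) := ⟨by simp⟩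
    have h2 := lintegral_rpow_jensen (volume.restrict (Set.Ioo 0 (s x))) q hq
      (fun t => g (x - t • e)) (by fun_prop)
    have h3 : volume.restrict (Set.Ioo 0 (s x)) Set.univ = ENNReal.ofReal (s x) := by simp
    rw [h3] at h2
    calc (H (s x) * w x) ^ q = H (s x) ^ q * w x ^ q := ENNReal.mul_rpow_of_nonneg _ _ (by linarith)
      _ ≤ H (s x) ^ q * (ENNReal.ofReal (s x) ^ (q - 1) *
            ∫⁻ t in Set.Ioo 0 (s x), g (x - t • e) ^ q) := by
          gcongr
          exact (ENNReal.rpow_le_rpow h1 (by linarith)).trans h2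
      _ = (ENNReal.ofReal (s x) * H (s x)) ^ (q - 1) * (H (s x) *
            ∫⁻ t in Set.Ioo 0 (s x), g (x - t • e) ^ q) := by
          rw [ENNReal.mul_rpow_of_nonneg _ _ (by linarith)]
          have : H (s x) ^ q = H (s x) ^ (q - 1) * H (s x) := by
            conv_rhs => rw [← ENNReal.rpow_one (H (s x)), ← ENNReal.rpow_mul, one_mul]
            rw [← ENNReal.rpow_add_of_nonneg _ _ (by linarith) (by norm_num)]
            congr 1; ring
          rw [this]; ring
      _ ≤ c ^ (q - 1) * ∫⁻ t in Set.Ioi (0:ℝ), H t * g (x - t • e) ^ q := by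
          gcongr
          · exact hr _ h0
          · rw [← lintegral_const_mul _ (by fun_prop)]
            refine (setLIntegral_mono (by fun_prop) fun t ht => ?_).trans
              (lintegral_mono_set fun t ht => ht.1)
            gcongr
            exact hH ht.2.le
  calc ∫⁻ x in S, (H (s x) * w x) ^ q ≤ ∫⁻ x in S, c ^ (q - 1) *
        ∫⁻ t in Set.Ioi (0:ℝ), H t * g (x - t • e) ^ q :=
        lintegral_mono_ae ((ae_restrict_iff' hS).2 step1)
    _ ≤ ∫⁻ x, c ^ (q - 1) * ∫⁻ t in Set.Ioi (0:ℝ), H t * g (x - t • e) ^ q :=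
        setLIntegral_le_lintegral _ _
    _ = c ^ (q - 1) * ∫⁻ x, ∫⁻ t in Set.Ioi (0:ℝ), H t * g (x - t • e) ^ q := by
        rw [lintegral_const_mul' _ _ (ENNReal.rpow_ne_top_of_nonneg (by linarith) hc)]
    _ = c ^ (q - 1) * ∫⁻ t in Set.Ioi (0:ℝ), ∫⁻ x, H t * g (x - t • e) ^ q := by
        rw [lintegral_lintegral_swap]
        refine Measurable.aemeasurable ?_
        simp only [Function.uncurry_def]
        fun_prop
    _ = c ^ (q - 1) * ∫⁻ t in Set.Ioi (0:ℝ), H t * ∫⁻ x, g x ^ q := by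
        congr 1
        refine lintegral_congr fun t => ?_
        rw [lintegral_const_mul _ (by fun_prop),
          lintegral_sub_right_eq_self (fun x => g x ^ q) (t • e)]
    _ = c ^ (q - 1) * ((∫⁻ t in Set.Ioi (0:ℝ), H t) * ∫⁻ x, g x ^ q) := by
        rw [lintegral_mul_const _ hHm]
    _ ≤ c ^ (q - 1) * (c * eLpNorm g p volume ^ q) := by gcongr
    _ = (c * eLpNorm g p volume) ^ q := by
        rw [ENNReal.mul_rpow_of_nonneg _ _ (by linarith), ← mul_assoc]
        congr 1
        conv_lhs => rw [← ENNReal.rpow_one c, ← ENNReal.rpow_mul, one_mul]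
        rw [← ENNReal.rpow_add_of_nonneg _ _ (by linarith) (by norm_num)]
        congr 1; ring

lemma IsLChart.fderiv_shift {n : ℕ} {Ω : Set (EV (n+1))} {Λ : ℝ} {U Q s}
    (h : IsLChart Ω Λ U Q s) (x : EV (n+1)) (t : ℝ) :
    fderiv ℝ s (x + t • lastDir Q) = fderiv ℝ s x := by
  rw [← fderiv_comp_add_right]
  simp_rw [h.shift]
  rw [fderiv_add_const]

lemma IsLChart.contDiff_dir {n : ℕ} {Ω : Set (EV (n+1))} {Λ : ℝ} {U Q s}
    (h : IsLChart Ω Λ U Q s) (a : EV (n+1)) : ContDiff ℝ 1 (fun x => fderiv ℝ s x a) :=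
  (h.smooth.fderiv_right (m := 1) (by norm_num)).clm_apply contDiff_const

lemma IsLChart.fderiv_dir_last {n : ℕ} {Ω : Set (EV (n+1))} {Λ : ℝ} {U Q s}
    (h : IsLChart Ω Λ U Q s) (a x : EV (n+1)) :
    fderiv ℝ (fun x => fderiv ℝ s x a) x (lastDir Q) = 0 := by
  set σ := fun x => fderiv ℝ s x a with hσ
  have h1 : HasDerivAt (fun t : ℝ => σ (x + t • lastDir Q)) (fderiv ℝ σ x (lastDir Q)) 0 := by
    have hd : HasFDerivAt σ (fderiv ℝ σ x) (x + (0:ℝ) • lastDir Q) := by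
      rw [zero_smul, add_zero]
      exact (((h.contDiff_dir a).differentiable (by norm_num)) x).hasFDerivAt
    have hl : HasDerivAt (fun t : ℝ => x + t • lastDir Q) (lastDir Q) 0 := by
      simpa using ((hasDerivAt_id (0:ℝ)).smul_const (lastDir Q)).const_add x
    exact hd.comp_hasDerivAt 0 hl
  have h2 : HasDerivAt (fun t : ℝ => σ (x + t • lastDir Q)) 0 0 := by
    simp_rw [hσ, h.fderiv_shift]; exact hasDerivAt_const _ _
  exact h1.unique h2

/-- transfer of a normal derivative to a tangential one across the boundary -/
lemma zt_single {n : ℕ} {Ω : Set (EV (n+1))} (hΩ : IsOpen Ω) {Λ : ℝ} {U Q s}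
    (h : IsLChart Ω Λ U Q s) {f ge gi : EV (n+1) → ℝ} (hf : LocallyIntegrable f volume)
    (hge : LocallyIntegrable ge volume) (hgi : LocallyIntegrable gi volume)
    (hf0 : ∀ x, x ∉ Ω → f x = 0) (hge0 : ∀ x, x ∉ Ω → ge x = 0) (hgi0 : ∀ x, x ∉ Ω → gi x = 0)
    {a : EV (n+1)} (he : WD Ω (lastDir Q) f ge) (ha : WD Ω a f gi)
    {φ : EV (n+1) → ℝ} (hφ : ContDiff ℝ (⊤ : ℕ∞) φ) (hc : HasCompactSupport φ)
    (hsu : tsupport φ ⊆ U) :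
    ∫ x, (f x * (fderiv ℝ s x a * fderiv ℝ φ x (lastDir Q) - fderiv ℝ φ x a) +
      (ge x * (fderiv ℝ s x a * φ x) - gi x * φ x)) = 0 := by
  have hφ1 : ContDiff ℝ 1 φ := hφ.of_le (by exact_mod_cast le_top)
  have hs1 : ContDiff ℝ 1 s := h.smooth.of_le (by norm_num)
  set e := lastDir Q with he_def
  set σ := fun x => fderiv ℝ s x a with hσ
  have hσ1 : ContDiff ℝ 1 σ := h.contDiff_dir a
  set η : ℕ → EV (n+1) → ℝ := fun k x => Real.smoothTransition (k * s x - 1) with hη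
  have hη1 : ∀ k, ContDiff ℝ 1 (η k) := fun k =>
    Real.smoothTransition.contDiff.comp ((contDiff_const.mul hs1).sub contDiff_const)
  set F : EV (n+1) → ℝ := fun x => f x * (σ x * fderiv ℝ φ x e - fderiv ℝ φ x a) +
      (ge x * (σ x * φ x) - gi x * φ x) with hF
  have i1 : Integrable (fun x => f x * (σ x * fderiv ℝ φ x e - fderiv ℝ φ x a)) :=
    integrable_mul_cs hf ((hσ1.continuous.mul (cont_dir hφ1 e)).sub (cont_dir hφ1 a))
      (((hasCompactSupport_dir hc e).mul_left).sub (hasCompactSupport_dir hc a))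
  have i2 : Integrable (fun x => ge x * (σ x * φ x)) :=
    integrable_mul_cs hge (hσ1.continuous.mul hφ1.continuous) hc.mul_left
  have i3 : Integrable (fun x => gi x * φ x) := integrable_mul_cs hgi hφ1.continuous hc
  have hFi : Integrable F := i1.add (i2.sub i3)
  have key : ∀ k : ℕ, ∫ x, η k x * F x = 0 := by
    intro k
    set χ : EV (n+1) → ℝ := fun x => φ x * η k x with hχ
    have hχ1 : ContDiff ℝ 1 χ := hφ1.mul (hη1 k)
    have hχc : HasCompactSupport χ := hc.mul_right
    have hχs : tsupport χ ⊆ Ω := by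
      have : tsupport χ ⊆ tsupport φ ∩ {x | 1 ≤ k * s x} := by
        refine closure_minimal ?_ ((isClosed_tsupport φ).inter
          (isClosed_le continuous_const (continuous_const.mul hs1.continuous)))
        intro x hx
        refine ⟨subset_tsupport φ (left_ne_zero_of_mul hx), ?_⟩
        by_contra hlt
        exact right_ne_zero_of_mul hx (Real.smoothTransition.zero_of_nonpos (by
          simp only [Set.mem_ofPred_eq] at hlt; linarith))
      intro x hx
      obtain ⟨hx1, hx2⟩ := this hx
      refine (h.mem_iff x (hsu hx1)).2 ?_
      have hx2 : (1:ℝ) ≤ k * s x := hx2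
      by_contra hle
      have : (k:ℝ) * s x ≤ 0 := mul_nonpos_of_nonneg_of_nonpos (by positivity) (by linarith)
      linarith
    have hψ1 : ContDiff ℝ 1 (fun x => σ x * χ x) := hσ1.mul hχ1
    have hψc : HasCompactSupport (fun x => σ x * χ x) := hχc.mul_left
    have hψs : tsupport (fun x => σ x * χ x) ⊆ Ω := (tsupport_mul_subset_right).trans hχs
    have e1 := wd_C1 hΩ hf hge he _ hψ1 hψc hψs
    have e2 := wd_C1 hΩ hf hgi ha _ hχ1 hχc hχs
    have dσ : Differentiable ℝ σ := hσ1.differentiable (by norm_num)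
    have dχ : Differentiable ℝ χ := hχ1.differentiable (by norm_num)
    have dφ : Differentiable ℝ φ := hφ1.differentiable (by norm_num)
    have dη : Differentiable ℝ (η k) := (hη1 k).differentiable (by norm_num)
    have ds : Differentiable ℝ s := hs1.differentiable (by norm_num)
    have d1 : ∀ x b, fderiv ℝ χ x b = φ x * fderiv ℝ (η k) x b + η k x * fderiv ℝ φ x b := by
      intro x b
      rw [hχ, fderiv_fun_mul (dφ x) (dη x)]; simp
    have d2 : ∀ x, fderiv ℝ (fun x => σ x * χ x) x e = σ x * fderiv ℝ χ x e := by
      intro x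
      rw [fderiv_fun_mul (dσ x) (dχ x)]; simp [hσ, he_def, h.fderiv_dir_last]
    have d3 : ∀ x, ∃ r, ∀ b, fderiv ℝ (η k) x b = r * fderiv ℝ s x b := by
      intro x
      have hd : HasDerivAt Real.smoothTransition (deriv Real.smoothTransition (k * s x - 1))
          (k * s x - 1) :=
        ((Real.smoothTransition.contDiff (n := 1)).differentiable (by norm_num) _).hasDerivAt
      have := hd.comp_hasFDerivAt x (((ds x).hasFDerivAt.const_mul (k:ℝ)).sub_const 1)
      refine ⟨deriv Real.smoothTransition (k * s x - 1) * k, fun b => ?_⟩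
      have h2 : fderiv ℝ (η k) x = _ := this.fderiv
      rw [h2]; simp [mul_assoc]
    have j1 : Integrable (fun x => f x * fderiv ℝ (fun x => σ x * χ x) x e) :=
      integrable_mul_cs hf (cont_dir hψ1 e) (hasCompactSupport_dir hψc e)
    have j2 : Integrable (fun x => f x * fderiv ℝ χ x a) :=
      integrable_mul_cs hf (cont_dir hχ1 a) (hasCompactSupport_dir hχc a)
    have j3 : Integrable (fun x => ge x * (σ x * χ x)) :=
      integrable_mul_cs hge hψ1.continuous hψc
    have j4 : Integrable (fun x => gi x * χ x) := integrable_mul_cs hgi hχ1.continuous hχc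
    have e3 : ∫ x, η k x * F x = (∫ x, f x * fderiv ℝ (fun x => σ x * χ x) x e) -
        (∫ x, f x * fderiv ℝ χ x a) + ((∫ x, ge x * (σ x * χ x)) - ∫ x, gi x * χ x) := by
      rw [← integral_sub j1 j2, ← integral_sub j3 j4]
      refine Eq.trans ?_ (integral_add (j1.sub j2) (j3.sub j4))
      refine integral_congr_ae (ae_of_all _ fun x => ?_)
      obtain ⟨r, hr⟩ := d3 x
      have h5 : fderiv ℝ s x e = 1 := h.fderiv_last x
      change η k x * F x = (f x * fderiv ℝ (fun x => σ x * χ x) x e - f x * fderiv ℝ χ x a) +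
        (ge x * (σ x * χ x) - gi x * χ x)
      rw [d2, d1, d1, hr, hr, h5]
      simp only [hF, hχ]
      have h6 : fderiv ℝ s x a = σ x := rfl
      rw [h6]; ring
    rw [e3, e1, e2]; ring
  have hlim : Tendsto (fun k : ℕ => ∫ x, η k x * F x) atTop (𝓝 (∫ x, F x)) := by
    refine tendsto_integral_of_dominated_convergence (fun x => ‖F x‖) ?_ hFi.norm ?_ ?_
    · intro k
      exact (hη1 k).continuous.aestronglyMeasurable.mul hFi.aestronglyMeasurable
    · intro k
      refine ae_of_all _ fun x => ?_
      rw [norm_mul, Real.norm_of_nonneg (Real.smoothTransition.nonneg _)]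
      exact mul_le_of_le_one_left (norm_nonneg _) (Real.smoothTransition.le_one _)
    · refine ae_of_all _ fun x => ?_
      by_cases hxU : x ∈ U
      · by_cases hxΩ : x ∈ Ω
        · have hsx := (h.mem_iff x hxU).1 hxΩ
          refine tendsto_const_nhds.congr' ?_
          obtain ⟨k0, hk0⟩ := exists_nat_ge (2 / s x)
          filter_upwards [eventually_ge_atTop k0] with k hk
          have : (2 / s x) ≤ k := hk0.trans (by exact_mod_cast hk)
          rw [div_le_iff₀ hsx] at this
          have : η k x = 1 := Real.smoothTransition.one_of_one_le (by linarith)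
          rw [this, one_mul]
        · have : F x = 0 := by simp [hF, hf0 x hxΩ, hge0 x hxΩ, hgi0 x hxΩ]
          simp [this]
      · have hn : x ∉ tsupport φ := fun hh => hxU (hsu hh)
        have h1 : φ x = 0 := image_eq_zero_of_notMem_tsupport hn
        have h2 : fderiv ℝ φ x = 0 := by
          have := fun hh => hn (tsupport_fderiv_subset ℝ (f := φ) hh)
          exact image_eq_zero_of_notMem_tsupport this
        have : F x = 0 := by simp [hF, h1, h2]
        simp [this]
  exact tendsto_nhds_unique (hlim.congr key |>.mono_left le_rfl) tendsto_const_nhds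


/-- unit coordinate vector -/
abbrev ee {m : ℕ} (i : Fin m) : EV m := EuclideanSpace.single i 1

lemma wd_dir {m : ℕ} {U : Set (EV m)} {f : EV m → ℝ} {g : Fin m → EV m → ℝ}
    (hf : LocallyIntegrable f volume) (hg : ∀ l, LocallyIntegrable (g l) volume)
    (h : ∀ l, WD U (ee l) f (g l)) (a : EV m) : WD U a f (fun x => ∑ l, a l * g l x) := by
  intro φ hφ hc hs
  have hφ1 : ContDiff ℝ 1 φ := hφ.of_le (by exact_mod_cast le_top)
  have e1 : ∀ x, f x * fderiv ℝ φ x a = ∑ l, a l * (f x * fderiv ℝ φ x (ee l)) := fun x => by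
    rw [lin_eq_sum (fderiv ℝ φ x) a, Finset.mul_sum]
    exact Finset.sum_congr rfl fun l _ => by ring
  have e2 : ∀ x, (∑ l, a l * g l x) * φ x = ∑ l, a l * (g l x * φ x) := fun x => by
    rw [Finset.sum_mul]
    exact Finset.sum_congr rfl fun l _ => by ring
  simp_rw [e1, e2]
  rw [integral_finsetSum _ fun l _ => (integrable_mul_cs hf (cont_dir hφ1 _)
      (hasCompactSupport_dir hc _)).const_mul _,
    integral_finsetSum _ fun l _ => (integrable_mul_cs (hg l) hφ1.continuous hc).const_mul _,
    ← Finset.sum_neg_distrib]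
  refine Finset.sum_congr rfl fun l _ => ?_
  rw [integral_const_mul, integral_const_mul, h l φ hφ hc hs]; ring

lemma wd_smul {m : ℕ} {U : Set (EV m)} {f g : EV m → ℝ} {a : EV m} (h : WD U a f g) (c : ℝ) :
    WD U (c • a) f (fun x => c * g x) := by
  intro φ hφ hc hs
  have e1 : ∀ x, f x * fderiv ℝ φ x (c • a) = c * (f x * fderiv ℝ φ x a) := fun x => by
    rw [map_smul, smul_eq_mul]; ring
  simp_rw [e1, mul_assoc]
  rw [integral_const_mul, integral_const_mul, h φ hφ hc hs]; ring

/-- a measurable representative of a Sobolev function with its derivatives -/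
structure SobData {m : ℕ} (Ω : Set (EV m)) (M : Matrix (Fin m) (Fin m) ℝ) (p : ℝ≥0∞)
    (U0 : EV m → ℝ) (U1 : Fin m → EV m → ℝ) (U2 : Fin m → Fin m → EV m → ℝ) : Prop where
  m0 : Measurable U0
  m1 : ∀ i, Measurable (U1 i)
  m2 : ∀ i j, Measurable (U2 i j)
  z0 : ∀ x, x ∉ Ω → U0 x = 0
  z1 : ∀ i x, x ∉ Ω → U1 i x = 0
  z2 : ∀ i j x, x ∉ Ω → U2 i j x = 0
  l0 : MemLp U0 p volume
  l1 : ∀ i, MemLp (U1 i) p volume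
  l2 : ∀ i j, MemLp (U2 i j) p volume
  wd0 : ∀ i, WD Ω (ee i) U0 (U1 i)
  wd1 : ∀ i j, WD Ω (ee i) (U1 j) (U2 i j)
  neu : ∀ φ : EV m → ℝ, ContDiff ℝ (⊤ : ℕ∞) φ → HasCompactSupport φ →
      (∑ i : Fin m, ∑ j : Fin m, M i j * ∫ x, U2 i j x * φ x)
        = - ∑ i : Fin m, ∑ j : Fin m, M i j * ∫ x, U1 j x * fderiv ℝ φ x (ee i)

/-- conormal derivative -/
def wt {m : ℕ} (M : Matrix (Fin m) (Fin m) ℝ) (s : EV m → ℝ) (U1 : Fin m → EV m → ℝ)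
    (x : EV m) : ℝ := ∑ i, ∑ j, M i j * (fderiv ℝ s x (ee i) * U1 j x)

/-- its derivative in direction `e` -/
def gt {m : ℕ} (M : Matrix (Fin m) (Fin m) ℝ) (s : EV m → ℝ) (e : EV m)
    (U2 : Fin m → Fin m → EV m → ℝ) (x : EV m) : ℝ :=
  ∑ i, ∑ j, M i j * (fderiv ℝ s x (ee i) * ∑ l, e l * U2 l j x)

lemma integral_dsum {m : ℕ} (M : Matrix (Fin m) (Fin m) ℝ) (F : Fin m → Fin m → EV m → ℝ)
    (hF : ∀ i j, Integrable (F i j)) :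
    ∫ x, ∑ i, ∑ j, M i j * F i j x = ∑ i, ∑ j, M i j * ∫ x, F i j x := by
  rw [integral_finsetSum _ fun i _ => integrable_finsetSum _ fun j _ => (hF i j).const_mul (M i j)]
  refine Finset.sum_congr rfl fun i _ => ?_
  rw [integral_finsetSum _ fun j _ => (hF i j).const_mul (M i j)]
  exact Finset.sum_congr rfl fun j _ => integral_const_mul _ _

lemma wd_wt {n : ℕ} {Ω : Set (EV (n+1))} (hΩ : IsOpen Ω) {Λ : ℝ} {U Q s}
    (h : IsLChart Ω Λ U Q s) {M : Matrix (Fin (n+1)) (Fin (n+1)) ℝ} {p : ℝ≥0∞} (hp1 : 1 ≤ p)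
    {U0 U1 U2} (hu : SobData Ω M p U0 U1 U2) :
    WD U (lastDir Q) (wt M s U1) (gt M s (lastDir Q) U2) := by
  intro φ hφ hc hsu
  have hφ1 : ContDiff ℝ 1 φ := hφ.of_le (by exact_mod_cast le_top)
  set e := lastDir Q with he
  have L1 : ∀ j, LocallyIntegrable (U1 j) volume := fun j => (hu.l1 j).locallyIntegrable hp1
  have L2 : ∀ i j, LocallyIntegrable (U2 i j) volume := fun i j => (hu.l2 i j).locallyIntegrable hp1
  set ge : Fin (n+1) → EV (n+1) → ℝ := fun j x => ∑ l, e l * U2 l j x with hge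
  have Lge : ∀ j, LocallyIntegrable (ge j) volume := fun j => by
    have : MemLp (ge j) p volume :=
      memLp_finsetSum (Finset.univ) fun l _ => (hu.l2 l j).const_mul (e l)
    exact this.locallyIntegrable hp1
  have hσ : ∀ i, Continuous fun x => fderiv ℝ s x (ee i) := fun i => (h.contDiff_dir _).continuous
  have key := fun i j => zt_single hΩ h (L1 j) (Lge j) (L2 i j) (hu.z1 j)
    (fun x hx => by simp [hge, hu.z2 _ _ x hx]) (hu.z2 i j)
    (wd_dir (L1 j) (fun l => L2 l j) (fun l => hu.wd1 l j) e) (hu.wd1 i j) hφ hc hsu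
  have a1 : ∀ i j, Integrable fun x => U1 j x * (fderiv ℝ s x (ee i) * fderiv ℝ φ x e) := fun i j =>
    integrable_mul_cs (L1 j) ((hσ i).mul (cont_dir hφ1 e)) (hasCompactSupport_dir hc e).mul_left
  have a2 : ∀ i j, Integrable fun x => U1 j x * fderiv ℝ φ x (ee i) := fun i j =>
    integrable_mul_cs (L1 j) (cont_dir hφ1 _) (hasCompactSupport_dir hc _)
  have a3 : ∀ i j, Integrable fun x => ge j x * (fderiv ℝ s x (ee i) * φ x) := fun i j =>
    integrable_mul_cs (Lge j) ((hσ i).mul hφ1.continuous) hc.mul_left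
  have a4 : ∀ i j, Integrable fun x => U2 i j x * φ x := fun i j =>
    integrable_mul_cs (L2 i j) hφ1.continuous hc
  have key2 : ∀ i j, (∫ x, U1 j x * (fderiv ℝ s x (ee i) * fderiv ℝ φ x e)) -
      (∫ x, U1 j x * fderiv ℝ φ x (ee i)) + ((∫ x, ge j x * (fderiv ℝ s x (ee i) * φ x)) -
        ∫ x, U2 i j x * φ x) = 0 := by
    intro i j
    rw [← integral_sub (a1 i j) (a2 i j), ← integral_sub (a3 i j) (a4 i j)]
    refine (integral_add ((a1 i j).sub (a2 i j)) ((a3 i j).sub (a4 i j))).symm.trans ?_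
    rw [← key i j]
    refine integral_congr_ae (ae_of_all _ fun x => ?_)
    simp only [Pi.sub_apply]; ring
  have e1 : ∀ x, wt M s U1 x * fderiv ℝ φ x e = ∑ i, ∑ j, M i j *
      (U1 j x * (fderiv ℝ s x (ee i) * fderiv ℝ φ x e)) := fun x => by
    unfold wt
    simp only [Finset.sum_mul]
    exact Finset.sum_congr rfl fun i _ => Finset.sum_congr rfl fun j _ => by ring
  have e2 : ∀ x, gt M s e U2 x * φ x = ∑ i, ∑ j, M i j *
      (ge j x * (fderiv ℝ s x (ee i) * φ x)) := fun x => by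
    unfold gt
    simp only [Finset.sum_mul (Finset.univ)]
    refine Finset.sum_congr rfl fun i _ => Finset.sum_congr rfl fun j _ => ?_
    change M i j * (fderiv ℝ s x (ee i) * ge j x) * φ x = _
    ring
  simp_rw [e1, e2]
  rw [integral_dsum _ _ a1, integral_dsum _ _ a3]
  have hn := hu.neu φ hφ hc
  have hz : ∑ i, ∑ j, M i j * ((∫ x, U1 j x * (fderiv ℝ s x (ee i) * fderiv ℝ φ x e)) -
      (∫ x, U1 j x * fderiv ℝ φ x (ee i)) + ((∫ x, ge j x * (fderiv ℝ s x (ee i) * φ x)) -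
        ∫ x, U2 i j x * φ x)) = 0 := by simp [key2]
  simp only [mul_add, mul_sub, Finset.sum_add_distrib, Finset.sum_sub_distrib] at hz
  linarith

lemma eLpNorm_sum_bound {m : ℕ} {ι : Type*} (μ : Measure (EV m)) {p : ℝ≥0∞} (hp1 : 1 ≤ p)
    (hp : p ≠ ⊤) (t : Finset ι) (c : ι → ℝ) (f : ι → EV m → ℝ) (hf : ∀ i ∈ t, Measurable (f i))
    (F : EV m → ℝ) (hc : ∀ i ∈ t, 0 ≤ c i) (hF : ∀ x, |F x| ≤ ∑ i ∈ t, c i * |f i x|) {W : ℝ≥0∞}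
    (hW : ∀ i ∈ t, eLpNorm (f i) p μ ≤ W) :
    eLpNorm F p μ ≤ ENNReal.ofReal (∑ i ∈ t, c i) * W := by
  rw [← eLpNorm_enorm_e]
  calc eLpNorm (fun x => ‖F x‖ₑ) p μ
      ≤ eLpNorm (fun x => ∑ i ∈ t, ENNReal.ofReal (c i) * ‖f i x‖ₑ) p μ := by
        refine eLpNorm_mono_e _ (ae_of_all _ fun x => ?_)
        rw [Real.enorm_eq_ofReal_abs]
        refine (ENNReal.ofReal_le_ofReal (hF x)).trans (le_of_eq ?_)
        rw [ENNReal.ofReal_sum_of_nonneg fun i hi => mul_nonneg (hc i hi) (abs_nonneg _)]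
        exact Finset.sum_congr rfl fun i hi => by
          rw [ENNReal.ofReal_mul (hc i hi), Real.enorm_eq_ofReal_abs]
    _ ≤ ∑ i ∈ t, eLpNorm (fun x => ENNReal.ofReal (c i) * ‖f i x‖ₑ) p μ :=
        eLpNorm_sum_e μ hp1 t fun i hi => (hf i hi).enorm.const_mul _
    _ ≤ ∑ i ∈ t, ENNReal.ofReal (c i) * W := by
        refine Finset.sum_le_sum fun i hi => ?_
        refine (eLpNorm_cmul_le μ hp1 hp _ _ ENNReal.ofReal_ne_top).trans ?_
        rw [eLpNorm_enorm_e]; gcongr; exact hW i hi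
    _ = _ := by rw [ENNReal.ofReal_sum_of_nonneg hc, Finset.sum_mul]

/-- total norm -/
def SobW {m : ℕ} (p : ℝ≥0∞) (U0 : EV m → ℝ) (U1 : Fin m → EV m → ℝ)
    (U2 : Fin m → Fin m → EV m → ℝ) : ℝ≥0∞ :=
  eLpNorm U0 p volume + (∑ i, eLpNorm (U1 i) p volume) + ∑ i, ∑ j, eLpNorm (U2 i j) p volume

lemma SobW_0 {m : ℕ} (p : ℝ≥0∞) (U0 : EV m → ℝ) (U1 : Fin m → EV m → ℝ)
    (U2 : Fin m → Fin m → EV m → ℝ) : eLpNorm U0 p volume ≤ SobW p U0 U1 U2 := by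
  unfold SobW; rw [add_assoc]; exact le_self_add

lemma SobW_1 {m : ℕ} (p : ℝ≥0∞) (U0 : EV m → ℝ) (U1 : Fin m → EV m → ℝ)
    (U2 : Fin m → Fin m → EV m → ℝ) (i : Fin m) : eLpNorm (U1 i) p volume ≤ SobW p U0 U1 U2 := by
  unfold SobW
  refine le_trans ?_ (le_self_add)
  refine le_trans ?_ (le_add_self)
  exact Finset.single_le_sum (f := fun i => eLpNorm (U1 i) p volume) (fun _ _ => zero_le)
    (Finset.mem_univ i)

lemma SobW_2 {m : ℕ} (p : ℝ≥0∞) (U0 : EV m → ℝ) (U1 : Fin m → EV m → ℝ)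
    (U2 : Fin m → Fin m → EV m → ℝ) (i j : Fin m) :
    eLpNorm (U2 i j) p volume ≤ SobW p U0 U1 U2 := by
  unfold SobW
  refine le_trans ?_ (le_add_self)
  refine le_trans (Finset.single_le_sum (f := fun j => eLpNorm (U2 i j) p volume)
    (fun _ _ => zero_le) (Finset.mem_univ j)) ?_
  exact Finset.single_le_sum (f := fun i => ∑ j, eLpNorm (U2 i j) p volume) (fun _ _ => zero_le)
    (Finset.mem_univ i)

lemma SobW_ne_top {m : ℕ} {Ω : Set (EV m)} {M : Matrix (Fin m) (Fin m) ℝ} {p : ℝ≥0∞}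
    {U0 U1 U2} (hu : SobData Ω M p U0 U1 U2) : SobW p U0 U1 U2 ≠ ⊤ := by
  unfold SobW
  refine ENNReal.add_ne_top.2 ⟨ENNReal.add_ne_top.2 ⟨hu.l0.2.ne, ?_⟩, ?_⟩
  · exact ENNReal.sum_ne_top.2 fun i _ => (hu.l1 i).2.ne
  · exact ENNReal.sum_ne_top.2 fun i _ => ENNReal.sum_ne_top.2 fun j _ => (hu.l2 i j).2.ne

/-- sum of absolute values -/
def absM {m : ℕ} (M : Matrix (Fin m) (Fin m) ℝ) : ℝ := ∑ i, ∑ j, |M i j|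

lemma absM_nonneg {m : ℕ} (M : Matrix (Fin m) (Fin m) ℝ) : 0 ≤ absM M :=
  Finset.sum_nonneg fun _ _ => Finset.sum_nonneg fun _ _ => abs_nonneg _

lemma abs_dir_le {n : ℕ} {Ω : Set (EV (n+1))} {Λ : ℝ} {U Q s}
    (h : IsLChart Ω Λ U Q s) (x : EV (n+1)) (i : Fin (n+1)) : |fderiv ℝ s x (ee i)| ≤ Λ := by
  have := (fderiv ℝ s x).le_opNorm (ee i)
  have h2 : ‖ee i‖ = (1:ℝ) := by simp
  rw [h2, mul_one, Real.norm_eq_abs] at this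
  exact this.trans (h.bound x)

lemma meas_wt {n : ℕ} {Ω : Set (EV (n+1))} {Λ : ℝ} {U Q s}
    (h : IsLChart Ω Λ U Q s) (M : Matrix (Fin (n+1)) (Fin (n+1)) ℝ) {U1 : Fin (n+1) → EV (n+1) → ℝ}
    (hm : ∀ i, Measurable (U1 i)) : Measurable (wt M s U1) := by
  have hσ : ∀ i, Measurable fun x => fderiv ℝ s x (ee i) :=
    fun i => (h.contDiff_dir _).continuous.measurable
  unfold wt
  exact Finset.measurable_sum _ fun i _ => Finset.measurable_sum _ fun j _ =>
    ((hσ i).mul (hm j)).const_mul _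

lemma meas_gt {n : ℕ} {Ω : Set (EV (n+1))} {Λ : ℝ} {U Q s}
    (h : IsLChart Ω Λ U Q s) (M : Matrix (Fin (n+1)) (Fin (n+1)) ℝ) (e : EV (n+1))
    {U2 : Fin (n+1) → Fin (n+1) → EV (n+1) → ℝ}
    (hm : ∀ i j, Measurable (U2 i j)) : Measurable (gt M s e U2) := by
  have hσ : ∀ i, Measurable fun x => fderiv ℝ s x (ee i) :=
    fun i => (h.contDiff_dir _).continuous.measurable
  unfold gt
  exact Finset.measurable_sum _ fun i _ => Finset.measurable_sum _ fun j _ =>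
    ((hσ i).mul (Finset.measurable_sum _ fun l _ => (hm l j).const_mul _)).const_mul _

lemma norm_wt {n : ℕ} {Ω : Set (EV (n+1))} {Λ : ℝ} {U Q s}
    (h : IsLChart Ω Λ U Q s) {M : Matrix (Fin (n+1)) (Fin (n+1)) ℝ} {p : ℝ≥0∞} (hp1 : 1 ≤ p)
    (hp : p ≠ ⊤) {U0 U1 U2} (hu : SobData Ω M p U0 U1 U2) :
    eLpNorm (wt M s U1) p volume ≤ ENNReal.ofReal (absM M * Λ) * SobW p U0 U1 U2 := by
  have hΛ : 0 ≤ Λ := zero_le_one.trans h.one_le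
  have := eLpNorm_sum_bound volume hp1 hp (Finset.univ : Finset (Fin (n+1) × Fin (n+1)))
    (fun q => |M q.1 q.2| * Λ) (fun q => U1 q.2) (fun q _ => hu.m1 q.2) (wt M s U1)
    (fun q _ => by positivity) (fun x => ?_) (fun q _ => SobW_1 p U0 U1 U2 q.2)
  · rwa [← Finset.sum_mul, Fintype.sum_prod_type] at this
  · unfold wt
    rw [Fintype.sum_prod_type]
    refine (Finset.abs_sum_le_sum_abs _ _).trans (Finset.sum_le_sum fun i _ => ?_)
    refine (Finset.abs_sum_le_sum_abs _ _).trans (Finset.sum_le_sum fun j _ => ?_)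
    rw [abs_mul, abs_mul, ← mul_assoc]
    gcongr
    exact abs_dir_le h x i

lemma norm_gt {n : ℕ} {Ω : Set (EV (n+1))} {Λ : ℝ} {U Q s}
    (h : IsLChart Ω Λ U Q s) {M : Matrix (Fin (n+1)) (Fin (n+1)) ℝ} {p : ℝ≥0∞} (hp1 : 1 ≤ p)
    (hp : p ≠ ⊤) {U0 U1 U2} (hu : SobData Ω M p U0 U1 U2) :
    eLpNorm (gt M s (lastDir Q) U2) p volume ≤
      ENNReal.ofReal (absM M * Λ * (n+1)) * SobW p U0 U1 U2 := by
  have hΛ : 0 ≤ Λ := zero_le_one.trans h.one_le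
  have := eLpNorm_sum_bound volume hp1 hp
    (Finset.univ : Finset (Fin (n+1) × Fin (n+1) × Fin (n+1)))
    (fun q => |M q.1 q.2.1| * Λ) (fun q => U2 q.2.2 q.2.1) (fun q _ => hu.m2 q.2.2 q.2.1)
    (gt M s (lastDir Q) U2)
    (fun q _ => by positivity) (fun x => ?_) (fun q _ => SobW_2 p U0 U1 U2 q.2.2 q.2.1)
  · rw [← Finset.sum_mul, Fintype.sum_prod_type] at this
    simp only [Fintype.sum_prod_type, Finset.sum_const, Finset.card_univ, Fintype.card_fin,
      nsmul_eq_mul] at this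
    simp only [← Finset.mul_sum] at this
    refine this.trans (le_of_eq ?_)
    congr 2
    unfold absM; push_cast; ring
  · unfold gt
    simp only [Fintype.sum_prod_type]
    refine (Finset.abs_sum_le_sum_abs _ _).trans (Finset.sum_le_sum fun i _ => ?_)
    refine (Finset.abs_sum_le_sum_abs _ _).trans (Finset.sum_le_sum fun j _ => ?_)
    rw [abs_mul, abs_mul, ← mul_assoc, ← Finset.mul_sum]
    gcongr
    · exact abs_dir_le h x i
    · refine (Finset.abs_sum_le_sum_abs _ _).trans (Finset.sum_le_sum fun l _ => ?_)
      rw [abs_mul]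
      refine mul_le_of_le_one_left (abs_nonneg _) ?_
      exact (abs_coord_le _ l).trans (norm_lastDir h.orth).le

lemma hardy_bound {n : ℕ} {Ω : Set (EV (n+1))} (hΩ : IsOpen Ω) {Λ : ℝ} {U Q s}
    (h : IsLChart Ω Λ U Q s) {M : Matrix (Fin (n+1)) (Fin (n+1)) ℝ} {p : ℝ≥0∞} (hp1 : 1 ≤ p)
    (hp : p ≠ ⊤) {U0 U1 U2} (hu : SobData Ω M p U0 U1 U2) {K : EV (n+1) → ℝ} {m0 : ℝ}
    (hK : KerOK K m0) {V : Set (EV (n+1))} (hV : MeasurableSet V) {δ1 δ2 : ℝ} (hδ2 : 0 < δ2)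
    (hδ : δ2 < δ1) (hVU : ∀ x ∈ V, Metric.ball x δ1 ⊆ U) :
    eLpNorm (fun x => Gk K (s x / Λ) * ‖wt M s U1 x‖ₑ) p (volume.restrict (V ∩ Ω)) ≤
      2 * (ENNReal.ofReal (Λ * m0) * eLpNorm (gt M s (lastDir Q) U2) p volume +
        ENNReal.ofReal (Λ * m0 / δ2) * eLpNorm (wt M s U1) p volume) := by
  have hΛ : 0 < Λ := zero_lt_one.trans_le h.one_le
  have hm0 := hK.m0pos
  have hsm : Measurable s := h.smooth.continuous.measurable
  have hwm := meas_wt h M hu.m1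
  have hgm := meas_gt h M (lastDir Q) hu.m2
  set e := lastDir Q with he
  have hen : ‖e‖ = 1 := norm_lastDir h.orth
  have hWt := SobW_ne_top hu
  have hwL : MemLp (wt M s U1) p volume := ⟨hwm.aestronglyMeasurable,
    (norm_wt h hp1 hp hu).trans_lt (ENNReal.mul_lt_top ENNReal.ofReal_lt_top hWt.lt_top)⟩
  have hgL : MemLp (gt M s e U2) p volume := ⟨hgm.aestronglyMeasurable,
    (norm_gt h hp1 hp hu).trans_lt (ENNReal.mul_lt_top ENNReal.ofReal_lt_top hWt.lt_top)⟩
  have hwz : ∀ x, x ∉ Ω → wt M s U1 x = 0 := fun x hx => by simp [wt, hu.z1 _ x hx]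
  have hgz : ∀ x, x ∉ Ω → gt M s e U2 x = 0 := fun x hx => by simp [gt, hu.z2 _ _ x hx]
  have hsub : ∀ x t, s (x - t • e) = s x - t := fun x t => by
    have := h.shift x (-t)
    rw [neg_smul, ← sub_eq_add_neg] at this
    rw [this]; ring
  have hHr : ∀ r : ℝ, 0 < r → ENNReal.ofReal r * Gk K (r / Λ) ≤ ENNReal.ofReal (Λ * m0) := by
    intro r hr
    have := Gk_mul_le hK (div_pos hr hΛ)
    rw [ENNReal.ofReal_mul hΛ.le]
    calc ENNReal.ofReal r * Gk K (r / Λ)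
        = ENNReal.ofReal Λ * (ENNReal.ofReal (r / Λ) * Gk K (r / Λ)) := by
          rw [← mul_assoc, ← ENNReal.ofReal_mul hΛ.le]; congr 2; field_simp
      _ ≤ _ := by gcongr
  set S : Bool → Set (EV (n+1)) := fun b => bif b then (V ∩ Ω) ∩ {x | s x < δ2} else
    (V ∩ Ω) ∩ {x | δ2 ≤ s x} with hSdef
  have hcov : V ∩ Ω ⊆ ⋃ b ∈ (Finset.univ : Finset Bool), S b := by
    intro x hx
    simp only [Finset.mem_univ, Set.iUnion_true, Set.mem_iUnion]
    rcases lt_or_ge (s x) δ2 with h1 | h1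
    · exact ⟨true, hx, h1⟩
    · exact ⟨false, hx, h1⟩
  refine (eLpNorm_union_e volume hp1 hp Finset.univ S _ hcov _
    (ENNReal.ofReal (Λ * m0) * eLpNorm (gt M s (lastDir Q) U2) p volume +
        ENNReal.ofReal (Λ * m0 / δ2) * eLpNorm (wt M s U1) p volume) ?_).trans (by simp [he])
  have hVΩ := hV.inter hΩ.measurableSet
  rintro (_ | _) -
  · refine le_trans ?_ le_add_self
    refine le_trans ?_ (mul_le_mul_right (eLpNorm_mono_measure _
      (Measure.restrict_le_self (s := S false))) _)
    have hSm : MeasurableSet (S false) := hVΩ.inter (measurableSet_le measurable_const hsm)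
    rw [← eLpNorm_enorm_e (f := wt M s U1)]
    refine le_trans ?_ (eLpNorm_cmul_le _ hp1 hp _ _ ENNReal.ofReal_ne_top)
    refine eLpNorm_mono_e _ ((ae_restrict_iff' hSm).2 (ae_of_all _ fun x hx => ?_))
    have hx2 : δ2 ≤ s x := hx.2
    gcongr
    refine (Gk_anti K (div_le_div_of_nonneg_right hx2 hΛ.le)).trans ?_
    rw [ENNReal.ofReal_div_of_pos hδ2, ENNReal.le_div_iff_mul_le (by simp [hδ2]) (by simp),
      mul_comm]
    exact hHr δ2 hδ2
  · refine le_trans ?_ le_self_add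
    have hSm : MeasurableSet (S true) := hVΩ.inter (measurableSet_lt hsm measurable_const)
    rw [← eLpNorm_enorm_e (f := gt M s (lastDir Q) U2)]
    refine hardy hp1 hp e hsm (S true) (H := fun r => Gk K (r / Λ)) hgm.enorm hSm ?_
      (fun a b hab => Gk_anti K (div_le_div_of_nonneg_right hab hΛ.le)) ENNReal.ofReal_ne_top hHr
      (Gk_int hK hΛ)
    have ftc := seg_ftc h.isOpen hp1 hp hwm (hgm.const_mul (-δ2)) hwL (hgL.const_mul (-δ2))
      ((-δ2) • e) (wd_smul (wd_wt hΩ h hp1 hu) (-δ2))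
    filter_upwards [ftc] with x hx hxS
    obtain ⟨⟨hxV, hxΩ⟩, hxs⟩ := hxS
    have hxs : s x < δ2 := hxs
    have hball : ∀ t : ℝ, 0 ≤ t → t ≤ δ2 → x - t • e ∈ U := fun t ht ht2 => by
      refine hVU x hxV ?_
      rw [Metric.mem_ball, dist_eq_norm, sub_sub_cancel_left, norm_neg, norm_smul, hen, mul_one,
        Real.norm_of_nonneg ht]
      linarith
    have h0 : 0 < s x := (h.mem_iff x (by simpa using hball 0 le_rfl hδ2.le)).1 hxΩ
    refine ⟨h0, ?_⟩
    have hpt : ∀ t : ℝ, x + t • ((-δ2) • e) = x - (δ2 * t) • e := fun t => by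
      rw [smul_smul, sub_eq_add_neg, ← neg_smul]; congr 2; ring
    have hx := hx (fun t ht => by
      rw [hpt]
      exact hball _ (mul_nonneg hδ2.le ht.1) (mul_le_of_le_one_right hδ2.le ht.2))
    have hz : wt M s U1 (x + (-δ2) • e) = 0 := by
      refine hwz _ fun hmem => ?_
      rw [neg_smul, ← sub_eq_add_neg] at hmem
      have := (h.mem_iff _ (hball δ2 hδ2.le le_rfl)).1 hmem
      rw [hsub] at this; linarith
    rw [hz, zero_sub] at hx
    set G : ℝ → ℝ≥0∞ := (Set.Ioo 0 (s x)).indicator fun t => ‖gt M s e U2 (x - t • e)‖ₑ with hG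
    have hGm : Measurable G := by
      refine Measurable.indicator ?_ measurableSet_Ioo
      fun_prop
    calc ‖wt M s U1 x‖ₑ = ‖-wt M s U1 x‖ₑ := (enorm_neg _).symm
      _ ≤ ∫⁻ t in Set.Ioc (0:ℝ) 1, ‖-δ2 * gt M s e U2 (x + t • ((-δ2) • e))‖ₑ := by
          rw [hx]; exact enorm_integral_le_lintegral_enorm _
      _ ≤ ∫⁻ t in Set.Ioc (0:ℝ) 1, ENNReal.ofReal δ2 * G (δ2 * t) := by
          refine setLIntegral_mono (by fun_prop) fun t ht => ?_
          rw [hpt, enorm_mul, enorm_neg, Real.enorm_of_nonneg hδ2.le]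
          gcongr
          by_cases hts : δ2 * t < s x
          · rw [hG, Set.indicator_of_mem (show δ2 * t ∈ Set.Ioo 0 (s x) from
              ⟨mul_pos hδ2 ht.1, hts⟩)]
          · rw [hgz, enorm_zero]; exact zero_le
            intro hmem
            have := (h.mem_iff _ (hball (δ2 * t) (mul_pos hδ2 ht.1).le
              (mul_le_of_le_one_right hδ2.le ht.2))).1 hmem
            rw [hsub] at this; linarith
      _ ≤ ∫⁻ t, ENNReal.ofReal δ2 * G (δ2 * t) := setLIntegral_le_lintegral _ _
      _ = ∫⁻ t, G t := by
          rw [lintegral_const_mul _ (by fun_prop)]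
          conv_rhs => rw [← Real.smul_map_volume_mul_left hδ2.ne']
          rw [lintegral_smul_measure, lintegral_map hGm (by fun_prop), abs_of_pos hδ2, smul_eq_mul]
      _ = _ := by rw [hG, lintegral_indicator measurableSet_Ioo]

lemma drift_bound {n : ℕ} {A : Matrix (Fin (n + 1)) (Fin (n + 1)) ℝ} (hA : A.PosDef)
    {lam : ℝ} (hlam : 0 < lam) (hlow : ∀ ν : EV (n+1), lam * ‖ν‖ ≤ ‖mulVecE (A * A) ν‖)
    {Ω : Set (EV (n+1))} (hΩ : IsOpen Ω) {Λ : ℝ} {U Q s}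
    (h : IsLChart Ω Λ U Q s) {p : ℝ≥0∞} (hp1 : 1 ≤ p)
    (hp : p ≠ ⊤) {U0 U1 U2} (hu : SobData Ω (A * A) p U0 U1 U2) {K : EV (n+1) → ℝ} {m0 κ : ℝ}
    (hK : KerOK K m0) (hs : SliceOK A K) (hκ : 0 ≤ κ) (hcv : CurvOK K κ)
    {V : Set (EV (n+1))} (hV : MeasurableSet V) {δ0 δ1 δ2 : ℝ} (hδ0 : 0 < δ0) (hδ01 : δ0 ≤ δ1)
    (hδ2 : 0 < δ2) (hδ : δ2 < δ1) (hVU : ∀ x ∈ V, Metric.ball x δ1 ⊆ U) :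
    eLpNorm (fun x => ∑ i, U1 i x * bfun Ω K δ0 x i) p (volume.restrict (V ∩ Ω)) ≤
      ENNReal.ofReal ((n+1) * (2 * Λ * κ + m0 / δ0) + lam⁻¹ * (2 * (Λ * m0 *
        (absM (A * A) * Λ * (n+1)) + Λ * m0 / δ2 * (absM (A * A) * Λ)))) * SobW p U0 U1 U2 := by
  have hΛ : 0 < Λ := zero_lt_one.trans_le h.one_le
  have hm0 := hK.m0pos
  have hsm : Measurable s := h.smooth.continuous.measurable
  have hwm := meas_wt h (A * A) hu.m1
  have hVΩ := hV.inter hΩ.measurableSet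
  have hHm : Measurable fun x => Gk K (s x / Λ) := (Gk_anti K).measurable.comp (hsm.div_const Λ)
  set C1 := 2 * Λ * κ + m0 / δ0 with hC1
  have hC10 : 0 ≤ C1 := by positivity
  have hab := absM_nonneg (A * A)
  have hsymm : ∀ i j, (A * A) i j = (A * A) j i := fun i j => by
    have h1 : A.IsHermitian := hA.1
    have h2 : (A * A).IsHermitian := by
      unfold Matrix.IsHermitian; rw [Matrix.conjTranspose_mul, h1.eq]
    have := h2.apply i j
    simpa using this.symm
  have hwt : ∀ x, ∑ i, U1 i x * mulVecE (A * A) (gradV s x) i = wt (A * A) s U1 x := fun x => by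
    unfold wt
    rw [Finset.sum_comm]
    refine Finset.sum_congr rfl fun j _ => ?_
    rw [mulVecE_apply, Finset.mul_sum]
    refine Finset.sum_congr rfl fun i _ => ?_
    rw [hsymm i j]
    change U1 j x * ((A * A) j i * fderiv ℝ s x (ee i)) = _
    ring
  have pt : ∀ x ∈ V ∩ Ω, ‖∑ i, U1 i x * bfun Ω K δ0 x i‖ₑ ≤
      (∑ i, ENNReal.ofReal C1 * ‖U1 i x‖ₑ) +
        ENNReal.ofReal lam⁻¹ * (Gk K (s x / Λ) * ‖wt (A * A) s U1 x‖ₑ) := by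
    rintro x ⟨hxV, hxΩ⟩
    obtain ⟨β, hβ1, hβ2⟩ := b_est hA hlam hlow hK hs hκ hcv hΩ h hδ0 hδ01 hxΩ (hVU x hxV)
    have e1 : ∑ i, U1 i x * bfun Ω K δ0 x i = (∑ i, U1 i x * (bfun Ω K δ0 x i -
        β * mulVecE (A * A) (gradV s x) i)) + β * wt (A * A) s U1 x := by
      rw [← hwt, Finset.mul_sum, ← Finset.sum_add_distrib]
      exact Finset.sum_congr rfl fun i _ => by ring
    rw [e1]
    refine (enorm_add_le _ _).trans (add_le_add ?_ ?_)
    · refine (enorm_sum_le _ _).trans (Finset.sum_le_sum fun i _ => ?_)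
      rw [enorm_mul, mul_comm]
      gcongr
      rw [Real.enorm_eq_ofReal_abs]
      exact ENNReal.ofReal_le_ofReal (hβ1 i)
    · rw [enorm_mul, ← mul_assoc]
      gcongr
      calc ‖β‖ₑ = ENNReal.ofReal lam⁻¹ * ENNReal.ofReal (|β| * lam) := by
            rw [Real.enorm_eq_ofReal_abs, ← ENNReal.ofReal_mul (by positivity)]
            congr 1; field_simp
        _ ≤ _ := by gcongr
  clear_value C1
  rw [← eLpNorm_enorm_e]
  refine (eLpNorm_mono_e _ ((ae_restrict_iff' hVΩ).2 (ae_of_all _ pt))).trans ?_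
  refine (eLpNorm_add_e _ hp1 (Finset.measurable_sum _ fun i _ => (hu.m1 i).enorm.const_mul _)
    ((hHm.mul hwm.enorm).const_mul _)).trans ?_
  rw [ENNReal.ofReal_add (by positivity) (by positivity), add_mul (ENNReal.ofReal _)]
  refine add_le_add ?_ ?_
  · refine (eLpNorm_sum_e _ hp1 _ fun i _ => (hu.m1 i).enorm.const_mul _).trans ?_
    calc ∑ i, eLpNorm (fun x => ENNReal.ofReal C1 * ‖U1 i x‖ₑ) p (volume.restrict (V ∩ Ω))
        ≤ ∑ i : Fin (n+1), ENNReal.ofReal C1 * SobW p U0 U1 U2 := by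
          refine Finset.sum_le_sum fun i _ => ?_
          refine (eLpNorm_cmul_le _ hp1 hp _ _ ENNReal.ofReal_ne_top).trans ?_
          rw [eLpNorm_enorm_e]
          gcongr
          exact (eLpNorm_mono_measure _ Measure.restrict_le_self).trans (SobW_1 p U0 U1 U2 i)
      _ = _ := by
          rw [Finset.sum_const, ENNReal.ofReal_mul (by positivity), Finset.card_univ,
            Fintype.card_fin, nsmul_eq_mul, mul_assoc]
          congr 1
          have : ((n:ℝ) + 1) = ((n + 1 : ℕ) : ℝ) := by push_cast; ring
          rw [this, ENNReal.ofReal_natCast]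
  · refine (eLpNorm_cmul_le _ hp1 hp _ _ ENNReal.ofReal_ne_top).trans ?_
    rw [ENNReal.ofReal_mul (by positivity), mul_assoc]
    gcongr
    refine (hardy_bound hΩ h hp1 hp hu hK hV hδ2 hδ hVU).trans ?_
    have hg := norm_gt h hp1 hp hu
    have hw := norm_wt h hp1 hp hu
    set a1 := Λ * m0 with ha1
    set a2 := Λ * m0 / δ2 with ha2
    set b1 := absM (A * A) * Λ * (n+1) with hb1
    set b2 := absM (A * A) * Λ with hb2
    have h1 : 0 ≤ a1 := by positivity
    have h2 : 0 ≤ a2 := by positivity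
    have h3 : 0 ≤ b1 := by positivity
    have h4 : 0 ≤ b2 := by positivity
    clear_value a1 a2 b1 b2
    calc _ ≤ 2 * (ENNReal.ofReal a1 * (ENNReal.ofReal b1 * SobW p U0 U1 U2) +
          ENNReal.ofReal a2 * (ENNReal.ofReal b2 * SobW p U0 U1 U2)) := by gcongr
      _ = _ := by
        rw [ENNReal.ofReal_mul (by norm_num : (0:ℝ) ≤ 2), ENNReal.ofReal_add (by positivity)
          (by positivity), ENNReal.ofReal_mul h1, ENNReal.ofReal_mul h2]
        have : ENNReal.ofReal 2 = 2 := by simp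
        rw [this]; ring

lemma sum_abs_coord_le {m : ℕ} (a : EV m) : ∑ l, |a l| ≤ m * ‖a‖ := by
  calc ∑ l, |a l| ≤ ∑ _l : Fin m, ‖a‖ := Finset.sum_le_sum fun l _ => abs_coord_le a l
    _ = _ := by simp

lemma ae_shift {m : ℕ} {P : EV m → Prop} (h : ∀ᵐ x, P x) (y : EV m) : ∀ᵐ x, P (x + y) :=
  (measurePreserving_add_right volume y).quasiMeasurePreserving.ae h

lemma eLpNorm_shift {m : ℕ} {f : EV m → ℝ} (hf : Measurable f) (p : ℝ≥0∞) (y : EV m) :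
    eLpNorm (fun x => f (x + y)) p volume = eLpNorm f p volume :=
  eLpNorm_comp_measurePreserving hf.aestronglyMeasurable (measurePreserving_add_right volume y)

lemma enorm_integral_sub_const_le {β : Type*} [MeasurableSpace β] (ν : Measure β)
    [IsProbabilityMeasure ν] {F : β → ℝ} (hF : Measurable F) (c : ℝ) :
    ‖(∫ t, F t ∂ν) - c‖ₑ ≤ ∫⁻ t, ‖F t - c‖ₑ ∂ν := by
  by_cases h : ∫⁻ t, ‖F t - c‖ₑ ∂ν = ⊤
  · rw [h]; exact le_top
  · have hi : Integrable (fun t => F t - c) ν :=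
      ⟨(hF.sub_const c).aestronglyMeasurable, lt_top_iff_ne_top.2 h⟩
    have hi2 : Integrable F ν := by
      have := hi.add (integrable_const c)
      refine this.congr (ae_of_all _ fun t => ?_)
      simp
    have : (∫ t, F t ∂ν) - c = ∫ t, (F t - c) ∂ν := by
      rw [integral_sub hi2 (integrable_const c)]; simp
    rw [this]
    exact enorm_integral_le_lintegral_enorm _

lemma diff_bound {m : ℕ} {Ω : Set (EV m)} (hΩ : IsOpen Ω) {p : ℝ≥0∞} (hp1 : 1 ≤ p) (hp : p ≠ ⊤)
    {f : EV m → ℝ} {g : Fin m → EV m → ℝ} (hfm : Measurable f) (hgm : ∀ k, Measurable (g k))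
    (hf : MemLp f p volume) (hg : ∀ k, MemLp (g k) p volume) (hw : ∀ k, WD Ω (ee k) f (g k))
    {W : ℝ≥0∞} (hW : ∀ k, eLpNorm (g k) p volume ≤ W) {S : Set (EV m)} (hS : MeasurableSet S)
    (y b : EV m) (hseg : ∀ x ∈ S, ∀ t ∈ Set.Icc (0:ℝ) 1, x + y + t • b ∈ Ω) :
    eLpNorm (fun x => f (x + y + b) - f (x + y)) p (volume.restrict S) ≤
      ENNReal.ofReal (m * ‖b‖) * W := by
  set G : EV m → ℝ := fun x => ∑ k, b k * g k x with hG
  have hGm : Measurable G := Finset.measurable_sum _ fun k _ => (hgm k).const_mul _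
  have hGL : MemLp G p volume := memLp_finsetSum _ fun k _ => (hg k).const_mul _
  have hGW : eLpNorm G p volume ≤ ENNReal.ofReal (m * ‖b‖) * W := by
    refine (eLpNorm_sum_bound volume hp1 hp Finset.univ (fun k => |b k|) g (fun k _ => hgm k) G
      (fun k _ => abs_nonneg _) (fun x => ?_) (fun k _ => hW k)).trans ?_
    · refine (Finset.abs_sum_le_sum_abs _ _).trans (le_of_eq ?_)
      exact Finset.sum_congr rfl fun k _ => abs_mul _ _
    · gcongr; exact sum_abs_coord_le b
  have ftc := ae_shift (seg_ftc hΩ hp1 hp hfm hGm hf hGL b (wd_dir (hf.locallyIntegrable hp1)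
    (fun k => (hg k).locallyIntegrable hp1) hw b)) y
  set ν : Measure ℝ := volume.restrict (Set.Ioc (0:ℝ) 1) with hν
  haveI : IsFiniteMeasure ν := ⟨by simp [hν]⟩
  have hν1 : ν Set.univ = 1 := by simp [hν]
  have h1 : eLpNorm (fun x => ∫⁻ t, ‖G (x + y + t • b)‖ₑ ∂ν) p (volume.restrict S) ≤
      ν Set.univ * (ENNReal.ofReal (m * ‖b‖) * W) := by
    refine minkM _ ν hp1 hp (fun x t => ‖G (x + y + t • b)‖ₑ) ?_ _ (ae_of_all _ fun t => ?_)
    · simp only [Function.uncurry_def]; fun_prop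
    · rw [eLpNorm_enorm_e (f := fun x => G (x + y + t • b))]
      refine (eLpNorm_mono_measure _ Measure.restrict_le_self).trans ?_
      have := eLpNorm_shift hGm p (y + t • b)
      simp only [← add_assoc] at this
      rw [this]; exact hGW
  rw [hν1, one_mul] at h1
  refine le_trans ?_ h1
  rw [← eLpNorm_enorm_e]
  refine eLpNorm_mono_e _ ((ae_restrict_iff' hS).2 ?_)
  filter_upwards [ftc] with x hx hxS
  rw [hx (hseg x hxS)]
  exact enorm_integral_le_lintegral_enorm _

lemma leg_bound {m : ℕ} {Ω : Set (EV m)} (hΩ : IsOpen Ω) {p : ℝ≥0∞} (hp1 : 1 ≤ p) (hp : p ≠ ⊤)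
    {f : EV m → ℝ} {g : Fin m → EV m → ℝ} (hfm : Measurable f) (hgm : ∀ k, Measurable (g k))
    (hf : MemLp f p volume) (hg : ∀ k, MemLp (g k) p volume) (hw : ∀ k, WD Ω (ee k) f (g k))
    {W : ℝ≥0∞} {D : ℝ} (hD : 0 ≤ D) {S : Set (EV m)} (hS : MeasurableSet S) (y a : EV m)
    (hseg : ∀ x ∈ S, ∀ t ∈ Set.Icc (0:ℝ) 1, x + y + t • a ∈ Ω)
    (hW : ∀ k, ∀ t ∈ Set.Icc (0:ℝ) 1, eLpNorm (fun x => g k (x + y + t • a) - g k x) p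
      (volume.restrict S) ≤ ENNReal.ofReal D * W) :
    eLpNorm (fun x => f (x + y + a) - f (x + y) - ∑ k, a k * g k x) p (volume.restrict S) ≤
      ENNReal.ofReal (m * ‖a‖ * D) * W := by
  set G : EV m → ℝ := fun x => ∑ k, a k * g k x with hG
  have hGm : Measurable G := Finset.measurable_sum _ fun k _ => (hgm k).const_mul _
  have hGL : MemLp G p volume := memLp_finsetSum _ fun k _ => (hg k).const_mul _
  have ftc := ae_shift (seg_ftc hΩ hp1 hp hfm hGm hf hGL a (wd_dir (hf.locallyIntegrable hp1)
    (fun k => (hg k).locallyIntegrable hp1) hw a)) y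
  set ν : Measure ℝ := volume.restrict (Set.Ioc (0:ℝ) 1) with hν
  have hν1 : ν Set.univ = 1 := by simp [hν]
  haveI : IsProbabilityMeasure ν := ⟨hν1⟩
  have h1 : eLpNorm (fun x => ∫⁻ t, ‖G (x + y + t • a) - G x‖ₑ ∂ν) p (volume.restrict S) ≤
      ν Set.univ * (ENNReal.ofReal (m * ‖a‖ * D) * W) := by
    refine minkM _ ν hp1 hp (fun x t => ‖G (x + y + t • a) - G x‖ₑ) ?_ _
      ((ae_restrict_iff' measurableSet_Ioc).2 (ae_of_all _ fun t ht => ?_))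
    · simp only [Function.uncurry_def]; fun_prop
    · rw [eLpNorm_enorm_e (f := fun x => G (x + y + t • a) - G x)]
      refine (eLpNorm_sum_bound _ hp1 hp Finset.univ (fun k => |a k|)
        (fun k x => g k (x + y + t • a) - g k x) (fun k _ => by have := hgm k; fun_prop) _
        (fun k _ => abs_nonneg _) (fun x => ?_) (fun k _ => hW k t ⟨ht.1.le, ht.2⟩)).trans ?_
      · rw [hG]
        simp only
        rw [← Finset.sum_sub_distrib]
        refine (Finset.abs_sum_le_sum_abs _ _).trans (le_of_eq ?_)
        exact Finset.sum_congr rfl fun k _ => by rw [← mul_sub, abs_mul]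
      · rw [← mul_assoc, ← ENNReal.ofReal_mul (Finset.sum_nonneg fun _ _ => abs_nonneg _)]
        gcongr; exact sum_abs_coord_le a
  rw [hν1, one_mul] at h1
  refine le_trans ?_ h1
  rw [← eLpNorm_enorm_e]
  refine eLpNorm_mono_e _ ((ae_restrict_iff' hS).2 ?_)
  filter_upwards [ftc] with x hx hxS
  rw [hx (hseg x hxS)]
  exact enorm_integral_sub_const_le ν (F := fun t => G (x + y + t • a)) (by fun_prop) (G x)

/-- three-leg paths stay in the domain -/
structure PathOK {m : ℕ} (Ω V : Set (EV m)) (e : EV m) (Λ δ0 : ℝ) : Prop where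
  enorm : ‖e‖ ≤ 1
  one_le : 1 ≤ Λ
  path : ∀ x ∈ V ∩ Ω, ∀ z : EV m, ‖z‖ < δ0 → x - z ∈ Ω → ∀ t ∈ Set.Icc (0:ℝ) 1,
    x + t • ((Λ * ‖z‖) • e) ∈ Ω ∧ x + (Λ * ‖z‖) • e + t • (-z) ∈ Ω ∧
      x + -z + t • ((Λ * ‖z‖) • e) ∈ Ω

lemma R_bound {m : ℕ} {Ω : Set (EV m)} (hΩ : IsOpen Ω) {M : Matrix (Fin m) (Fin m) ℝ}
    {p : ℝ≥0∞} (hp1 : 1 ≤ p) (hp : p ≠ ⊤) {U0 U1 U2} (hu : SobData Ω M p U0 U1 U2)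
    {V : Set (EV m)} (hV : MeasurableSet V) {e : EV m} {Λ δ0 : ℝ} (h : PathOK Ω V e Λ δ0)
    {z : EV m} (hz : ‖z‖ < δ0) :
    eLpNorm (fun x => U0 x - U0 (x - z) - ∑ k, z k * U1 k x) p
      (volume.restrict {x | x ∈ V ∩ Ω ∧ x - z ∈ Ω}) ≤
      ENNReal.ofReal (9 * m ^ 2 * Λ ^ 2 * ‖z‖ ^ 2) * SobW p U0 U1 U2 := by
  set S := {x | x ∈ V ∩ Ω ∧ x - z ∈ Ω} with hSdef
  have hS : MeasurableSet S := (hV.inter hΩ.measurableSet).inter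
    (hΩ.measurableSet.preimage (measurable_id.sub_const z))
  set W := SobW p U0 U1 U2 with hWdef
  have hΛ := h.one_le
  have hm0 := hu.m0
  have hm1 := hu.m1
  set a : EV m := (Λ * ‖z‖) • e with ha
  have han : ‖a‖ ≤ Λ * ‖z‖ := by
    rw [ha, norm_smul, Real.norm_of_nonneg (by positivity)]
    exact mul_le_of_le_one_right (by positivity) h.enorm
  have hz1 : ‖z‖ ≤ Λ * ‖z‖ := le_mul_of_one_le_left (norm_nonneg _) hΛ
  set DQ : EV m → ℝ → Prop := fun y c => ∀ j, eLpNorm (fun x => U1 j (x + y) - U1 j x) p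
    (volume.restrict S) ≤ ENNReal.ofReal c * W with hDQ
  have dq0 : DQ 0 0 := fun j => by simp
  have mono : ∀ y c c', c ≤ c' → DQ y c → DQ y c' := fun y c c' hc hd j =>
    (hd j).trans (by gcongr)
  have step : ∀ y b c, 0 ≤ c → (∀ x ∈ S, ∀ t ∈ Set.Icc (0:ℝ) 1, x + y + t • b ∈ Ω) →
      DQ y c → DQ (y + b) (c + m * ‖b‖) := by
    intro y b c hc hseg hd j
    have hb := diff_bound hΩ hp1 hp (hu.m1 j) (fun k => hu.m2 k j) (hu.l1 j) (fun k => hu.l2 k j)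
      (fun k => hu.wd1 k j) (fun k => SobW_2 p U0 U1 U2 k j) hS y b hseg
    have hj := hm1 j
    calc eLpNorm (fun x => U1 j (x + (y + b)) - U1 j x) p (volume.restrict S)
        = eLpNorm ((fun x => U1 j (x + y) - U1 j x) +
            fun x => U1 j (x + y + b) - U1 j (x + y)) p (volume.restrict S) := by
          congr 1; funext x; simp [add_assoc]
      _ ≤ _ := eLpNorm_add_le (Measurable.aestronglyMeasurable (by fun_prop))
          (Measurable.aestronglyMeasurable (by fun_prop)) hp1
      _ ≤ ENNReal.ofReal c * W + ENNReal.ofReal (m * ‖b‖) * W := add_le_add (hd j) hb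
      _ = _ := by rw [← add_mul, ← ENNReal.ofReal_add hc (by positivity)]
  have P : ∀ x ∈ S, ∀ t ∈ Set.Icc (0:ℝ) 1, x + t • a ∈ Ω ∧ x + a + t • (-z) ∈ Ω ∧
      x + -z + t • a ∈ Ω := fun x hx => h.path x hx.1 z hz hx.2
  set D := 3 * m * (Λ * ‖z‖) with hD
  have hD0 : 0 ≤ D := by positivity
  have hma : (m:ℝ) * ‖a‖ ≤ m * (Λ * ‖z‖) := by gcongr
  have hmz : (m:ℝ) * ‖z‖ ≤ m * (Λ * ‖z‖) := by gcongr
  have hpos : 0 ≤ (m:ℝ) * (Λ * ‖z‖) := by positivity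
  have hna : 0 ≤ (m:ℝ) * ‖a‖ := by positivity
  have hnz : 0 ≤ (m:ℝ) * ‖z‖ := by positivity
  have ts : ∀ (t : ℝ) (b : EV m), t ∈ Set.Icc (0:ℝ) 1 → (m:ℝ) * ‖t • b‖ ≤ m * ‖b‖ := by
    intro t b ht
    rw [norm_smul, Real.norm_of_nonneg ht.1]
    gcongr
    exact mul_le_of_le_one_left (norm_nonneg _) ht.2
  have unit_mul : ∀ τ t : ℝ, τ ∈ Set.Icc (0:ℝ) 1 → t ∈ Set.Icc (0:ℝ) 1 → τ * t ∈ Set.Icc (0:ℝ) 1 :=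
    fun τ t h1 h2 => ⟨mul_nonneg h1.1 h2.1, mul_le_one₀ h1.2 h2.1 h2.2⟩
  have q1 : ∀ t ∈ Set.Icc (0:ℝ) 1, DQ (0 + t • a) (0 + m * ‖t • a‖) := fun t ht =>
    step 0 (t • a) 0 le_rfl (fun x hx τ hτ => by
      rw [add_zero, smul_smul]; exact (P x hx _ (unit_mul τ t hτ ht)).1) dq0
  have q1a : DQ a (m * ‖a‖) := by
    have := q1 1 ⟨zero_le_one, le_rfl⟩
    simpa using this
  have q2 : ∀ t ∈ Set.Icc (0:ℝ) 1, DQ (a + t • (-z)) (m * ‖a‖ + m * ‖t • (-z)‖) := fun t ht =>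
    step a (t • (-z)) _ hna (fun x hx τ hτ => by
      rw [smul_smul]; exact (P x hx _ (unit_mul τ t hτ ht)).2.1) q1a
  have q2a : DQ (a + -z) (m * ‖a‖ + m * ‖z‖) := by
    have := q2 1 ⟨zero_le_one, le_rfl⟩
    simpa using this
  have q3 : ∀ t ∈ Set.Icc (0:ℝ) 1, DQ ((a + -z) + (1 - t) • (-a))
      (m * ‖a‖ + m * ‖z‖ + m * ‖(1 - t) • (-a)‖) := fun t ht =>
    step (a + -z) ((1 - t) • (-a)) _ (by positivity) (fun x hx τ hτ => by
      have h1 : τ * (1 - t) ∈ Set.Icc (0:ℝ) 1 :=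
        unit_mul τ (1 - t) hτ ⟨by linarith [ht.2], by linarith [ht.1]⟩
      have h2 : x + (a + -z) + τ • ((1 - t) • (-a)) = x + -z + (1 - τ * (1 - t)) • a := by
        rw [smul_smul, smul_neg, sub_smul, one_smul]; abel
      rw [h2]
      exact (P x hx _ ⟨by linarith [h1.2], by linarith [h1.1]⟩).2.2) q2a
  have Q1 : ∀ t ∈ Set.Icc (0:ℝ) 1, DQ (0 + t • a) D := fun t ht =>
    mono _ _ _ (by have := ts t a ht; rw [hD]; linarith) (q1 t ht)
  have Q2 : ∀ t ∈ Set.Icc (0:ℝ) 1, DQ (a + t • (-z)) D := fun t ht =>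
    mono _ _ _ (by have := ts t (-z) ht; rw [norm_neg] at this; rw [hD]; linarith) (q2 t ht)
  have Q3 : ∀ t ∈ Set.Icc (0:ℝ) 1, DQ (-z + t • a) D := fun t ht => by
    have h1 : (a + -z) + (1 - t) • (-a) = -z + t • a := by
      rw [smul_neg, sub_smul, one_smul]; abel
    have h2 := q3 t ht
    rw [h1] at h2
    exact mono _ _ _ (by
      have := ts (1 - t) (-a) ⟨by linarith [ht.2], by linarith [ht.1]⟩
      rw [norm_neg] at this; rw [hD]; linarith) h2
  have L1 := leg_bound hΩ hp1 hp hm0 hm1 hu.l0 hu.l1 hu.wd0 hD0 (W := W) hS 0 a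
    (fun x hx t ht => by rw [add_zero]; exact (P x hx t ht).1)
    (fun k t ht => by simpa only [add_assoc] using Q1 t ht k)
  have L2 := leg_bound hΩ hp1 hp hm0 hm1 hu.l0 hu.l1 hu.wd0 hD0 (W := W) hS a (-z)
    (fun x hx t ht => (P x hx t ht).2.1)
    (fun k t ht => by simpa only [add_assoc] using Q2 t ht k)
  have L3 := leg_bound hΩ hp1 hp hm0 hm1 hu.l0 hu.l1 hu.wd0 hD0 (W := W) hS (-z) a
    (fun x hx t ht => (P x hx t ht).2.2)
    (fun k t ht => by simpa only [add_assoc] using Q3 t ht k)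
  have bd : ∀ b : EV m, ‖b‖ ≤ Λ * ‖z‖ → ENNReal.ofReal (m * ‖b‖ * D) * W ≤
      ENNReal.ofReal (3 * m ^ 2 * Λ ^ 2 * ‖z‖ ^ 2) * W := fun b hb => by
    refine mul_le_mul' (ENNReal.ofReal_le_ofReal ?_) le_rfl
    calc m * ‖b‖ * D ≤ m * (Λ * ‖z‖) * D := by gcongr
      _ = _ := by rw [hD]; ring
  have e1 : (fun x => U0 x - U0 (x - z) - ∑ k, z k * U1 k x) =
      ((fun x => U0 (x + -z + a) - U0 (x + -z) - ∑ k, a k * U1 k x) -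
       (fun x => U0 (x + 0 + a) - U0 (x + 0) - ∑ k, a k * U1 k x)) -
       (fun x => U0 (x + a + -z) - U0 (x + a) - ∑ k, (-z) k * U1 k x) := by
    funext x
    have e3 : x + -z + a = x + a - z := by abel
    have e4 : x + a + -z = x + a - z := by abel
    have e5 : x + -z = x - z := by abel
    have e6 : x - z + a = x + a - z := by abel
    simp only [Pi.sub_apply, add_zero, e3, e4, e5, e6, PiLp.neg_apply, neg_mul,
      Finset.sum_neg_distrib]
    ring
  have ms : ∀ b : EV m, Measurable fun x => ∑ k, b k * U1 k x := fun b =>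
    Finset.measurable_sum _ fun k _ => (hm1 k).const_mul _
  have msz := ms (-z)
  have msa := ms a
  rw [e1]
  calc _ ≤ _ := eLpNorm_sub_le (Measurable.aestronglyMeasurable (by fun_prop))
          (Measurable.aestronglyMeasurable (by fun_prop)) hp1
    _ ≤ _ := add_le_add (eLpNorm_sub_le (Measurable.aestronglyMeasurable (by fun_prop))
          (Measurable.aestronglyMeasurable (by fun_prop)) hp1) le_rfl
    _ ≤ _ := add_le_add (add_le_add (L3.trans (bd a han)) (L1.trans (bd a han)))
          (L2.trans (bd (-z) (by rw [norm_neg]; exact hz1)))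
    _ = _ := by
      rw [← add_mul, ← add_mul, ← ENNReal.ofReal_add (by positivity) (by positivity),
        ← ENNReal.ofReal_add (by positivity) (by positivity)]
      congr 2; ring

lemma pathOK_chart {n : ℕ} {Ω : Set (EV (n+1))} {Λ : ℝ} {U Q s} (h : IsLChart Ω Λ U Q s)
    {V : Set (EV (n+1))} {δ0 δ1 : ℝ} (hδ : δ0 * (2 * Λ + 2) ≤ δ1) (hδ1 : 0 < δ1)
    (hVU : ∀ x ∈ V, Metric.ball x δ1 ⊆ U) : PathOK Ω V (lastDir Q) Λ δ0 := by
  have hΛ := h.one_le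
  refine ⟨(norm_lastDir h.orth).le, hΛ, ?_⟩
  rintro x ⟨hxV, hxΩ⟩ z hz hxz t ⟨ht0, ht1⟩
  have hen := norm_lastDir h.orth
  have hlip : ∀ y w : EV (n+1), s y - Λ * ‖w‖ ≤ s (y + w) := fun y w => by
    have := (convex_univ : Convex ℝ (Set.univ : Set (EV (n+1)))).norm_image_sub_le_of_norm_fderiv_le
      (𝕜 := ℝ) (f := s) (C := Λ) (x := y) (y := y + w)
      (fun x _ => (h.smooth.differentiable (by norm_num)) x)
      (fun x _ => h.bound x) trivial trivial
    rw [add_sub_cancel_left, Real.norm_eq_abs] at this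
    linarith [neg_abs_le (s (y + w) - s y)]
  have hzn := norm_nonneg z
  have hinU : ∀ w : EV (n+1), ‖w‖ ≤ (Λ + 1) * ‖z‖ → x + w ∈ U := fun w hw => by
    refine hVU x hxV ?_
    rw [Metric.mem_ball, dist_eq_norm, add_sub_cancel_left]
    have : (Λ + 1) * ‖z‖ ≤ (Λ + 1) * δ0 := by gcongr
    have h2 : 0 < δ0 := hzn.trans_lt hz
    nlinarith
  have hLz : 0 ≤ Λ * ‖z‖ := by positivity
  have hn1 : ‖t • ((Λ * ‖z‖) • lastDir Q)‖ ≤ Λ * ‖z‖ := by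
    rw [norm_smul, norm_smul, hen, Real.norm_of_nonneg ht0, Real.norm_of_nonneg hLz, mul_one]
    exact mul_le_of_le_one_left hLz ht1
  have hn2 : ‖(Λ * ‖z‖) • lastDir Q‖ ≤ Λ * ‖z‖ := by
    rw [norm_smul, hen, Real.norm_of_nonneg hLz, mul_one]
  have hn3 : ‖t • (-z)‖ ≤ ‖z‖ := by
    rw [norm_smul, norm_neg, Real.norm_of_nonneg ht0]
    exact mul_le_of_le_one_left hzn ht1
  have hsx : 0 < s x := (h.mem_iff x (by
    simpa using hinU 0 (by rw [norm_zero]; positivity))).1 hxΩ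
  have htL : 0 ≤ t * (Λ * ‖z‖) := by positivity
  refine ⟨?_, ?_, ?_⟩
  · rw [h.mem_iff _ (hinU _ (by linarith)), smul_smul, h.shift]; positivity
  · have h1 : x + (Λ * ‖z‖) • lastDir Q + t • (-z) ∈ U := by
      rw [add_assoc]
      exact hinU _ ((norm_add_le _ _).trans (by linarith))
    rw [h.mem_iff _ h1]
    have h2 := hlip (x + (Λ * ‖z‖) • lastDir Q) (t • (-z))
    rw [h.shift] at h2
    have h3 : Λ * ‖t • (-z)‖ ≤ Λ * ‖z‖ := by gcongr
    linarith
  · have h1 : x + -z + t • ((Λ * ‖z‖) • lastDir Q) ∈ U := by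
      rw [add_assoc]
      exact hinU _ ((norm_add_le _ _).trans (by rw [norm_neg]; linarith))
    rw [h.mem_iff _ h1, smul_smul, h.shift, ← sub_eq_add_neg]
    have h2 : x - z ∈ U := by
      rw [sub_eq_add_neg]; exact hinU _ (by rw [norm_neg]; linarith)
    have := (h.mem_iff _ h2).1 hxz
    linarith

lemma pathOK_interior {m : ℕ} {Ω V : Set (EV m)} {Λ δ0 δ1 : ℝ} (hΛ : 1 ≤ Λ) (hδ : δ0 ≤ δ1)
    (hVU : ∀ x ∈ V, Metric.ball x δ1 ⊆ Ω) : PathOK Ω V 0 Λ δ0 := by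
  refine ⟨by simp, hΛ, ?_⟩
  rintro x ⟨hxV, hxΩ⟩ z hz hxz t ⟨ht0, ht1⟩
  simp only [smul_zero, add_zero]
  refine ⟨hxΩ, hVU x hxV ?_, by rwa [← sub_eq_add_neg]⟩
  rw [Metric.mem_ball, dist_eq_norm, add_sub_cancel_left, norm_smul, norm_neg,
    Real.norm_of_nonneg ht0]
  have := mul_le_of_le_one_left (norm_nonneg z) ht1
  linarith

open Classical in
/-- Taylor remainder, cut off outside the domain -/
def Rz {m : ℕ} (Ω : Set (EV m)) (δ0 : ℝ) (U0 : EV m → ℝ) (U1 : Fin m → EV m → ℝ)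
    (x z : EV m) : ℝ :=
  if x - z ∈ Ω then U0 x - U0 (x - z) - ∑ k, (if ‖z‖ < δ0 then z k else 0) * U1 k x else 0

lemma meas_Rz {m : ℕ} {Ω : Set (EV m)} (hΩ : IsOpen Ω) (δ0 : ℝ) {U0 : EV m → ℝ}
    {U1 : Fin m → EV m → ℝ} (h0 : Measurable U0) (h1 : ∀ i, Measurable (U1 i)) :
    Measurable (Function.uncurry (Rz Ω δ0 U0 U1)) := by
  unfold Rz Function.uncurry
  refine Measurable.ite (hΩ.measurableSet.preimage (by fun_prop)) ?_ measurable_const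
  refine Measurable.sub (by fun_prop) ?_
  refine Finset.measurable_sum _ fun k _ => Measurable.mul ?_ ((h1 k).comp measurable_fst)
  refine Measurable.ite (measurableSet_lt (by fun_prop) measurable_const) (by fun_prop)
    measurable_const

lemma Rz_bound {m : ℕ} {Ω : Set (EV m)} (hΩ : IsOpen Ω) {M : Matrix (Fin m) (Fin m) ℝ}
    {p : ℝ≥0∞} (hp1 : 1 ≤ p) (hp : p ≠ ⊤) {U0 U1 U2} (hu : SobData Ω M p U0 U1 U2)
    {V : Set (EV m)} (hV : MeasurableSet V) {e : EV m} {Λ δ0 : ℝ} (hδ0 : 0 < δ0)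
    (h : PathOK Ω V e Λ δ0) (z : EV m) :
    eLpNorm (fun x => (‖z‖ ^ 2)⁻¹ * Rz Ω δ0 U0 U1 x z) p (volume.restrict (V ∩ Ω)) ≤
      ENNReal.ofReal (9 * m ^ 2 * Λ ^ 2 + 2 / δ0 ^ 2) * SobW p U0 U1 U2 := by
  classical
  have hm0 := hu.m0
  have hm1 := hu.m1
  rcases eq_or_ne z 0 with rfl | hz0
  · simp
  have hzn : 0 < ‖z‖ := norm_pos_iff.2 hz0
  set T : Set (EV m) := {x | x - z ∈ Ω} with hT
  have hTm : MeasurableSet T := hΩ.measurableSet.preimage (by fun_prop)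
  have hset : T ∩ (V ∩ Ω) = {x | x ∈ V ∩ Ω ∧ x - z ∈ Ω} := by
    ext x; simp only [hT, Set.mem_inter_iff, Set.mem_ofPred_eq]; tauto
  have e1 : (fun x => (‖z‖ ^ 2)⁻¹ * Rz Ω δ0 U0 U1 x z) = (‖z‖ ^ 2)⁻¹ • T.indicator
      (fun x => U0 x - U0 (x - z) - ∑ k, (if ‖z‖ < δ0 then z k else 0) * U1 k x) := by
    funext x
    simp only [Rz, Pi.smul_apply, smul_eq_mul, Set.indicator, hT, Set.mem_ofPred_eq]
  rw [e1, eLpNorm_const_smul, eLpNorm_indicator_eq_eLpNorm_restrict hTm,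
    Measure.restrict_restrict hTm, hset]
  have e2 : ‖(‖z‖ ^ 2)⁻¹‖ₑ = ENNReal.ofReal ((‖z‖ ^ 2)⁻¹) :=
    Real.enorm_of_nonneg (by positivity)
  rw [e2]
  by_cases hz : ‖z‖ < δ0
  · simp only [hz, if_true]
    calc _ ≤ ENNReal.ofReal ((‖z‖ ^ 2)⁻¹) *
          (ENNReal.ofReal (9 * m ^ 2 * Λ ^ 2 * ‖z‖ ^ 2) * SobW p U0 U1 U2) :=
          mul_le_mul' le_rfl (R_bound hΩ hp1 hp hu hV h hz)
      _ = ENNReal.ofReal (9 * m ^ 2 * Λ ^ 2) * SobW p U0 U1 U2 := by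
          rw [← mul_assoc, ← ENNReal.ofReal_mul (by positivity)]
          congr 2; field_simp
      _ ≤ _ := mul_le_mul' (ENNReal.ofReal_le_ofReal (by
          have : 0 ≤ 2 / δ0 ^ 2 := by positivity
          linarith)) le_rfl
  · simp only [hz, if_false, zero_mul, Finset.sum_const_zero, sub_zero]
    push Not at hz
    have h3 : eLpNorm (fun x => U0 x - U0 (x - z)) p
        (volume.restrict {x | x ∈ V ∩ Ω ∧ x - z ∈ Ω}) ≤ 2 * SobW p U0 U1 U2 := by
      refine (eLpNorm_mono_measure _ Measure.restrict_le_self).trans ?_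
      refine (eLpNorm_sub_le (f := U0) (g := fun x => U0 (x - z)) hm0.aestronglyMeasurable
        (Measurable.aestronglyMeasurable (by fun_prop)) hp1).trans ?_
      have := eLpNorm_shift hm0 p (-z)
      simp only [← sub_eq_add_neg] at this
      rw [this, two_mul]
      exact add_le_add (SobW_0 p U0 U1 U2) (SobW_0 p U0 U1 U2)
    calc _ ≤ ENNReal.ofReal ((δ0 ^ 2)⁻¹) * (2 * SobW p U0 U1 U2) :=
          mul_le_mul' (ENNReal.ofReal_le_ofReal (by gcongr)) h3
      _ = ENNReal.ofReal (2 / δ0 ^ 2) * SobW p U0 U1 U2 := by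
          rw [← mul_assoc]; congr 1
          rw [show (2:ℝ≥0∞) = ENNReal.ofReal 2 by simp, ← ENNReal.ofReal_mul (by positivity)]
          congr 1; ring
      _ ≤ _ := mul_le_mul' (ENNReal.ofReal_le_ofReal (by
          have : 0 ≤ 9 * (m:ℝ) ^ 2 * Λ ^ 2 := by positivity
          linarith)) le_rfl

lemma lint_Rz {m : ℕ} {Ω : Set (EV m)} (hΩ : IsOpen Ω) {K : EV m → ℝ} {m0 : ℝ} (hK : KerOK K m0)
    (δ0 : ℝ) {U0 : EV m → ℝ} {U1 : Fin m → EV m → ℝ} (h0 : Measurable U0)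
    (h1 : ∀ i, Measurable (U1 i)) (x : EV m) :
    ∫⁻ z, ‖kernelJ K z * Rz Ω δ0 U0 U1 x z‖ₑ =
      ∫⁻ z, ‖(‖z‖ ^ 2)⁻¹ * Rz Ω δ0 U0 U1 x z‖ₑ
        ∂(volume.withDensity fun z => ENNReal.ofReal (K z)) := by
  have hm := hK.meas
  have hR := (meas_Rz hΩ δ0 h0 h1).comp (measurable_prodMk_left (x := x))
  simp only [Function.comp_def, Function.uncurry] at hR
  rw [lintegral_withDensity_eq_lintegral_mul _ (by fun_prop) (by fun_prop)]
  refine lintegral_congr fun z => ?_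
  simp only [Pi.mul_apply]
  rw [← Real.enorm_of_nonneg (hK.nonneg z), ← enorm_mul]
  congr 1
  unfold kernelJ; ring

lemma taylor_part {m : ℕ} {Ω : Set (EV m)} (hΩ : IsOpen Ω) {M : Matrix (Fin m) (Fin m) ℝ}
    {p : ℝ≥0∞} (hp1 : 1 ≤ p) (hp : p ≠ ⊤) {U0 U1 U2} (hu : SobData Ω M p U0 U1 U2)
    {K : EV m → ℝ} {m0 : ℝ} (hK : KerOK K m0)
    {V : Set (EV m)} (hV : MeasurableSet V) {e : EV m} {Λ δ0 : ℝ} (hδ0 : 0 < δ0)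
    (h : PathOK Ω V e Λ δ0) :
    eLpNorm (fun x => ∫⁻ z, ‖kernelJ K z * Rz Ω δ0 U0 U1 x z‖ₑ) p (volume.restrict (V ∩ Ω)) ≤
      ENNReal.ofReal (m0 * (9 * m ^ 2 * Λ ^ 2 + 2 / δ0 ^ 2)) * SobW p U0 U1 U2 := by
  simp only [lint_Rz hΩ hK δ0 hu.m0 hu.m1]
  set ν := volume.withDensity fun z => ENNReal.ofReal (K z) with hν
  have hνu : ν Set.univ ≤ ENNReal.ofReal m0 := by
    rw [hν, withDensity_apply _ MeasurableSet.univ, Measure.restrict_univ]; exact hK.mass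
  haveI : IsFiniteMeasure ν := ⟨hνu.trans_lt ENNReal.ofReal_lt_top⟩
  have hR := meas_Rz hΩ δ0 hu.m0 hu.m1
  refine (minkM _ ν hp1 hp (fun x z => ‖(‖z‖ ^ 2)⁻¹ * Rz Ω δ0 U0 U1 x z‖ₑ) ?_
    (ENNReal.ofReal (9 * m ^ 2 * Λ ^ 2 + 2 / δ0 ^ 2) * SobW p U0 U1 U2)
    (ae_of_all _ fun z => ?_)).trans ?_
  · simp only [Function.uncurry_def] at hR ⊢
    fun_prop
  · rw [eLpNorm_enorm_e (f := fun x => (‖z‖ ^ 2)⁻¹ * Rz Ω δ0 U0 U1 x z)]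
    exact Rz_bound hΩ hp1 hp hu hV hδ0 h z
  · rw [ENNReal.ofReal_mul hK.m0pos, mul_assoc (ENNReal.ofReal m0)]
    exact mul_le_mul' hνu le_rfl

lemma meas_inner_set {m : ℕ} (U : Set (EV m)) (δ : ℝ) :
    MeasurableSet {x : EV m | Metric.ball x δ ⊆ U} := by
  have : {x : EV m | Metric.ball x δ ⊆ U}ᶜ = ⋃ y ∈ Uᶜ, Metric.ball y δ := by
    ext x
    simp only [Set.mem_compl_iff, Set.mem_ofPred_eq, Set.mem_iUnion, Set.not_subset,
      Metric.mem_ball, exists_prop]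
    constructor
    · rintro ⟨y, h1, h2⟩; exact ⟨y, h2, by rwa [dist_comm]⟩
    · rintro ⟨y, h1, h2⟩; exact ⟨y, by rwa [dist_comm], h1⟩
  rw [← MeasurableSet.compl_iff, this]
  exact (isOpen_biUnion fun y _ => Metric.isOpen_ball).measurableSet

/-- both parts of the operator are bounded on the whole domain -/
lemma global_bound {n : ℕ} {Ω : Set (EV (n + 1))} (hΩ : IsGraphDomain 3 Ω)
    (hcpt : IsCompact (frontier Ω)) {ρ : EV (n+1) → ℝ} (hρ1 : A1 ρ) (hρ2 : A2 ρ)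
    {p : ℝ≥0∞} (hp1 : 1 ≤ p) (hp : p ≠ ⊤) :
    ∃ δ0 c : ℝ, 0 < δ0 ∧ 0 ≤ c ∧ ∀ ε : ℝ, 0 < ε → ∀ U0 U1 U2,
      (∀ M, SobData Ω M p U0 U1 U2 →
        eLpNorm (fun x => ∫⁻ z, ‖kernelJ (scaled ρ ε) z * Rz Ω δ0 U0 U1 x z‖ₑ) p
          (volume.restrict Ω) ≤ ENNReal.ofReal c * SobW p U0 U1 U2) ∧
      (SobData Ω (momentum ρ) p U0 U1 U2 →
        eLpNorm (fun x => ∑ i, U1 i x * bfun Ω (scaled ρ ε) δ0 x i) p (volume.restrict Ω) ≤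
          ENNReal.ofReal c * SobW p U0 U1 U2) := by
  classical
  have hΩo := hΩ.1
  obtain ⟨Λ, δ1, t, U, Q, s, hΛ, hδ1, hch, hcov⟩ := exists_atlas hΩ hcpt
  obtain ⟨hc1, ⟨c₀, c₁, α, N, hc0, hc1, hα0, hα2, hN, hb⟩, A, hA, hAM, hsl⟩ := hρ2
  obtain ⟨κ, hκ, hcv⟩ := curvOK_scaled hρ1 hc0 hα0 hα2 hN (fun x hx => (hb x hx).1)
  obtain ⟨lam, hlam, hlow⟩ := posdef_lower hA
  have hΛ0 : 0 < Λ := by linarith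
  set δ0 := δ1 / (2 * Λ + 2) with hδ0d
  have hδ0 : 0 < δ0 := by positivity
  have hδe : δ0 * (2 * Λ + 2) = δ1 := by rw [hδ0d]; field_simp
  have hδ01 : δ0 ≤ δ1 := by nlinarith
  set m0 := ∫ x, ρ x with hm0
  have hm00 : 0 ≤ m0 := integral_nonneg hρ1.2.1
  set C1 : ℝ := m0 * (9 * ((n + 1 : ℕ) : ℝ) ^ 2 * Λ ^ 2 + 2 / δ0 ^ 2) with hC1
  set C2 : ℝ := ((n+1) * (2 * Λ * κ + m0 / δ0) + lam⁻¹ * (2 * (Λ * m0 *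
        (absM (A * A) * Λ * (n+1)) + Λ * m0 / (δ1 / 2) * (absM (A * A) * Λ)))) with hC2
  have hab := absM_nonneg (A * A)
  have hC10 : 0 ≤ C1 := by positivity
  have hC20 : 0 ≤ C2 := by positivity
  let V : Option (EV (n+1)) → Set (EV (n+1)) := fun o =>
    o.elim {x | Metric.ball x δ1 ⊆ Ω} fun k => {x | Metric.ball x δ1 ⊆ U k}
  have hV : ∀ o, MeasurableSet (V o) := by
    rintro (_ | k)
    · exact meas_inner_set _ _
    · exact meas_inner_set _ _
  have hcov2 : Ω ⊆ ⋃ o ∈ t.insertNone, V o ∩ Ω := by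
    intro x hx
    simp only [Set.mem_iUnion]
    rcases hcov x hx with h | ⟨k, hk, h⟩
    · exact ⟨none, by simp, h, hx⟩
    · exact ⟨some k, by simpa using hk, h, hx⟩
  set T : ℝ := (t.insertNone.card : ℝ) with hT
  have key : ∀ (f : EV (n+1) → ℝ≥0∞) (c : ℝ) (W : ℝ≥0∞), 0 ≤ c → c ≤ C1 + C2 →
      (∀ o ∈ t.insertNone, eLpNorm f p (volume.restrict (V o ∩ Ω)) ≤ ENNReal.ofReal c * W) →
      eLpNorm f p (volume.restrict Ω) ≤ ENNReal.ofReal (T * (C1 + C2)) * W := by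
    intro f c W hc hcc h
    refine (eLpNorm_union_e volume hp1 hp t.insertNone (fun o => V o ∩ Ω) Ω hcov2 f _ h).trans ?_
    rw [ENNReal.ofReal_mul (by positivity), hT, ENNReal.ofReal_natCast, mul_assoc]
    exact mul_le_mul' le_rfl (mul_le_mul' (ENNReal.ofReal_le_ofReal hcc) le_rfl)
  refine ⟨δ0, T * (C1 + C2), hδ0, by positivity, fun ε hε U0 U1 U2 => ⟨fun M hu => ?_, fun hu => ?_⟩⟩
  · have hK := kerOK_scaled hρ1 hε
    refine key _ C1 _ hC10 (by linarith) ?_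
    rintro (_ | k) ho
    · exact taylor_part hΩo hp1 hp hu hK (hV none) hδ0
        (pathOK_interior hΛ hδ01 fun x hx => hx)
    · exact taylor_part hΩo hp1 hp hu hK (hV (some k)) hδ0
        (pathOK_chart (hch k (by simpa using ho)) hδe.le hδ1 fun x hx => hx)
  · have hK := kerOK_scaled hρ1 hε
    rw [← hAM] at hu
    rw [← eLpNorm_enorm_e]
    refine key _ C2 _ hC20 (by linarith) ?_
    rintro (_ | k) ho
    · rw [eLpNorm_enorm_e]
      have : eLpNorm (fun x => ∑ i, U1 i x * bfun Ω (scaled ρ ε) δ0 x i) p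
          (volume.restrict (V none ∩ Ω)) = 0 := by
        rw [eLpNorm_congr_ae (g := fun _ => (0:ℝ))]
        · simp
        · filter_upwards [ae_restrict_mem ((hV none).inter hΩo.measurableSet)] with x hx
          have h0 : oneSided Ω δ0 x = ∅ := by
            ext z
            simp only [oneSided, Set.mem_ofPred_eq, Set.mem_empty_iff_false, iff_false]
            rintro ⟨h1, h2, h3⟩
            refine h3 (hx.1 ?_)
            rw [Metric.mem_ball, dist_eq_norm, add_sub_cancel_left]; linarith
          simp [bfun, h0]
      rw [this]; exact zero_le
    · rw [eLpNorm_enorm_e]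
      exact drift_bound hA hlam hlow hΩo (hch k (by simpa using ho)) hp1 hp hu hK
        (slice_scaled hsl hε) hκ (hcv ε hε) (hV (some k)) hδ0 hδ01 (by positivity)
        (by linarith) fun x hx => hx

lemma exists_rep {m : ℕ} {Ω : Set (EV m)} (hΩ : MeasurableSet Ω) {p : ℝ≥0∞} {f : EV m → ℝ}
    (hf : MemLp f p (volume.restrict Ω)) :
    ∃ F : EV m → ℝ, Measurable F ∧ (∀ x, x ∉ Ω → F x = 0) ∧ MemLp F p volume ∧
      F =ᵐ[volume.restrict Ω] f ∧ eLpNorm F p volume = eLpNorm f p (volume.restrict Ω) ∧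
      ∀ ψ : EV m → ℝ, ∫ x, F x * ψ x = ∫ x in Ω, f x * ψ x := by
  have hmk := hf.1.stronglyMeasurable_mk.measurable
  have h1 : Ω.indicator (hf.1.mk f) =ᵐ[volume.restrict Ω] f := by
    filter_upwards [hf.1.ae_eq_mk, ae_restrict_mem hΩ] with x hx hxΩ
    rw [Set.indicator_of_mem hxΩ, hx]
  refine ⟨Ω.indicator (hf.1.mk f), hmk.indicator hΩ, fun x hx => Set.indicator_of_notMem hx _,
    ?_, h1, ?_, fun ψ => ?_⟩
  · rw [memLp_indicator_iff_restrict hΩ]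
    exact hf.ae_eq hf.1.ae_eq_mk
  · rw [eLpNorm_indicator_eq_eLpNorm_restrict hΩ]
    exact eLpNorm_congr_ae hf.1.ae_eq_mk.symm
  · rw [← integral_indicator hΩ]
    refine integral_congr_ae ?_
    have h2 := (ae_restrict_iff' hΩ).1 h1
    filter_upwards [h2] with x hx
    by_cases hxΩ : x ∈ Ω
    · rw [Set.indicator_of_mem hxΩ (f := fun x => f x * ψ x), hx hxΩ]
    · rw [Set.indicator_of_notMem hxΩ, Set.indicator_of_notMem hxΩ, zero_mul]

lemma WNormD_ge {m : ℕ} (p : ℝ≥0∞) (μ : Measure (EV m)) (D : List (Fin m) → EV m → ℝ)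
    (l : List (Fin m)) (hl : l.length ≤ 2) : eLpNorm (D l) p μ ≤ WNormD 2 p μ D := by
  unfold WNormD
  refine le_trans ?_ (ENNReal.le_tsum l)
  rw [if_pos hl]

lemma sob_of_derivs {m : ℕ} {Ω : Set (EV m)} (hΩ : MeasurableSet Ω) {p : ℝ≥0∞} {u : EV m → ℝ}
    {D : List (Fin m) → EV m → ℝ} (hD : IsSobDerivs Ω 2 p u D) :
    ∃ U0 U1 U2, (∀ M, NeumannBC Ω M p u → SobData Ω M p U0 U1 U2) ∧
      U0 =ᵐ[volume.restrict Ω] u ∧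
      SobW p U0 U1 U2 ≤ ENNReal.ofReal (1 + m + m * m) * WNormD 2 p (volume.restrict Ω) D := by
  obtain ⟨hD0, hDw, hDm⟩ := hD
  obtain ⟨U0, m0, z0, l0, ae0, n0, i0⟩ := exists_rep hΩ (hDm [] (by simp))
  choose U1 m1 z1 l1 ae1 n1 i1 using fun i : Fin m => exists_rep hΩ (hDm [i] (by simp))
  choose U2 m2 z2 l2 ae2 n2 i2 using fun i j : Fin m => exists_rep hΩ (hDm [i, j] (by simp))
  refine ⟨U0, U1, U2, fun M hN => ⟨m0, m1, m2, z0, z1, z2, l0, l1, l2, ?_, ?_, ?_⟩,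
    by rwa [hD0] at ae0, ?_⟩
  · intro i φ hφ hc hs
    rw [i0, i1]
    exact hDw [] (by simp) i φ hφ hc hs
  · intro i j φ hφ hc hs
    rw [i1, i2]
    exact hDw [j] (by simp) i φ hφ hc hs
  · intro φ hφ hc
    simp only [i1, i2]
    exact hN D ⟨hD0, hDw, hDm⟩ φ hφ hc
  · unfold SobW
    rw [n0]
    simp only [n1, n2]
    set W := WNormD 2 p (volume.restrict Ω) D with hW
    have h0 := WNormD_ge p (volume.restrict Ω) D [] (by simp)
    have h1 := fun i => WNormD_ge p (volume.restrict Ω) D [i] (by simp)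
    have h2 := fun i j => WNormD_ge p (volume.restrict Ω) D [i, j] (by simp)
    calc _ ≤ W + (∑ _i : Fin m, W) + ∑ _i : Fin m, ∑ _j : Fin m, W := by
          refine add_le_add (add_le_add h0 (Finset.sum_le_sum fun i _ => h1 i))
            (Finset.sum_le_sum fun i _ => Finset.sum_le_sum fun j _ => h2 i j)
      _ = _ := by
          simp only [Finset.sum_const, Finset.card_univ, Fintype.card_fin, nsmul_eq_mul]
          rw [ENNReal.ofReal_add (by positivity) (by positivity),
            ENNReal.ofReal_add (by positivity) (by positivity), ENNReal.ofReal_mul (by positivity)]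
          simp only [ENNReal.ofReal_one, ENNReal.ofReal_natCast]
          ring

lemma SobData.zero {m : ℕ} {Ω : Set (EV m)} {M : Matrix (Fin m) (Fin m) ℝ} {p : ℝ≥0∞}
    {U0 U1 U2} (h : SobData Ω M p U0 U1 U2) : SobData Ω 0 p U0 U1 U2 :=
  ⟨h.m0, h.m1, h.m2, h.z0, h.z1, h.z2, h.l0, h.l1, h.l2, h.wd0, h.wd1, by simp⟩

lemma wd_lin {m : ℕ} {Ω : Set (EV m)} {a : EV m} {f g f' g' : EV m → ℝ}
    (hf : LocallyIntegrable f) (hg : LocallyIntegrable g)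
    (hf' : LocallyIntegrable f') (hg' : LocallyIntegrable g') (h : WD Ω a f g) (h' : WD Ω a f' g')
    (c d : ℝ) : WD Ω a (fun x => c * f x + d * f' x) (fun x => c * g x + d * g' x) := by
  intro φ hφ hc hs
  have hφ1 : ContDiff ℝ 1 φ := hφ.of_le (by exact_mod_cast le_top)
  have key : ∀ (F G : EV m → ℝ) (ψ : EV m → ℝ), LocallyIntegrable F → LocallyIntegrable G →
      Continuous ψ → HasCompactSupport ψ → ∫ x, (c * F x + d * G x) * ψ x =
        c * (∫ x, F x * ψ x) + d * ∫ x, G x * ψ x := by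
    intro F G ψ hF hG hψ hcψ
    rw [← integral_const_mul, ← integral_const_mul,
      ← integral_add ((integrable_mul_cs hF hψ hcψ).const_mul c)
        ((integrable_mul_cs hG hψ hcψ).const_mul d)]
    congr 1; funext x; ring
  rw [key f f' _ hf hf' (cont_dir hφ1 a) (hasCompactSupport_dir hc a),
    key g g' _ hg hg' hφ.continuous hc, h φ hφ hc hs, h' φ hφ hc hs]
  ring

lemma SobData.lin {m : ℕ} {Ω : Set (EV m)} {p : ℝ≥0∞} (hp1 : 1 ≤ p)
    {U0 U1 U2} (h : SobData Ω 0 p U0 U1 U2) {V0 V1 V2} (h' : SobData Ω 0 p V0 V1 V2) (a b : ℝ) :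
    SobData Ω 0 p (fun x => a * U0 x + b * V0 x) (fun i x => a * U1 i x + b * V1 i x)
      (fun i j x => a * U2 i j x + b * V2 i j x) := by
  refine ⟨(h.m0.const_mul a).add (h'.m0.const_mul b),
    fun i => ((h.m1 i).const_mul a).add ((h'.m1 i).const_mul b),
    fun i j => ((h.m2 i j).const_mul a).add ((h'.m2 i j).const_mul b),
    fun x hx => by rw [h.z0 x hx, h'.z0 x hx]; ring,
    fun i x hx => by rw [h.z1 i x hx, h'.z1 i x hx]; ring,
    fun i j x hx => by rw [h.z2 i j x hx, h'.z2 i j x hx]; ring,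
    (h.l0.const_mul a).add (h'.l0.const_mul b),
    fun i => ((h.l1 i).const_mul a).add ((h'.l1 i).const_mul b),
    fun i j => ((h.l2 i j).const_mul a).add ((h'.l2 i j).const_mul b),
    fun i => wd_lin (h.l0.locallyIntegrable hp1) ((h.l1 i).locallyIntegrable hp1)
      (h'.l0.locallyIntegrable hp1) ((h'.l1 i).locallyIntegrable hp1) (h.wd0 i) (h'.wd0 i) a b,
    fun i j => wd_lin ((h.l1 j).locallyIntegrable hp1) ((h.l2 i j).locallyIntegrable hp1)
      ((h'.l1 j).locallyIntegrable hp1) ((h'.l2 i j).locallyIntegrable hp1) (h.wd1 i j) (h'.wd1 i j)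
        a b, by simp⟩

/-- the operator written in terms of a function and its gradient -/
def Ldef {m : ℕ} (Ω : Set (EV m)) (K : EV m → ℝ) (δ0 : ℝ) (U0 : EV m → ℝ) (U1 : Fin m → EV m → ℝ)
    (x : EV m) : ℝ :=
  (∫ z, kernelJ K z * Rz Ω δ0 U0 U1 x z) + ∑ i, U1 i x * bfun Ω K δ0 x i

lemma meas_bfun {m : ℕ} {Ω : Set (EV m)} (hΩ : IsOpen Ω) {K : EV m → ℝ} {m0 : ℝ} (hK : KerOK K m0)
    (δ0 : ℝ) (i : Fin m) : Measurable fun x => bfun Ω K δ0 x i := by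
  have hJ := hK.measJ
  have hS : MeasurableSet {q : EV m × EV m | q.2 ∈ oneSided Ω δ0 q.1} := by
    have h1 : MeasurableSet {q : EV m × EV m | ‖q.2‖ < δ0} :=
      measurableSet_lt (by fun_prop) measurable_const
    have h2 : MeasurableSet {q : EV m × EV m | q.1 - q.2 ∈ Ω} :=
      hΩ.measurableSet.preimage (by fun_prop)
    have h3 : MeasurableSet {q : EV m × EV m | q.1 + q.2 ∈ Ω} :=
      hΩ.measurableSet.preimage (by fun_prop)
    exact h1.inter (h2.inter h3.compl)
  have hF : Measurable ({q : EV m × EV m | q.2 ∈ oneSided Ω δ0 q.1}.indicator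
      fun q => kernelJ K q.2 * q.2 i) := Measurable.indicator (by fun_prop) hS
  have := (hF.stronglyMeasurable.integral_prod_right' (ν := (volume : Measure (EV m)))).measurable
  convert this using 2 with x
  unfold bfun
  rw [← integral_indicator (meas_oneSided hΩ δ0 x)]
  rfl

lemma meas_Ldef {m : ℕ} {Ω : Set (EV m)} (hΩ : IsOpen Ω) {K : EV m → ℝ} {m0 : ℝ} (hK : KerOK K m0)
    (δ0 : ℝ) {U0 : EV m → ℝ} {U1 : Fin m → EV m → ℝ} (h0 : Measurable U0)
    (h1 : ∀ i, Measurable (U1 i)) : Measurable (Ldef Ω K δ0 U0 U1) := by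
  have hJ := hK.measJ
  have hR := meas_Rz hΩ δ0 h0 h1
  have hF : Measurable fun q : EV m × EV m => kernelJ K q.2 * Rz Ω δ0 U0 U1 q.1 q.2 :=
    (hJ.comp measurable_snd).mul hR
  unfold Ldef
  refine Measurable.add ?_ (Finset.measurable_sum _ fun i _ => (h1 i).mul (meas_bfun hΩ hK δ0 i))
  exact (hF.stronglyMeasurable.integral_prod_right' (ν := (volume : Measure (EV m)))).measurable

lemma Ldef_int {m : ℕ} {Ω : Set (EV m)} (hΩ : IsOpen Ω) {K : EV m → ℝ} {m0 : ℝ} (hK : KerOK K m0)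
    {δ0 c : ℝ} {p : ℝ≥0∞} (hp1 : 1 ≤ p) (hp : p ≠ ⊤) {U0 U1 U2} (hu : SobData Ω 0 p U0 U1 U2)
    (hb : eLpNorm (fun x => ∫⁻ z, ‖kernelJ K z * Rz Ω δ0 U0 U1 x z‖ₑ) p
          (volume.restrict Ω) ≤ ENNReal.ofReal c * SobW p U0 U1 U2) :
    ∀ᵐ x ∂(volume.restrict Ω), Integrable fun z => kernelJ K z * Rz Ω δ0 U0 U1 x z := by
  have hJ := hK.measJ
  have hR := meas_Rz hΩ δ0 hu.m0 hu.m1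
  have hF : Measurable fun q : EV m × EV m => kernelJ K q.2 * Rz Ω δ0 U0 U1 q.1 q.2 :=
    (hJ.comp measurable_snd).mul hR
  have hfin : eLpNorm (fun x => ∫⁻ z, ‖kernelJ K z * Rz Ω δ0 U0 U1 x z‖ₑ) p
      (volume.restrict Ω) < ⊤ :=
    hb.trans_lt (ENNReal.mul_lt_top ENNReal.ofReal_lt_top (lt_top_iff_ne_top.2 (SobW_ne_top hu)))
  have hmeas : Measurable fun x => ∫⁻ z, ‖kernelJ K z * Rz Ω δ0 U0 U1 x z‖ₑ :=
    Measurable.lintegral_prod_right' (f := fun q : EV m × EV m =>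
      ‖kernelJ K q.2 * Rz Ω δ0 U0 U1 q.1 q.2‖ₑ) hF.enorm
  have hp0 : p ≠ 0 := (zero_lt_one.trans_le hp1).ne'
  have h2 := lintegral_rpow_enorm_lt_top_of_eLpNorm_lt_top hp0 hp hfin
  have h3 := ae_lt_top (by fun_prop) h2.ne
  filter_upwards [h3] with x hx
  refine ⟨(hF.comp measurable_prodMk_left).aestronglyMeasurable, ?_⟩
  have hpt : 0 < p.toReal := ENNReal.toReal_pos hp0 hp
  rw [enorm_eq_self] at hx
  exact (ENNReal.rpow_lt_top_iff_of_pos hpt).1 hx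

lemma Ldef_lin {m : ℕ} {Ω : Set (EV m)} (hΩ : IsOpen Ω) {K : EV m → ℝ} {m0 : ℝ} (hK : KerOK K m0)
    {δ0 c : ℝ} {p : ℝ≥0∞} (hp1 : 1 ≤ p) (hp : p ≠ ⊤)
    (hb : ∀ U0 U1 U2, SobData Ω 0 p U0 U1 U2 →
      eLpNorm (fun x => ∫⁻ z, ‖kernelJ K z * Rz Ω δ0 U0 U1 x z‖ₑ) p
          (volume.restrict Ω) ≤ ENNReal.ofReal c * SobW p U0 U1 U2)
    {U0 U1 U2} (hu : SobData Ω 0 p U0 U1 U2) {V0 V1 V2} (hv : SobData Ω 0 p V0 V1 V2)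
    {W0 W1 W2} (hw : SobData Ω 0 p W0 W1 W2) (a b : ℝ)
    (h : W0 =ᵐ[volume.restrict Ω] fun x => a * U0 x + b * V0 x) :
    Ldef Ω K δ0 W0 W1 =ᵐ[volume.restrict Ω]
      fun x => a * Ldef Ω K δ0 U0 U1 x + b * Ldef Ω K δ0 V0 V1 x := by
  have hl := hu.lin hp1 hv a b
  have h0 : ∀ᵐ x, W0 x = a * U0 x + b * V0 x := by
    filter_upwards [(ae_restrict_iff' hΩ.measurableSet).1 h] with x hx
    by_cases hxΩ : x ∈ Ω
    · exact hx hxΩ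
    · rw [hw.z0 x hxΩ, hu.z0 x hxΩ, hv.z0 x hxΩ]; ring
  have h1 : ∀ i, ∀ᵐ x, x ∈ Ω → W1 i x = a * U1 i x + b * V1 i x := fun i =>
    wd_unique hΩ ((hw.l1 i).locallyIntegrable hp1) ((hl.l1 i).locallyIntegrable hp1) h0
      (hw.wd0 i) (hl.wd0 i)
  have h1' := ae_all_iff.2 h1
  filter_upwards [ae_restrict_of_ae h0, ae_restrict_of_ae h1', ae_restrict_mem hΩ.measurableSet,
    Ldef_int hΩ hK hp1 hp hu (hb _ _ _ hu), Ldef_int hΩ hK hp1 hp hv (hb _ _ _ hv)]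
    with x hx0 hx1 hxΩ iu iv
  have hz : ∀ᵐ z : EV m, W0 (x - z) = a * U0 (x - z) + b * V0 (x - z) :=
    (quasiMeasurePreserving_sub_left_of_right_invariant volume x).ae h0
  have e1 : ∫ z, kernelJ K z * Rz Ω δ0 W0 W1 x z =
      a * (∫ z, kernelJ K z * Rz Ω δ0 U0 U1 x z) + b * ∫ z, kernelJ K z * Rz Ω δ0 V0 V1 x z := by
    rw [← integral_const_mul, ← integral_const_mul, ← integral_add (iu.const_mul a) (iv.const_mul b)]
    refine integral_congr_ae ?_
    filter_upwards [hz] with z hz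
    unfold Rz
    by_cases hc : x - z ∈ Ω
    · rw [if_pos hc, if_pos hc, if_pos hc]
      have : ∑ k, (if ‖z‖ < δ0 then z k else 0) * W1 k x =
          a * ∑ k, (if ‖z‖ < δ0 then z k else 0) * U1 k x +
          b * ∑ k, (if ‖z‖ < δ0 then z k else 0) * V1 k x := by
        rw [Finset.mul_sum, Finset.mul_sum, ← Finset.sum_add_distrib]
        refine Finset.sum_congr rfl fun k _ => ?_
        rw [hx1 k hxΩ]; ring
      rw [this, hz, hx0]; ring
    · rw [if_neg hc, if_neg hc, if_neg hc]; ring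
  have e2 : ∑ i, W1 i x * bfun Ω K δ0 x i = a * (∑ i, U1 i x * bfun Ω K δ0 x i) +
      b * ∑ i, V1 i x * bfun Ω K δ0 x i := by
    rw [Finset.mul_sum, Finset.mul_sum, ← Finset.sum_add_distrib]
    refine Finset.sum_congr rfl fun k _ => ?_
    rw [hx1 k hxΩ]; ring
  unfold Ldef
  rw [e1, e2]; ring

lemma Ldef_congr {m : ℕ} {Ω : Set (EV m)} (hΩ : IsOpen Ω) {K : EV m → ℝ} {m0 : ℝ} (hK : KerOK K m0)
    {δ0 c : ℝ} {p : ℝ≥0∞} (hp1 : 1 ≤ p) (hp : p ≠ ⊤)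
    (hb : ∀ U0 U1 U2, SobData Ω 0 p U0 U1 U2 →
      eLpNorm (fun x => ∫⁻ z, ‖kernelJ K z * Rz Ω δ0 U0 U1 x z‖ₑ) p
          (volume.restrict Ω) ≤ ENNReal.ofReal c * SobW p U0 U1 U2)
    {U0 U1 U2} (hu : SobData Ω 0 p U0 U1 U2)
    {W0 W1 W2} (hw : SobData Ω 0 p W0 W1 W2)
    (h : W0 =ᵐ[volume.restrict Ω] U0) :
    Ldef Ω K δ0 W0 W1 =ᵐ[volume.restrict Ω] Ldef Ω K δ0 U0 U1 := by
  have h1 := Ldef_lin hΩ hK hp1 hp hb hu hu hw 1 0 (by simpa using h)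
  simpa using h1

lemma Ldef_bound {m : ℕ} {Ω : Set (EV m)} (hΩ : IsOpen Ω) {K : EV m → ℝ} {m0 : ℝ} (hK : KerOK K m0)
    {δ0 c : ℝ} {p : ℝ≥0∞} (hc : 0 ≤ c) (hp1 : 1 ≤ p) {U0 : EV m → ℝ} {U1 : Fin m → EV m → ℝ}
    (h0 : Measurable U0) (h1 : ∀ i, Measurable (U1 i)) {W : ℝ≥0∞}
    (hb : eLpNorm (fun x => ∫⁻ z, ‖kernelJ K z * Rz Ω δ0 U0 U1 x z‖ₑ) p
          (volume.restrict Ω) ≤ ENNReal.ofReal c * W)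
    (hd : eLpNorm (fun x => ∑ i, U1 i x * bfun Ω K δ0 x i) p (volume.restrict Ω) ≤
          ENNReal.ofReal c * W) :
    eLpNorm (Ldef Ω K δ0 U0 U1) p (volume.restrict Ω) ≤ ENNReal.ofReal (2 * c) * W := by
  have hJ := hK.measJ
  have hR := meas_Rz hΩ δ0 h0 h1
  have hF : Measurable fun q : EV m × EV m => kernelJ K q.2 * Rz Ω δ0 U0 U1 q.1 q.2 :=
    (hJ.comp measurable_snd).mul hR
  have hA : Measurable fun x => ∫ z, kernelJ K z * Rz Ω δ0 U0 U1 x z :=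
    (hF.stronglyMeasurable.integral_prod_right' (ν := (volume : Measure (EV m)))).measurable
  have hB : Measurable fun x => ∑ i, U1 i x * bfun Ω K δ0 x i :=
    Finset.measurable_sum _ fun i _ => (h1 i).mul (meas_bfun hΩ hK δ0 i)
  have e : Ldef Ω K δ0 U0 U1 = (fun x => ∫ z, kernelJ K z * Rz Ω δ0 U0 U1 x z) +
      fun x => ∑ i, U1 i x * bfun Ω K δ0 x i := rfl
  rw [e]
  refine (eLpNorm_add_le hA.aestronglyMeasurable hB.aestronglyMeasurable hp1).trans ?_
  have h3 : eLpNorm (fun x => ∫ z, kernelJ K z * Rz Ω δ0 U0 U1 x z) p (volume.restrict Ω) ≤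
      ENNReal.ofReal c * W := by
    refine le_trans ?_ hb
    rw [← eLpNorm_enorm_e (f := fun x => ∫ z, kernelJ K z * Rz Ω δ0 U0 U1 x z)]
    exact eLpNorm_mono_e _ (ae_of_all _ fun x => enorm_integral_le_lintegral_enorm _)
  refine (add_le_add h3 hd).trans (le_of_eq ?_)
  rw [← two_mul, ← mul_assoc, ENNReal.ofReal_mul (by norm_num)]
  simp

lemma wd_classical {m : ℕ} {Ω : Set (EV m)} {f : EV m → ℝ} (hf : ContDiff ℝ 1 f) (a : EV m) :
    WD Ω a (Ω.indicator f) (Ω.indicator fun x => fderiv ℝ f x a) := by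
  intro φ hφ hc hs
  have hφ1 : ContDiff ℝ 1 φ := hφ.of_le (by exact_mod_cast le_top)
  have hout : ∀ x, x ∉ Ω → x ∉ tsupport φ := fun x hx h => hx (hs h)
  have e1 : ∀ x, Ω.indicator f x * fderiv ℝ φ x a = f x * fderiv ℝ φ x a := fun x => by
    by_cases hx : x ∈ Ω
    · rw [Set.indicator_of_mem hx]
    · have h0 : fderiv ℝ φ x = 0 := by
        by_contra h
        exact hout x hx (support_fderiv_subset ℝ h)
      simp [h0]
  have e2 : ∀ x, Ω.indicator (fun x => fderiv ℝ f x a) x * φ x = fderiv ℝ f x a * φ x := fun x => by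
    by_cases hx : x ∈ Ω
    · rw [Set.indicator_of_mem hx]
    · rw [image_eq_zero_of_notMem_tsupport (hout x hx)]; ring
  simp only [e1, e2]
  have hfd := cont_dir hf a
  have hφd := cont_dir hφ1 a
  refine integral_mul_fderiv_eq_neg_fderiv_mul_of_integrable ?_ ?_ ?_ ?_ ?_
  · exact (hfd.mul hφ.continuous).integrable_of_hasCompactSupport hc.mul_left
  · exact (hf.continuous.mul hφd).integrable_of_hasCompactSupport
      (hasCompactSupport_dir hc a).mul_left
  · exact (hf.continuous.mul hφ.continuous).integrable_of_hasCompactSupport hc.mul_left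
  · exact fun x _ => hf.differentiable (by norm_num) x
  · exact fun x _ => hφ1.differentiable (by norm_num) x

lemma sob_classical {m : ℕ} {Ω : Set (EV m)} (hΩ : IsOpen Ω) {p : ℝ≥0∞} {u : EV m → ℝ}
    (hu : ContDiff ℝ 2 u) (hc : HasCompactSupport u) :
    SobData Ω 0 p (Ω.indicator u) (fun i => Ω.indicator fun x => fderiv ℝ u x (ee i))
      (fun i j => Ω.indicator fun x => fderiv ℝ (fun y => fderiv ℝ u y (ee j)) x (ee i)) := by
  have hu1 : ContDiff ℝ 1 u := hu.of_le (by norm_num)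
  have hd : ∀ j, ContDiff ℝ 1 fun y => fderiv ℝ u y (ee j) := fun j =>
    (hu.fderiv_right (m := 1) (by norm_num)).clm_apply contDiff_const
  have hcd : ∀ j, HasCompactSupport fun y => fderiv ℝ u y (ee j) := fun j =>
    hasCompactSupport_dir hc _
  have hΩm := hΩ.measurableSet
  refine ⟨hu.continuous.measurable.indicator hΩm, fun i => (cont_dir hu1 _).measurable.indicator hΩm,
    fun i j => (cont_dir (hd j) _).measurable.indicator hΩm,
    fun x hx => Set.indicator_of_notMem hx _, fun i x hx => Set.indicator_of_notMem hx _,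
    fun i j x hx => Set.indicator_of_notMem hx _,
    (hu.continuous.memLp_of_hasCompactSupport hc).indicator hΩm,
    fun i => ((cont_dir hu1 _).memLp_of_hasCompactSupport (hcd i)).indicator hΩm,
    fun i j => ((cont_dir (hd j) _).memLp_of_hasCompactSupport
      (hasCompactSupport_dir (hcd j) _)).indicator hΩm,
    fun i => wd_classical hu1 _, fun i j => wd_classical (hd j) _, by simp⟩

lemma odd_zero {m : ℕ} {K : EV m → ℝ} {m0 : ℝ} (hK : KerOK K m0) {S : Set (EV m)}
    (hS : MeasurableSet S) (hsym : ∀ z, -z ∈ S ↔ z ∈ S) (i : Fin m) :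
    ∫ z in S, kernelJ K z * z i = 0 := by
  rw [← integral_indicator hS]
  set F := S.indicator fun z => kernelJ K z * z i with hF
  have h1 := integral_neg_eq_self F volume
  have h2 : ∫ z, F (-z) = ∫ z, -F z := by
    refine integral_congr_ae ?_
    filter_upwards [hK.even] with z hz
    simp only [hF]
    by_cases h : z ∈ S
    · rw [Set.indicator_of_mem h, Set.indicator_of_mem ((hsym z).2 h)]
      simp [kernelJ, hz]
    · rw [Set.indicator_of_notMem h, Set.indicator_of_notMem (fun h' => h ((hsym z).1 h'))]
      simp
  rw [integral_neg] at h2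
  linarith

lemma Rz_classical_int {m : ℕ} {Ω : Set (EV m)} (hΩ : IsOpen Ω) {K : EV m → ℝ} {m0 : ℝ}
    (hK : KerOK K m0) {δ0 : ℝ} (hδ0 : 0 < δ0) {u : EV m → ℝ}
    (hu : ContDiff ℝ 2 u) (hc : HasCompactSupport u) {x : EV m} (hx : x ∈ Ω) :
    Integrable fun z => kernelJ K z * Rz Ω δ0 (Ω.indicator u)
      (fun i => Ω.indicator fun x => fderiv ℝ u x (ee i)) x z := by
  obtain ⟨C, hC⟩ := (hu.continuous_iteratedFDeriv (m := 2) le_rfl).bounded_above_of_compact_support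
    (hc.iteratedFDeriv (𝕜 := ℝ) 2)
  obtain ⟨B, hB⟩ := hu.continuous.bounded_above_of_compact_support hc
  have hC0 : 0 ≤ C := (norm_nonneg _).trans (hC x)
  have hB0 : 0 ≤ B := (norm_nonneg _).trans (hB x)
  have hu' := sob_classical hΩ (p := 1) hu hc
  have hJ := hK.measJ
  have hR := (meas_Rz hΩ δ0 hu'.m0 hu'.m1).comp (measurable_prodMk_left (x := x))
  have hKi : Integrable K := by
    refine ⟨hK.meas.aestronglyMeasurable, ?_⟩
    refine lt_of_le_of_lt (le_of_eq ?_) (hK.mass.trans_lt ENNReal.ofReal_lt_top)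
    exact lintegral_congr fun z => Real.enorm_of_nonneg (hK.nonneg z)
  refine (hKi.const_mul (C + 2 * B / δ0 ^ 2)).mono' (hJ.mul hR).aestronglyMeasurable
    (ae_of_all _ fun z => ?_)
  have hRb : |Rz Ω δ0 (Ω.indicator u) (fun i => Ω.indicator fun x => fderiv ℝ u x (ee i)) x z| ≤
      (C + 2 * B / δ0 ^ 2) * ‖z‖ ^ 2 := by
    unfold Rz
    have hpos : 0 ≤ C * ‖z‖ ^ 2 := by positivity
    have hpos2 : 0 ≤ 2 * B / δ0 ^ 2 * ‖z‖ ^ 2 := by positivity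
    by_cases h : x - z ∈ Ω
    · rw [if_pos h, Set.indicator_of_mem hx, Set.indicator_of_mem h]
      simp only [Set.indicator_of_mem hx]
      by_cases hz : ‖z‖ < δ0
      · simp only [hz, if_true]
        have h1 := taylor2 hu hC0 hC x z
        rw [lin_eq_sum] at h1
        have h2 : u x - u (x - z) - ∑ k, z k * fderiv ℝ u x (ee k) =
            -(u (x - z) - u x + ∑ i, fderiv ℝ u x (EuclideanSpace.single i 1) * z i) := by
          simp only [mul_comm (z _)]; ring
        rw [h2, abs_neg, add_mul]
        linarith
      · simp only [hz, if_false, zero_mul, Finset.sum_const_zero, sub_zero]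
        push Not at hz
        have h1 := hB x
        have h2 := hB (x - z)
        rw [Real.norm_eq_abs] at h1 h2
        have h3 : |u x - u (x - z)| ≤ |u x| + |u (x - z)| := abs_sub _ _
        have h4 : 2 * B ≤ 2 * B / δ0 ^ 2 * ‖z‖ ^ 2 := by
          rw [div_mul_eq_mul_div, le_div_iff₀ (by positivity)]
          gcongr
        rw [add_mul]
        linarith
    · rw [if_neg h, abs_zero, add_mul]; linarith
  rw [norm_mul, Real.norm_eq_abs, Real.norm_eq_abs]
  have hJ0 := kernelJ_nonneg hK.nonneg z
  rw [abs_of_nonneg hJ0]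
  calc _ ≤ kernelJ K z * ((C + 2 * B / δ0 ^ 2) * ‖z‖ ^ 2) := mul_le_mul_of_nonneg_left hRb hJ0
    _ ≤ _ := by
      have hK0 := hK.nonneg z
      have : kernelJ K z * ‖z‖ ^ 2 ≤ K z := by
        unfold kernelJ
        rcases eq_or_ne (‖z‖ ^ 2) 0 with h0 | h0
        · rw [h0, mul_zero]; exact hK0
        · rw [div_mul_cancel₀ _ h0]
      have h5 : 0 ≤ C + 2 * B / δ0 ^ 2 := by positivity
      nlinarith

lemma pv_classical {m : ℕ} {Ω : Set (EV m)} (hΩ : IsOpen Ω) {K : EV m → ℝ} {m0 : ℝ}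
    (hK : KerOK K m0) {δ0 : ℝ} (hδ0 : 0 < δ0) {u : EV m → ℝ}
    (hu : ContDiff ℝ 2 u) (hc : HasCompactSupport u) {x : EV m} (hx : x ∈ Ω) :
    Tendsto (fun r : ℝ => ∫ y in Ω ∩ {y : EV m | r ≤ dist x y}, kernelJ K (x - y) * (u x - u y))
      (𝓝[>] 0) (𝓝 (Ldef Ω K δ0 (Ω.indicator u)
        (fun i => Ω.indicator fun x => fderiv ℝ u x (ee i)) x)) := by
  set U1 : Fin m → EV m → ℝ := fun i => Ω.indicator fun x => fderiv ℝ u x (ee i) with hU1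
  set R : EV m → ℝ := fun z => Rz Ω δ0 (Ω.indicator u) U1 x z with hR
  have hRi : Integrable fun z => kernelJ K z * R z := Rz_classical_int hΩ hK hδ0 hu hc hx
  have hJ := hK.measJ
  have hnm : ∀ r : ℝ, MeasurableSet {z : EV m | r ≤ ‖z‖} := fun r =>
    measurableSet_le measurable_const measurable_norm
  have hsm : MeasurableSet {z : EV m | x - z ∈ Ω} := hΩ.measurableSet.preimage (by fun_prop)
  have hsp : MeasurableSet {z : EV m | x + z ∈ Ω} := hΩ.measurableSet.preimage (by fun_prop)
  have hlt : MeasurableSet {z : EV m | ‖z‖ < δ0} := measurableSet_lt measurable_norm measurable_const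
  -- dominated convergence
  have hdc : Tendsto (fun r : ℝ => ∫ z in {z : EV m | r ≤ ‖z‖}, kernelJ K z * R z) (𝓝[>] 0)
      (𝓝 (∫ z, kernelJ K z * R z)) := by
    simp only [← integral_indicator (hnm _)]
    refine tendsto_integral_filter_of_dominated_convergence (fun z => ‖kernelJ K z * R z‖)
      (Eventually.of_forall fun r => hRi.1.indicator (hnm r))
      (Eventually.of_forall fun r => ae_of_all _ fun z => norm_indicator_le_norm_self _ _)
      hRi.norm (ae_of_all _ fun z => ?_)
    rcases eq_or_ne z 0 with rfl | hz
    · have h0 : kernelJ K (0 : EV m) = 0 := by simp [kernelJ]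
      refine tendsto_const_nhds.congr fun r => ?_
      simp [Set.indicator, h0]
    · refine tendsto_const_nhds.congr' ?_
      have : ∀ᶠ r in 𝓝[>] (0:ℝ), r < ‖z‖ :=
        nhdsWithin_le_nhds (Iio_mem_nhds (norm_pos_iff.2 hz))
      filter_upwards [this] with r hr
      rw [Set.indicator_of_mem]
      exact hr.le
  obtain ⟨τ, hτ, hball⟩ := Metric.isOpen_iff.1 hΩ x hx
  have hone : ∀ z, x + z ∉ Ω → τ ≤ ‖z‖ := fun z hz => by
    by_contra h
    push Not at h
    exact hz (hball (by rwa [Metric.mem_ball, dist_eq_norm, add_sub_cancel_left]))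
  have hlim := hdc.add_const (∑ i, U1 i x * bfun Ω K δ0 x i)
  refine hlim.congr' ?_
  have hev : ∀ᶠ r in 𝓝[>] (0:ℝ), r < min τ δ0 :=
    nhdsWithin_le_nhds (Iio_mem_nhds (lt_min hτ hδ0))
  filter_upwards [hev, self_mem_nhdsWithin] with r hr hr0
  have hr0 : 0 < r := hr0
  have hrτ : r < τ := hr.trans_le (min_le_left _ _)
  -- change of variables
  set E : Set (EV m) := {z | x - z ∈ Ω} ∩ {z | r ≤ ‖z‖} with hE
  have hEm : MeasurableSet E := hsm.inter (hnm r)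
  have hdm : MeasurableSet {y : EV m | r ≤ dist x y} :=
    measurableSet_le measurable_const (by fun_prop)
  have ecv : ∫ y in Ω ∩ {y : EV m | r ≤ dist x y}, kernelJ K (x - y) * (u x - u y) =
      ∫ z in E, kernelJ K z * (u x - u (x - z)) := by
    rw [← integral_indicator (hΩ.measurableSet.inter hdm), ← integral_indicator hEm,
      ← integral_sub_left_eq_self _ volume x]
    congr 1; funext z
    have hiff : x - z ∈ Ω ∩ {y : EV m | r ≤ dist x y} ↔ z ∈ E := by
      simp [hE, dist_eq_norm]
    by_cases hz : z ∈ E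
    · rw [Set.indicator_of_mem hz, Set.indicator_of_mem (hiff.2 hz), _root_.sub_sub_cancel]
    · rw [Set.indicator_of_notMem hz, Set.indicator_of_notMem (fun h => hz (hiff.1 h))]
  rw [ecv]
  -- the first-order pieces
  have hEl : ∀ i, IntegrableOn (fun z : EV m => kernelJ K z * z i) E := fun i =>
    integrableOn_first' hK hr0 hEm (fun z hz => hz.2) (g := fun z => z i) (by fun_prop) 1
      (fun z => by rw [one_mul]; exact abs_coord_le z i)
  have e1 : ∫ z in {z : EV m | r ≤ ‖z‖}, kernelJ K z * R z = ∫ z in E, kernelJ K z * R z := by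
    refine setIntegral_eq_of_subset_of_forall_sdiff_eq_zero (hnm r) Set.inter_subset_right ?_
    intro z hz
    have : x - z ∉ Ω := fun h => hz.2 ⟨h, hz.1⟩
    simp only [hR, Rz, if_neg this, mul_zero]
  have e2 : ∀ i, bfun Ω K δ0 x i = ∫ z in E ∩ {z | ‖z‖ < δ0}, kernelJ K z * z i := by
    intro i
    have hd : E ∩ {z | ‖z‖ < δ0} = (E ∩ {z | ‖z‖ < δ0} ∩ {z | x + z ∈ Ω}) ∪ oneSided Ω δ0 x := by
      ext z
      simp only [hE, oneSided, Set.mem_inter_iff, Set.mem_union, Set.mem_ofPred_eq]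
      have := hone z
      constructor
      · rintro ⟨⟨h1, h2⟩, h3⟩
        by_cases h4 : x + z ∈ Ω
        · exact Or.inl ⟨⟨⟨h1, h2⟩, h3⟩, h4⟩
        · exact Or.inr ⟨h3, h1, h4⟩
      · rintro (⟨h, _⟩ | ⟨h1, h2, h3⟩)
        · exact h
        · exact ⟨⟨h2, hrτ.le.trans (this h3)⟩, h1⟩
    have hdisj : Disjoint (E ∩ {z | ‖z‖ < δ0} ∩ {z | x + z ∈ Ω}) (oneSided Ω δ0 x) := by
      rw [Set.disjoint_left]
      rintro z hz1 hz2
      exact hz2.2.2 hz1.2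
    have hi : IntegrableOn (fun z : EV m => kernelJ K z * z i) (E ∩ {z | ‖z‖ < δ0}) :=
      (hEl i).mono_set Set.inter_subset_left
    have hi1 := hi.mono_set (s := E ∩ {z | ‖z‖ < δ0} ∩ {z | x + z ∈ Ω}) Set.inter_subset_left
    have hi2 : IntegrableOn (fun z : EV m => kernelJ K z * z i) (oneSided Ω δ0 x) :=
      hi.mono_set (by rw [hd]; exact Set.subset_union_right)
    rw [hd, setIntegral_union hdisj (meas_oneSided hΩ δ0 x) hi1 hi2,
      odd_zero hK ((hEm.inter hlt).inter hsp) (fun z => by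
        simp only [hE, Set.mem_inter_iff, Set.mem_ofPred_eq, sub_neg_eq_add, norm_neg,
          ← sub_eq_add_neg]
        tauto) i, zero_add]
    rfl
  have e3 : ∀ i, ∫ z in E ∩ {z | ‖z‖ < δ0}, kernelJ K z * z i =
      ∫ z in E, kernelJ K z * (if ‖z‖ < δ0 then z i else 0) := fun i => by
    rw [Set.inter_comm, ← Measure.restrict_restrict hlt, ← integral_indicator hlt]
    congr 1; funext z
    simp only [Set.indicator, Set.mem_ofPred_eq]
    split_ifs <;> simp
  have hi3 : ∀ i, IntegrableOn (fun z : EV m => kernelJ K z * (if ‖z‖ < δ0 then z i else 0)) E :=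
    fun i => integrableOn_first' hK hr0 hEm (fun z hz => hz.2)
      (g := fun z => if ‖z‖ < δ0 then z i else 0)
      (Measurable.ite hlt (by fun_prop) measurable_const) 1
      (fun z => by
        rw [one_mul]
        split_ifs
        · exact abs_coord_le z i
        · simp)
  simp only [e2, e3, e1]
  simp only [← integral_const_mul]
  rw [← integral_finsetSum _ fun i _ => (hi3 i).const_mul (U1 i x),
    ← integral_add hRi.integrableOn (integrable_finsetSum _ fun i _ => (hi3 i).const_mul (U1 i x))]
  refine setIntegral_congr_fun hEm fun z hz => ?_
  have hz1 : x - z ∈ Ω := hz.1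
  simp only [hR, Rz, if_pos hz1, Set.indicator_of_mem hx, Set.indicator_of_mem hz1]
  rw [mul_sub (kernelJ K z), Finset.mul_sum]
  have : ∑ i, kernelJ K z * ((if ‖z‖ < δ0 then z i else 0) * U1 i x) =
      ∑ i, U1 i x * (kernelJ K z * if ‖z‖ < δ0 then z i else 0) :=
    Finset.sum_congr rfl fun i _ => by ring
  rw [this]; ring

theorem nlOp_main (n : ℕ) (Ω : Set (EV (n + 1)))
    (hΩ : IsGraphDomain 3 Ω) (hcpt : IsCompact (frontier Ω))
    (ρ : EV (n + 1) → ℝ) (hρ1 : A1 ρ) (hρ2 : A2 ρ)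
    (p : ℝ≥0∞) (hp1 : 1 ≤ p) (hp : p ≠ ⊤) :
    ∃ c : ℝ, 0 < c ∧ ∀ ε : ℝ, 0 < ε → ε ≤ 1 →
      ∃ L : (EV (n + 1) → ℝ) → EV (n + 1) → ℝ, IsNLExtOn Ω (momentum ρ) ρ p ε c L := by
  classical
  obtain ⟨δ0, c, hδ0, hc, H⟩ := global_bound hΩ hcpt hρ1 hρ2 hp1 hp
  have hΩo := hΩ.1
  have hΩm := hΩo.measurableSet
  have hex : ∀ u : EV (n+1) → ℝ, ∃ U0 U1 U2,
      (∃ U0 U1 U2, SobData Ω 0 p U0 U1 U2 ∧ U0 =ᵐ[volume.restrict Ω] u) →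
        SobData Ω 0 p U0 U1 U2 ∧ U0 =ᵐ[volume.restrict Ω] u := fun u => by
    by_cases h : ∃ U0 U1 U2, SobData Ω 0 p U0 U1 U2 ∧ U0 =ᵐ[volume.restrict Ω] u
    · obtain ⟨U0, U1, U2, h⟩ := h
      exact ⟨U0, U1, U2, fun _ => h⟩
    · exact ⟨0, 0, 0, fun h' => absurd h' h⟩
  choose U0 U1 U2 hU using hex
  set C : ℝ := 2 * c * (1 + ((n + 1 : ℕ) : ℝ) + ((n + 1 : ℕ) : ℝ) * ((n + 1 : ℕ) : ℝ)) with hCd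
  have hC0 : 0 ≤ C := by positivity
  refine ⟨C + 1, by linarith, fun ε hε _ => ?_⟩
  have hK := kerOK_scaled hρ1 hε
  have hb : ∀ U0 U1 U2, SobData Ω 0 p U0 U1 U2 →
      eLpNorm (fun x => ∫⁻ z, ‖kernelJ (scaled ρ ε) z * Rz Ω δ0 U0 U1 x z‖ₑ) p
          (volume.restrict Ω) ≤ ENNReal.ofReal c * SobW p U0 U1 U2 := fun U0 U1 U2 hu =>
    (H ε hε U0 U1 U2).1 0 hu
  have data : ∀ u, MemWN Ω (momentum ρ) 2 p u →
      SobData Ω 0 p (U0 u) (U1 u) (U2 u) ∧ U0 u =ᵐ[volume.restrict Ω] u := fun u hu => by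
    obtain ⟨⟨D, hD⟩, hN⟩ := hu
    obtain ⟨V0, V1, V2, hV, hVu, _⟩ := sob_of_derivs hΩm hD
    exact hU u ⟨V0, V1, V2, (hV _ hN).zero, hVu⟩
  have bound : ∀ u D, MemWN Ω (momentum ρ) 2 p u → IsSobDerivs Ω 2 p u D →
      eLpNorm (Ldef Ω (scaled ρ ε) δ0 (U0 u) (U1 u)) p (volume.restrict Ω) ≤
        ENNReal.ofReal (C + 1) * WNormD 2 p (volume.restrict Ω) D ∧
      eLpNorm (Ldef Ω (scaled ρ ε) δ0 (U0 u) (U1 u)) p (volume.restrict Ω) < ⊤ := by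
    intro u D hu hD
    obtain ⟨hd, hdu⟩ := data u hu
    obtain ⟨V0, V1, V2, hV, hVu, hW⟩ := sob_of_derivs hΩm hD
    have hV := hV _ hu.2
    have hcg := Ldef_congr hΩo hK hp1 hp hb hV.zero hd (hdu.trans hVu.symm)
    rw [eLpNorm_congr_ae hcg]
    have h1 := Ldef_bound hΩo hK hc hp1 hV.m0 hV.m1 (hb _ _ _ hV.zero) ((H ε hε V0 V1 V2).2 hV)
    refine ⟨h1.trans ?_, h1.trans_lt (ENNReal.mul_lt_top ENNReal.ofReal_lt_top
      (lt_top_iff_ne_top.2 (SobW_ne_top hV)))⟩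
    refine (mul_le_mul' le_rfl hW).trans ?_
    rw [← mul_assoc, ← ENNReal.ofReal_mul (by positivity)]
    exact mul_le_mul' (ENNReal.ofReal_le_ofReal (by rw [hCd]; linarith)) le_rfl
  refine ⟨fun u => Ldef Ω (scaled ρ ε) δ0 (U0 u) (U1 u), ?_, ?_, ?_, ?_⟩
  · intro u hu huc huN
    obtain ⟨hd, hdu⟩ := data u huN
    have hcl := sob_classical hΩo (p := p) hu huc
    have hcg := Ldef_congr hΩo hK hp1 hp hb hcl hd
      (hdu.trans (indicator_ae_eq_restrict hΩm).symm)
    filter_upwards [hcg, ae_restrict_mem hΩm] with x hx hxΩ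
    unfold pvAt
    simp only [hx]
    exact pv_classical hΩo hK hδ0 hu huc hxΩ
  · intro u v hu hv a b
    obtain ⟨hdu, hu0⟩ := data u hu
    obtain ⟨hdv, hv0⟩ := data v hv
    have hcomb : (fun x => a * U0 u x + b * U0 v x) =ᵐ[volume.restrict Ω]
        fun x => a * u x + b * v x := by
      filter_upwards [hu0, hv0] with x h1 h2
      rw [h1, h2]
    obtain ⟨hdw, hw0⟩ := hU (fun x => a * u x + b * v x)
      ⟨_, _, _, hdu.lin hp1 hdv a b, hcomb⟩
    exact Ldef_lin hΩo hK hp1 hp hb hdu hdv hdw a b (hw0.trans hcomb.symm)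
  · intro u hu
    obtain ⟨D, hD⟩ := hu.1
    obtain ⟨hd, _⟩ := data u hu
    exact ⟨(meas_Ldef hΩo hK δ0 hd.m0 hd.m1).aestronglyMeasurable, (bound u D hu hD).2⟩
  · intro u D hu hD
    exact (bound u D hu hD).1

/-- bounded extension on a domain with compact `C³` boundary: let
`Ω ⊂ ℝⁿ` be a domain with compact boundary of class `C³`, `p ∈ [1,∞)`, and let `ρ`
satisfy (A1) and (A2). Then for every `ε ∈ (0,1]` the nonlocal operator
`u ↦ P.V. ∫_Ω J_ε(·-y)(u(·)-u(y)) dy` extends to a bounded linear operator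
`L_ε^Ω : W^{2,p}_M(Ω) → L^p(Ω)` with `‖L_ε^Ω u‖_{L^p(Ω)} ≤ c_Ω ‖u‖_{W^{2,p}(Ω)}`,
where `c_Ω > 0` depends only on `Ω`, `ρ` and `p` (in particular not on `ε`). -/
theorem nlOp_extension_domain (n : ℕ) (Ω : Set (EV (n + 1)))
    (hΩ : IsGraphDomain 3 Ω) (hconn : IsConnected Ω) (hcpt : IsCompact (frontier Ω))
    (ρ : EV (n + 1) → ℝ) (hρ1 : A1 ρ) (hρ2 : A2 ρ)
    (p : ℝ≥0∞) (hp1 : 1 ≤ p) (hp : p ≠ ⊤) :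
    ∃ c : ℝ, 0 < c ∧ ∀ ε : ℝ, 0 < ε → ε ≤ 1 →
      ∃ L : (EV (n + 1) → ℝ) → EV (n + 1) → ℝ,
        IsNLExtOn Ω (momentum ρ) ρ p ε c L := by
  exact nlOp_main n Ω hΩ hcpt ρ hρ1 hρ2 p hp1 hp
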